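/- In the Maker-Breaker Fixed Hamiltonian Path game on E(K_n) with two predetermined distinct vertices u and v, Maker as first player has a winning strategy if and only if n ≥ 7, and Maker as second player has a winning strategy if and only if n ≥ 8, for all n ≥ 4. -/

import Mathlib

/-- `MakerWins X F t M B` : in the Maker-Breaker positional game on board `X` with
winning sets `F`, from the position where Maker has claimed the elements of `M`,
Breaker has claimed the elements of `B`, and it is Maker's turn iff `t = true`,
Maker has a winning strategy (he can ensure to claim all elements of some winning set). -/
inductive MakerWins {α : Type} [DecidableEq α] (X : Finset α) (F : Set (Finset α)) :
    Bool → Finset α → Finset α → Prop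
  | claim {t : Bool} {M B : Finset α} (A : Finset α) (hA : A ∈ F) (hAM : A ⊆ M) :
      MakerWins X F t M B
  | makerMove {M B : Finset α} (e : α) (he : e ∈ X) (heM : e ∉ M) (heB : e ∉ B)
      (h : MakerWins X F false (insert e M) B) : MakerWins X F true M B
  | breakerMove {M B : Finset α} (e : α) (he : e ∈ X) (heM : e ∉ M) (heB : e ∉ B)
      (h : ∀ f ∈ X, f ∉ M → f ∉ B → MakerWins X F true M (insert f B)) :
      MakerWins X F false M B

/-- Maker, moving first, has a winning strategy in the game `(X, F)`. -/
def MakerWinsFirst {α : Type} [DecidableEq α] (X : Finset α) (F : Set (Finset α)) : Prop :=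
  MakerWins X F true ∅ ∅

/-- Maker, moving second (Breaker moves first), has a winning strategy in `(X, F)`. -/
def MakerWinsSecond {α : Type} [DecidableEq α] (X : Finset α) (F : Set (Finset α)) : Prop :=
  MakerWins X F false ∅ ∅

/-- The board of games played on the edge set of the complete graph `K_n`. -/
def Board (n : ℕ) : Finset (Sym2 (Fin n)) := (⊤ : SimpleGraph (Fin n)).edgeFinset

/-- Edge sets of Hamiltonian cycles of `K_n`: the winning sets of the Hamiltonicity game. -/
def HamCycles (n : ℕ) : Set (Finset (Sym2 (Fin n))) :=
  {H | ∃ (a : Fin n) (p : (⊤ : SimpleGraph (Fin n)).Walk a a),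
    p.IsHamiltonianCycle ∧ H = p.edges.toFinset}

/-- Edge sets of Hamiltonian paths of `K_n`: the winning sets of the Hamiltonian Path game. -/
def HamPaths (n : ℕ) : Set (Finset (Sym2 (Fin n))) :=
  {H | ∃ (a b : Fin n) (p : (⊤ : SimpleGraph (Fin n)).Walk a b),
    p.IsHamiltonian ∧ H = p.edges.toFinset}

/-- Edge sets of Hamiltonian paths of `K_n` with endpoints `u` and `v`:
the winning sets of the Fixed Hamiltonian Path game. -/
def FixedHamPaths (n : ℕ) (u v : Fin n) : Set (Finset (Sym2 (Fin n))) :=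
  {H | ∃ p : (⊤ : SimpleGraph (Fin n)).Walk u v, p.IsHamiltonian ∧ H = p.edges.toFinset}

/-! ### The certificate checker -/

namespace FHP

/-- Evaluate the natural number `a` before passing it on. -/
noncomputable def force {β : Type} (a : ℕ) (d : β) (f : ℕ → β) : β :=
  Nat.rec d (fun k _ => f (Nat.succ k)) a

/-- `l[i]`, with default value `d`. -/
noncomputable def lget {β : Type} (d : β) (l : List β) : ℕ → β :=
  List.rec (fun _ => d) (fun h _ ih i => Nat.rec h (fun j _ => ih j) i) l

/-- Delta swap: exchange the bits of `x` in the mask `m` with those `s` places higher. -/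
def dsw (s m x : ℕ) : ℕ :=
  (fun t => Nat.xor (Nat.xor x t) (Nat.shiftLeft t s)) (Nat.land (Nat.xor (Nat.shiftRight x s) x) m)

/-- Exchange vertices `i` and `i + d` in a pair of `8 × 8` bit matrices. -/
def sw (i d x : ℕ) : ℕ :=
  dsw d (Nat.shiftLeft 1334440654591915542993625911497130241 i)
    (dsw (Nat.mul 8 d) (Nat.shiftLeft 4703919738795935662335 (Nat.mul 8 i)) x)

/-- Exchange if `d ≠ 0`, then continue with `f`. -/
noncomputable def swC {β : Type} (i d x : ℕ) (z : β) (f : ℕ → β) : β :=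
  Nat.rec (f x) (fun k _ => force (sw i (Nat.succ k) x) z f) d

/-- Apply the vertex permutation coded by `r` (mixed radix) to `x`, then continue with `f`. -/
noncomputable def permL {β : Type} (N : ℕ) (z : β) (f : ℕ → β) (fuel : ℕ) : ℕ → ℕ → ℕ → β :=
  Nat.rec (fun _ _ x => f x)
    (fun _ ih i r x => swC i (Nat.mod r (Nat.sub N i)) x z
      (fun y => ih (Nat.succ i) (Nat.div r (Nat.sub N i)) y)) fuel

noncomputable def permC {β : Type} (N idx x : ℕ) (z : β) (f : ℕ → β) : β :=
  swC 0 (Nat.mod idx 2) x z (fun y => permL N z f (Nat.sub N 3) 2 (Nat.div idx 2) y)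

/-- The edge with code `m = 8 * i + j`, as a symmetric `8 × 8` bit matrix. -/
def ebit (m : ℕ) : ℕ :=
  Nat.lor (Nat.shiftLeft 1 m) (Nat.shiftLeft 1 (Nat.add (Nat.mul 8 (Nat.mod m 8)) (Nat.div m 8)))

/-- Final step of a node. -/
noncomputable def fin (w0 acc I : ℕ) : ℕ :=
  (fun O zI => Bool.rec w0
      ((fun P => Nat.xor (Nat.lor acc P) P) (Nat.shiftLeft O 64))
      (Nat.beq (Nat.land zI O) zI))
    (Nat.mod acc 18446744073709551616) (Nat.shiftRight I 64)

/-- Is `m = 8 * i + j` the code of an edge with `i < j < N`? -/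
def okE (N m : ℕ) : Bool :=
  Bool.rec false (Nat.ble (Nat.succ (Nat.mod m 8)) N) (Nat.ble (Nat.succ (Nat.div m 8)) (Nat.mod m 8))

/-- Run through the branches of a node. -/
noncomputable def node (N w0 : ℕ) (tbl : List (List ℕ)) (fuel : ℕ) : ℕ → ℕ → ℕ → ℕ :=
  Nat.rec (fun _ _ _ => w0)
    (fun _ ih code acc I => force code (fin w0 acc I) (fun code =>
      Bool.rec w0
        (permC N (Nat.mod (Nat.div code 64) 2048)
          (lget w0 (lget [] tbl (Nat.mod (Nat.div code 131072) 64))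
            (Nat.mod (Nat.div code 8388608) 64)) w0
          (fun v => force (ebit (Nat.mod code 64)) w0 (fun b =>
            force (Nat.lor v (Nat.mul b 18446744073709551617)) w0 (fun v =>
              force (Nat.lor acc (Nat.xor v b)) w0 (fun acc =>
                force (Nat.succ (Nat.land I v)) w0 (fun I =>
                  ih (Nat.div code 536870912) acc (Nat.pred I)))))))
        (okE N (Nat.mod code 64)))) fuel

/-- Run through a chunk of nodes. -/
noncomputable def chunk (N w0 : ℕ) (closed : List (List ℕ)) (codes : List ℕ) :
    List ℕ → List ℕ :=
  List.rec (fun cur => cur)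
    (fun c _ ih cur => force (node N w0 (cur :: closed) 30 c 0 340282366920938463463374607431768211455)
      cur (fun w => ih (w :: cur))) codes

/-- Run through all chunks. -/
noncomputable def run (N w0 : ℕ) (chunks : List (List ℕ)) : List (List ℕ) → List (List ℕ) :=
  List.rec (fun closed => closed)
    (fun c _ ih closed => ih (chunk N w0 closed c [] :: closed)) chunks

/-- The last table entry. -/
noncomputable def result (N w0 : ℕ) (leaves : List ℕ) (chunks : List (List ℕ)) : ℕ :=
  lget w0 (lget [] (run N w0 chunks [leaves]) 0) 0

end FHP
namespace FHP

def brk4_0 : List ℕ :=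
  [4573969982291978, 20271268164627149945684623362]

def brk4_leaves : List ℕ :=
  [197636, 16842764]

def brk4_cert : List (List ℕ) :=
  [brk4_0]

theorem brk4_run : result 4 197636 brk4_leaves brk4_cert =
    932138696681602413955645440 := by
  decide +kernel

def brk5_0 : List ℕ :=
  [4573970519162890, 40233051298103906947689349122, 116156841672891695124]

def brk5_leaves : List ℕ :=
  [17181115396, 21475950612]

def brk5_cert : List (List ℕ) :=
  [brk5_0]

theorem brk5_run : result 5 17181115396 brk5_leaves brk5_cert =
    1195573366679755949885479714816 := by
  decide +kernel

def brk6_0 : List ℕ :=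
  [4573979645968412, 260586378312518874752536805405,
   40810363746874047285443164393242277848452956197]

def brk6_leaves : List ℕ :=
  [26560883064832, 30924303499264]

def brk6_cert : List (List ℕ) :=
  [brk6_0]

theorem brk6_run : result 6 26560883064832 brk6_leaves brk6_cert =
    571409668973231011087446441984000 := by
  decide +kernel

def brk7_0 : List ℕ :=
  [4573971592904716, 802804115496745237357923401742, 13581183749324837, 24704450570,
   18084770491794205, 70473467691054, 297569836944957170481784422446, 22588373323481118,
   13583936269582340, 7788648014990797544813661121418277,
   2245152949893413715056130410947274022360103966998550, 9077730175891460,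
   11682870666145546966370762868391957, 22589196891848742, 9077730209445916, 22589196883460134,
   2993338977589655624839990096322870641970928324445478, 12092958254521796916155430,
   3414007996717343794308062757, 7255037047822379571486245, 10384599609374111070066898630608430,
   1122548420609035353755653131703795143605236006912022,
   93286131269973049508947776012412687465816849324483687386304728053648048627817314779174,
   13581453333896094, 12982725945250029414637822850110484, 14279413548565825817086746370772371,
   20769669959956073206147800180457491,
   57953619094621824358038421530749041446868735279033036897183858169643702166292,
   107922306352057030576852759273372044265852676367881207567178029599891,
   13241484596478359233794688051721783119719069,
   173719192038079163814791808354925045043090090777107732562406945876622075495061,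
   3145180948706131452128745592057072173716188087834119134310937783622691303373817133122113056319998539538625098929626840825876]

def brk7_leaves : List ℕ :=
  [6192750140740608, 6474216527578180, 14725089221148672, 16959143302660096, 16114774472392784,
   4503939199275024]

def brk7_cert : List (List ℕ) :=
  [brk7_0]

theorem brk7_run : result 7 6192750140740608 brk7_leaves brk7_cert =
    329050362302873038415381759707381764 := by
  decide +kernel

def mak7_0 : List ℕ :=
  [75386876732619, 76418205614100, 76456860319757, 76456860460244, 2763811455006,
   18017505951875742, 2014070418662019905448050718, 75353590728899, 36507222028,
   2417915653400012905250902, 1298098663949504698901643025978388, 76176613837638, 75386876592157,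
   76418205614100, 71918153764238, 15569396894, 71577777614492, 2759516487702,
   8367688118509245532, 75328357805086, 2752000294916,
   1294837443694469355448590071455757905795481667, 9009951271813196, 8453259264562036830,
   3894237034954081255516813991608414,
   10338355438771956460378283307368519731384910527729814876859772620793637549764627951633039365,
   74493036857924, 71641665110044, 24663870033211650217568685898334221, 112590668215493654,
   2147617606, 121598084366076227, 24696195910, 4492368354069162103586947118,
   32452315267821469205481937075963013, 4835723175361677619106198,
   115807197375777753912182384298240007593148615127542232480604915244381459447854, 76466716939356,
   6491111068753357163986010062719534, 26597125527974515671305860, 21760705510642738930914206,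
   183014951102609093073734575041249727476604278275908670178374597004528459993073466115885614,
   171137680585797764, 15577230414324416239813002272964637, 26597752739792011525095837,
   70546985454925, 33851823828541575991918598, 36270266632775921498593282,
   22068234205416387055474587396477122, 13512037468473675, 24664153506974571954204617903964188,
   2418191854657320005928259, 113640100855053444433577165,
   51622888431597331645600945686838424470519412256439073645789197, 108803447907043114085253278,
   58029824184877541532634756,
   759192098739721354695266742853830737041356046442563629650997531553830045,
   33850348219620584715190341, 106386967803050076615480325, 29014233046446605623890846]

def mak7_1 : List ℕ :=
  [904819055671896849733805954071874055748414815223685188754230441670539870238,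
   2158483575125696045696421112104003251057294220861674177409762627554948,
   5239751293980814410813277790551050699839203206295245051744698680375776217002165329218407566550385051704605940469626784906180295446536940290069,
   193727298057542557, 141977123291138, 50645775425915630882887367709949990,
   1299264462590257782793230698555078,
   28835009230930504729403970518950851120498774033628293194831735038862619678332815910,
   126172363703325443, 37666564819303763455373827775794918,
   275457487439670811379924795135903644819523919090168475188623039615861955275738441512906787366,
   180220063360624725, 50645633984012461365598413807157254, 35070104562167167954197633132793702,
   133020729600650866667425547,
   21568086173192142458833898125826144400883921821363090600681320053082662,
   100139968659053780496102226742998533113046728175367338994351754057170713843766918443097626118476,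
   87122773928009035205114466889993447481454562251719023095135325538419401326627790643153700337577211266692977924182269050926630862976846250775196,
   16877134466335638824620383279388165, 22089416312124381964119262076473518,
   2158580051665388329072423398883053425381848926178971878215579678679846, 144764691296853,
   54540648948226196208905751575396390, 41144744242270094911080326, 142699676176387,
   18827432354544729862660606225733287623524381,
   83036738116264659003960161610234545656699259785445663928413268327146278,
   53194416590329703152354189,
   927324845226738196541068631083314208409530780498738172648228522093161065096003,
   539302137934630663365941196005764668338562872564688016840673927888924,
   122991253006651403991460025210874426108045143601149136635817832041387783717494969517441086866166433354346985823297152127233484395781836738010398,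
   3144077330922729033864386948434512096931812282396382700347773195925545683850379911091944536696186326049021501565961067791481527532963302095919069031761704910886]

def mak7_leaves : List ℕ :=
  [9658282273226756]

def mak7_cert : List (List ℕ) :=
  [mak7_0, mak7_1]

theorem mak7_run : result 7 9658282273226756 mak7_leaves mak7_cert =
    329050361056470592179675375491088384 := by
  decide +kernel

def mak8_0 : List ℕ :=
  [91858613257126, 5368885771, 108859167342647, 98558762163238, 108868294148143, 94862405795854,
   74237436146231, 95456722079053, 3221409038, 9007205160321052, 4503624860474487,
   108859167556518, 22519478868771267, 13551331295417597980,
   29747637075563377605439786083866654777954001549409991513237094431, 79340394135823,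
   78464220836471, 1619001372, 9007214303907367, 91848949543435, 79310329217079,
   4337625844542298807617978381, 84120818426955, 11811362830, 41339262990, 9034220869173379094,
   113883205496415, 25961911737411890721573425939220813, 3389030987, 94593499680244227,
   6431140270586202371, 85574823560006926, 9007211065901084, 114850822927382, 5368911886,
   81064833625107791, 3476870660386711260419325999, 2417857989304749811302447,
   4835725481204682386833455, 14279173414793750519353921083801606, 144133056851083270,
   15576897848502227283567904376759327,
   283222831427195883134027713424520257044002676150822920135901189, 135113042680664708,
   162158519766755658, 3485148012306778189055618493267362954880131, 98585068893259, 4025458098182,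
   58547634822068684, 112590830350514636, 466645367244945204573119619, 18018080940628611,
   8079457771868659423, 55624318434474813646974285, 58042170082711309914221829,
   74956743455304462580591877, 40536040464711686, 148649782955474950,
   7173769135695998838135324718, 26596381447751358341983493]

def mak8_1 : List ℕ :=
  [485771031569252900807809923331203471650329479144162307604507873075653085899945803822,
   77411000433085536167716782, 87080439497928500712703534, 7294685982411723202756685,
   750165818448519715835608435832764334579625334119858179, 58636459846019439, 162230950607068527,
   1005720793473144530041493816912999373222829969312738623630620, 72581012654898479678752671,
   72581012781030238954061871, 13591215702555084, 144186819003813071,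
   515905439425928027903923691968678784178547851311, 2418295914930301640534053,
   79722072052138560176188004744416953980740303288683949081685628858199500709,
   125766508681660862461817035, 151774052924069, 1085624638731510499535487013, 168950055079327,
   6979642250, 1211543000090542086, 180427405001659663688735867488473520192690943718290620447,
   72573452385648980049038431, 148681466714827, 142497888075823, 216274193136885471,
   3792107459615653925, 32473591049393085446895829948441775,
   81189757810299536257389652154203259589469405184000028,
   1725456398439061039336900916451881175203050578505949427052667172029957, 193731377739623948,
   72582564739374906737688581, 38969881458588363203243123373244447, 149725244575854, 4194453871,
   1787488740470671240572990128156, 50825954081735436342001711,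
   475854530008789395354521792494381940087764862410855470996652079, 41105447025403427022831663,
   6360456374505822962081434732155577312090867336621349, 238761155168967299,
   31174067103003056892135401051914287, 87080439398850155757305933,
   2576677316855511770864374183337525295, 5244383343935267494111232095357348328066966217555971,
   211739794701687427, 3927994285450855942813505364663731758,
   696939437726472057626417721961598849002798, 18119357844089651607211627150694786908815363,
   339182267608644257028269989106391456036902685184531333730983529660469647904075095214597169159710143522392099795108584826408506290100101916805946551222387319837680599077,
   137872562723853129157223735, 165104129713429, 137872373644712277341896759, 238777684526760269,
   234258936012896335, 53244614880497542095757835436689959, 1298117472472214566435900140742422,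
   58190383503102763443653975736687168824564424500125261632945164861876392200215, 168953813202030,
   154991947939863]

def mak8_2 : List ℕ :=
  [219566781366283, 72629265090593879700275206, 239322557463951, 112736915609878534,
   117257009094722935, 1566856053622655839786500119, 13510802128502862,
   50645393272424337300194421286895639, 87130393749184108571038455,
   201603404132575347101764114892864651668563483589223645493782, 31525200638255022,
   29089790829243876765597774, 19418384411885277309567054, 4337625848874761623940630822,
   162291834989897423, 8544687715761472370137628695, 58548053002742156, 21617278213072879644,
   10429920777969085069732126847402007, 70127610231291896154011145468951334,
   45939203803036753875483430,
   193356737857160245704019634910005072284491603883915450138404420879253507,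
   24704377167362815934478241893774870, 87130414596346813121623574, 239318799359078,
   58691199472500749, 8860489993292513328086, 24704377102032233099999392554811402,
   77447559434400302742148630, 37649475533275126934073827035055833538027991,
   87130414627872010328648503,
   77870180033123900093498046990278861828703074058608820339334075298889835810390037,
   214996105562443, 220391414956055, 11137554029583010343, 234370940631409767, 234370940631445671,
   20933960364185306296739432687136085597224983,
   7872048455050628951518395291617025252087329212858371, 50654712569576716208527766982754326,
   50645393405356946718584035780748391, 943602840559554203310187314224413399817713495,
   87130414659560584744271895, 7808733773475925026540224738757159,
   6272084836316998573916516103280995988406295, 87130393915843003896079695,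
   82263000004828993406936330, 3939559567217366422899010998401079, 116112921922788031713289551,
   670840944817034870462763460494618560792317750000357379,
   749660040052056371624943079415325650052724409285142, 94346626463152057381552151,
   17422457435587055787824981090661756414769686,
   1497948863033716365120762174615573955084647334722070,
   1334499159134387842487466275029542084220942437640578809546259440444422480575943891269634625251742817337264419373031516737156492712862766202883,
   116058662973290287858977739, 63607784188277305090234237725977931, 180303044712629511,
   4931711555905776911647399, 19418566740169720378721615]

def mak8_3 : List ℕ :=
  [4122823677743746621029010901793809603663456916109735, 72650775755140549325491147,
   7371666979127984805779879, 2621193068589680427628108167125415,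
   17966424802657400006226233686449244205341230153859111, 96837229453567249755717389,
   96828377610468763111661550, 59759551016835626279647099331018759, 216390265836425326,
   96828396057212870719438855, 59759560920355942877469155973529646,
   1430126330957868541679809613445456170502566, 344592511162288894235765112693788145414981025829,
   3961892012895396817903157281737126, 87159401398614569368290023, 901952750645006355912597751,
   4183943088627646642547237136786797174456357,
   19463658186024421569637781949578338033271600664854375,
   13851494753169139776958213859218028212566500221173543,
   13851494743392253953655000152310908032684602817642542,
   8623998686743221437958622559048724094499575165482553281504484381788800644154201412537231866024724617271913830547493,
   137859808727996786207532070, 68820616769896320052721159422143022, 180371604940281166,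
   15032935372, 1088075489006320025763983271, 44157689321687291287498464256215223,
   295273096562150, 4094036583, 2628677624937230728972199981670693, 7389705413350565167375910,
   216418768850008587, 20938515404, 2283408645079643814,
   591955802989266591630659233430023703112949125696255479668277303, 291133821840023, 6551901607,
   947927091843164591987525799, 137871930819220352236970918,
   1723713806414116551563589656739982521807688455782, 2014083698867591136250167318,
   15576946002435485518162150232859414, 120474506082218049108746087319733317094712108583485462,
   32768020143421714378812100684551022956391703, 62358670562757036477789005943188007,
   171027694814189151290453302130634599833964624481082242482533910281760171909659492389,
   10391727830130760435190260224418070,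
   4964135601780989668068129811834608059579819728546111354533544802174119,
   58054376796966775129788581, 1405644565599021994771106701798593630724279,
   72671033198484801936825989, 19458780475621721719844102,
   1122435311229708739996083198007404671749028304650286, 38698910076820618024725766,
   36278881037099772441404694, 19459483838735283472444747, 58777182906110083,
   76615269137425846540921175151881547, 29129117202378231430664470, 94386651078926467772900014]

def mak8_4 : List ℕ :=
  [485752504834940205805174804456029112131005815445622924402682842913058172645297750071,
   72708812130418166405275341, 2250885445660141745196702219095074503024064478576686,
   2250884831692779957973447180004456229135971489284103, 68840899307727715124589806202559644,
   137896444317385975965155333, 35074676081381898975609991448505675,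
   499981036786924108505928967308071945014791525371671588764903023530233232027352563767,
   180446449040512334, 365559698948124, 128228831038774249030418439, 148924910424180198,
   365559698948109, 2031123474609157798,
   170619643809312785106671730533446843862182975110489486375142851102034843236734620,
   4965821421607607529903051804402817692899140119576932248208246315452583,
   19506779052462688507800855, 19497444981658972466982823, 180445803662810757,
   7676774019266866754902694568520083751316773,
   2666004637511610606478916949060543665285190330593507798384066074664158170841110,
   142745519355151838181875844, 31439857151115426068459267, 3590517470200235639450382247,
   26596370202441238320277892, 32534206752001387791874561841498727, 2096315152219789378103279639,
   2417855462799844011683751, 19516740325499669028561028,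
   170503851719644109879068085180683727329809205032773152042812276976770592553435173,
   365557291958851, 3675155414263541093, 58829274316171652,
   2135269852146062599499921316335399563427863, 58028462265008679953963722,
   46811847130443576255893876393462438, 117093633219682951,
   317588171803713794171191715185244994698742507267227387235840070625919013, 162214457622697036,
   216390922697618510, 848716989708564223423163685,
   9249561659762657751580512374542384047222677174758341016158230, 58840129720551174,
   76630766860407355013231859352993871, 1104850192792952081913712386330545127756360935463367685,
   33485622438115370754698776457667962353129207,
   6428677205711574035788927203709483695955107639270268314189846,
   9059681587019258953394614045809205443736599, 44187666194525511761297469975035911,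
   142735926188179370629136463,
   868440990321243712903854636967319978691515291866222185586738387884786808177447,
   31588538205503437626935118, 45452881004980939211398590054268951,
   1105970904066313501139675150111072113143033766386597901, 142745519530643159360104423,
   599589682796940199835269509462321888225260126887724169503440965,
   50624901561454236433268566323625997, 57115277680630261505780320685174311,
   1113836010397632083290526048781600990654717734303039557,
   374146495938297434238055705003679499718587362312205]

def mak8_5 : List ℕ :=
  [6636092984183337128082557016312013488837500537561475205693453,
   228503431181719911440992153037837872283554149460514172716314893203600741528366994795534624249763717577170829767106986253145114492834057057361606374746316503778211397655,
   1618006370403904402335826510105317386270843137395801022121056693214440479984822662760663,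
   7443017628125860302828998262833765384194275530176931687613207,
   17236552441717393647596460375846341239984181383266326,
   2219241637191920393380507536764168214602981575399260255555332, 157880736509672911,
   4816384681489741, 87232766414641311687018927, 75369479736208559407053756549824558,
   2667227739328720788421176050714897244929041266222490351237215940427421321527318,
   9253803635117060278407201438070170986084764552970509501071790,
   68880274655068097996399109539769687, 4791306560395926, 82343657082653406367055886,
   2431211558758914531004174, 592420207148768600986703382556691925377842494899579885818585808919,
   4028703352522049731521851264738498165616811809678906636813060, 94448985230410131391927885,
   1726958392932749376150526259215179707008024581, 116214362360790198715594061,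
   490729510468135419466317738235834689944701528755451252605200678,
   1178957659490220842791682692822656108568220704835465666368885855680947443744520703753646786001694392752364336746730754940448580496595766644365361242177573,
   5992158780078836368724174803633402598443640051550876,
   17216491346410298666575935808576741885396483494383407, 142770016509834691709928103,
   87139284391132162914171804, 3968247186039598468302733951740862757,
   2162301274658697879128591756594193881704078407300549141664425161523222,
   11236196856897032486299095878426852098356655258113692, 142776657387032653811298222,
   25988898150903085953039648050908996, 140286469349473054676488004,
   1727122185173747164296583847729860034821342843667681811822624897152047,
   4962315784018649872090979333181931560469256348636594163244487944700334,
   67713128504781626897800580, 94461157401957673732854405, 72548225134870514687940868,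
   3905905319180750793071158280784896293,
   2664123000598582784296855080429487319538407973473428161063883923404976476651542,
   58916423263336567, 6333603222, 4000760692137051390101992808024486,
   46737802853934299975404440611394692, 1125800559344389080410350300371606851862919350524837934,
   428679033686183, 24768127116478573564759240538921958, 19574155562140972994416638798640519,
   1125800559341601487235856251903443060051054396895920167,
   1005440788290921951257477623730978582274570710894393092819612,
   8848169089002928186540916554272883408273462162707992581157935, 77446814210315065328178908,
   180497224361707558, 229771356974350415, 48056759131853640969130732052021255,
   46134232054319635120156070,
   329344890105375421229147926026062693858433981697621040771566183274165295,
   1941116446074061017148113592301377373023283963023856486666512158031982,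
   3217015746861057948071982173440061692648221138595607000252462,
   323519966424053264938321210378312192029487060156932712908274356322350]

def mak8_6 : List ℕ :=
  [1799991353149879092194201879049423682143585539945450705854837244913307675510200189999562231221880362954646631222656276722765059554147304755346946066365664818013487,
   2272154231122566748677435406976919846237171319849310590140508692130434364892697097487962094925445517158427790215649875423091664585041789959139142526412548728659004631679007,
   117604844032466841629010817021570757040121067942782997158047219111294646720836832005524915264764471884358416424021177023254866424469969296083662628373796200362016815,
   4428654446595483023835836274355483542237132384090293434449943, 94495952694437069657002886,
   1144907446770221115563522148898104139981804777215792799,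
   20260271741127414237373316564130616870309891,
   9256942185990602463093031067031087706732959322374505280966822,
   14341788983077971175284768275694903, 27302258669210489391516799767743071,
   2377615747246789670439249241869400647740276760134626724629964006621230,
   77508980026162836102731303, 7821821220033735371598241517180559, 142818162849490381761545591,
   27233594664521556968461263175518105830617271,
   10457652616580625072904506392518249087923713735950489579067039,
   15368297422455526588013157806602500270850123, 63166092495050247,
   3219037131303979470264563388408869569486045478815308592879263, 130767868106919847,
   157925757959426071, 82367894064235494772834327, 14657901521731651003734703683874903864902967,
   75397145031705243566875303238901187, 149045199036624652, 16979272887,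
   76667520371718699189693089730695863, 142804385162945388303876102,
   31260258791585205797185286307331211607740127168889899306629566341234529210300285059118,
   19579016335569973293092868, 113725701246300637272381095, 266031857413053772,
   5998004771274587747030564292720044113879815733042535, 96949595745868608445356055,
   28595872555271297623014398349170222928758071, 36983145639736609587664789016774314503438359,
   4020689348436356074169148950095191, 41164538792650843521587498834351628636284007,
   31260496512744413893940462255749241933724741102637965495377707095012065648280384569390,
   7836962445264620665347771698256016250541384564346133965998247,
   1179216192413618109818313884203550207168690316254303338205617885068639095504518883116571515907166452394311118824298133705862384587871092907498832658563103,
   75091150990568565143776943, 50858240212004904167184071, 10410849966066679957115642128537287,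
   402838075470872040608734196574407675994422412955987216433158,
   9256942186364742516881713314868958299688351933878097549076774, 130781723897920847,
   7246456958602143753923106447,
   1739621870627489384766187227507917273536571063042050399083062419663090236830748,
   138065299242231735874386006, 1211499266959557645956500166,
   1808908864199543767688549306604049877025343868613415715995654,
   1496578957586003266324128219196503366897398658236438,
   2210643383493412301789022477098001021578915920218935789883140, 266007118208615500,
   2057332947549081240929321718117861323753896029935,
   9257218223739941521934652549780838668471106464449685013008150, 2623534979606426120140109,
   216606834730874999, 116248812024895735783751727]

def mak8_7 : List ℕ :=
  [20283033447164715023486696504814,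
   592523051183796867136685156653473561119577190397836591833775738628,
   1297448037766196717675441897689137953693388470627359489482404640764950,
   632948073859899917172186183423117311655337558210025617525287149726216310462230100843496239404900941622566845325406747254932698861029188163898224202260550486074789,
   142845574436477253974888452, 211905031061799206, 261727934708005094, 239188605079206135,
   5965032404976885417186951223, 70219342163651634986402805461595183,
   3348681362576110428762182019862704011112842435295972823725214267736110, 257063210950993551,
   104173312789514911486050327, 55762816832500688654839471,
   270440132803414245279661982727314018029010947, 72806139502978554036883532, 460219923435533,
   84789206648215606283730948,
   1194816272820649365618149896684428608052201143285754569322336350502958,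
   116301816721918513554302287, 266102226056777804,
   742676673284724381582185313024127656865552881437912707,
   1194816275047270356076394477117877240153558115644197973232720296546095,
   113752366010482028077563430, 142858856304213984350518668,
   3782910330993733154522532935532775792411359336988703,
   7744661168005215504005243301216444408440348, 128237308853389106458004007, 234703701343603222,
   239200100458301974, 3241291914264187930587376399075508263, 180657555608861983,
   180657529503613967, 15857182607281906743, 22074616156538532052451000886231068,
   13511910506927205680700618600935985793646207449432103,
   175082403501694687920483275578703591186082610036964538075587921032722275549315118,
   46880424796815060264818273604752175,
   4419080756129796267008458561679383636487051910203728537452572,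
   7859090099718767021800046398131531569402938992754701, 29937434328553784988123665648582731,
   44244915135536718456271474606616487, 142928264300009409532015910,
   44237823131780876155043517801955342,
   817135196306601372601695807501624344147338069976783073050630, 21785072840425712443600807,
   3421021577586358283548800692749627536978961779460730022920205,
   433168087697798490813472932212872243538791751802353772146408066881068219059985859973629409295892564724050318964533688282824481155481382442566553344891238887377854792670511151,
   72802664561735680131989509, 94533249579215159577935877,
   7448609650858402215271359988687542919447624827224664465747246,
   19487899024266874391174402274766444199507584646420124,
   20987161402390989308690842979411941181288597, 46204193835619085070376879,
   4228156330553010249365921907410799969902239542062423955094702, 234690828714126596,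
   11183197801546256643014233658914449985571413, 27330956273667764635581817717144725,
   149118590104031885, 1114667409202195046599444975]

def mak8_8 : List ℕ :=
  [7881400885854940119957274250729306575443747087858871,
   29345953235345334776192315311347435471511471, 9085957837447764108507521268682993171184823,
   22444551367582316272094107825594435461103127138960142977535950667301889026343521420713596886843439,
   15392812952007374891842001198891005140186517, 77571256491121755687010615,
   66290052479504846882056422485339223, 1056832319957812499228300999,
   2669702703639050729947686858237726039591102776730360885528944354512170367192854,
   130851244262094255300839846, 87346072437185417585635013,
   328809206905026857762000666168092701130197317114925303567191359187583013,
   44265131482242425443337109378978359, 94566619824888805013323781,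
   76713422032737207167288069388643630,
   298297297382583919719384076371035186923962163459285556205191190,
   31324383527398910454000897384724006, 72847017487900595131974821, 116337639456886487503122278,
   929996999859579439570302776280953724171092524214048809658320217678582603488406,
   22155527818366734005104125135600422,
   4972709604311935451647449861018434782218546356121958699123033720271919,
   82441213981785359777313870, 2468925954375113014979671, 959962690483067011023518903,
   4972709613564383381920729420225326466114776813699021653885457330247324,
   65482791072695325299846446, 7519506875772568113213371940027519573316644787716118,
   1406071293447438879226221768777143066189127285933186894191013, 116324357850456192938198092,
   142903276077472662738977463, 68859375364681883139184719718793911,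
   4972708789999220085141773729048360902489081144715412725152242817564718,
   155252116999495860970816592534863514840772459933981549896904450216399934236733947041963628524548459449858970959075444479616593508075476317912968051671688065404534652951,
   24830638393272105223604071355941479, 26559158810207585427322165504106283755634710,
   2380955907389451039931691696099886737846043251920158707228707698377134,
   16848951894385623282417029859336335510618670841246725, 116324378531165243232364804,
   15357460899929766834198981542469455657487015581627397,
   4746685478815807760481126771513284786864159672423484663974468528898053,
   72860702616836033750287436, 9045896261920524669774012189985211218865363276657529580700326,
   4856478575398246327798102183985556900752956133006108090383446665990374,
   115792411144727282050845851430099049790460436902497964517868900471643906587814,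
   1178957659490220094420361189958411426720675562971874614236309523226115369530512401581420070117176617245724867493477942314980660750208803033203751776157742,
   804573545841911165747344042558754800272777068443061474699622, 75155602360824385843533479,
   69108676784977999467633995933815291324261778121548192440431663,
   4422311036733022260969074387428746858236248902328098268405934,
   40496348497728929337639473910722198998748966,
   170753499146367049977323245527987159062116407161822294656456519216837249938613210919,
   68858781163200537021879792140629670, 158091843069759143, 5015121005036300,
   82454495619544281340848460, 1394118746543649435903768538277500571268109,
   25561618779238915573773047444919514713540632621069689367687765489699558,
   754878545448701702494692917505938614941372531786043908836261789958157,
   632948073859899919367164128580460102728031384476778695286827004479393627023474635381914406472956868842492082792000053639557862282240393833746869899138654635173349]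

def mak8_9 : List ℕ :=
  [144562143202412356, 144562181722489510, 123540449741436128420871207,
   416682428871487000472607299947462669, 40364858229977106662631974737418572,
   3908508591710867890670787324363145295,
   156155831636732731758408452011007704046104109624058990833764983086945942,
   2317892484251110303709159729392042267266378194098457307700698136701863899824174,
   215705777369296233131261363790478022232184892824820045426361606199769937424413959138208968404024905791011231388238182475236248859888366126161351374139162671,
   94598848732386959801088055, 4081526538523571733417048551892303, 48710774066214983494182223,
   1276590935629258995601181598292770418550908555634755611931674405446839185662997619802135,
   140553180229804347349959014, 26145251527937805041353044469662796,
   76730198562547080865912003979432650,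
   612456909373640355047597262130438587882397789514296283070332974,
   15365533834518211966947151688915040029991067655077935, 97062932424849470459369034,
   157862630865926151, 6085929264186740386889203751, 116377374608357750582673486,
   128424398731562919331428231, 82494505143616162051040591, 94609289693056441024198917,
   2377835913802048177824286780695856264590120102131156650271261600410291555794990,
   46913259176124300345059447034123943,
   1186238259976878529328085386351467947790217708022302545412427845209893,
   1152355019133824248151661947413946435986883055255634008944858823237026296578318039521266678238686330098470013564547235413253760554636986224520064890606627278764900380,
   128419312280827780039573551, 4078554140259741996170216045807150, 60751867894719250596765358,
   1434550047604257225849416882557107732912828439881048137008686, 116375439190734372229291494,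
   2594944744268707566731960208905901771778025922567872537368950603120646,
   138170846305663833421939246, 719439235658662, 130907037429796707491643415, 746657517175975,
   266347498451242819, 6450839563, 117673047973192741, 11812488614, 2325973292949310863935799318,
   592445918157535128727355715969143886114509648391655639679417061124, 322634729881035137493350,
   62478588051635347420523762235350766,
   610038097942320769445194130213156989341268369218615243484345383,
   3229569959316649209550085855580980755982597067573247190109956,
   2489530070766514608280568441256228307196420642015715566157690383853148032335918,
   288536027190204504821495128368204237399240035355031414443884295202517545616321118682727062862027502214124671279569912845100652428292214345533107224742933299223,
   60798478475408437619994246, 123668643930435748763999695, 75028970078952662252781591,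
   44281261185524193949397396307836983, 26151397668080234235268965656166403,
   2382669920324553491712356129236771024607640991083578447383081350507319,
   76728356548725058829288916418385349, 76728367704576263871630085047604767,
   76735775731384942064997759271054983]

def mak8_10 : List ℕ :=
  [904950625881234983710738111744121489247549850136417462767115521368915712055,
   128448375175473468116608263, 180800831574294815, 50814217337940136513048502900914223,
   5630616755839831203421657233342677419029087411050163981298487, 97075674715797945238814731,
   32824052407537546367445865213529914656304771, 76761303266432509849816159304596271,
   149326726627232103, 7785584271, 4528376758307111, 70350748960273222107922445,
   1056907877771833284468350343, 1386130694369333212424273349055735989294902071,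
   87425893061964565706617862, 76750480928678708871345685615607846, 19733454747046702029248205,
   974520501602909125769305256969311893534539195589272288749557211509799,
   339885119865555564018673865591333995638233527630741954944296352207802001705784346418978430778540221324721122784678475623800072101051882584618695473805068313306734050541596,
   72927181800322697958576773, 49517983679396939757785429860078282, 121132559717364689720761604,
   11861687391070951693439349034973705600809588528789705106128909,
   4746636216908328163315651061410729016381212051073728981406473144500237,
   288536027193409613816530190829236324197784974230598678597353135949715761092386586287484595857012479976229992597334609693015281870581832520805366161714968526895,
   116415153603270363600692559, 50814218670534160213293244976768335, 131063198841184207,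
   3870999293491006291510806053787810999, 76748638963326936448284886150420535,
   5040661140564334602586992265422318754316576131430030352842783,
   10470206830948354649427485317297478489956079609154807474203447,
   1037182825996870376330452152764627574307929209499102785448088353980575539650643329040290962012720791260800756559224298041992291673791123872501962805698593416976924703,
   142674234516640779970963242535249562396758043657743824950447041005792005327832207765323675109668767227933903145363055243215552471178851024609475830016101460347482772820130658695731482018840599,
   1280154784161749245115657295249838479012067166318961228660094001517108946419118,
   11267145651330867799965115885704390816822161614777783,
   2810348037805603571301118253303286114592231, 450919455313627657232638361828368395623353509,
   2609129501256433341056251141599550326069811971676633583627323225111566952058085,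
   105868909515327437263422471137064345975072786534553660856596875385336861385825445382334447743704458130090697941941594971919531777618051589634753324648147356676143,
   793958428241975, 113874674656762445527253020,
   7544091246617681163901202288790418528555608840339461, 138213050416040056338816302,
   183367558244144007277184222476750211363251523861632046, 62472797326369124208053565527184430,
   7895800642657177957043762122210359, 123537146315067114998750084,
   3861918709855372552006276109736885303,
   28568224256824116411303246717587185302948873063402798600794805296185268235888654366,
   14705305006183395224950555048843988215820838, 40395233291318369174332202277696038,
   40388230716533696045509141205105719, 40437051630332255408749233189294243459274311,
   32779192312668002737733577201512537341728271,
   193464578466380259667894806065851942716782431114227384185164160423600677,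
   4242853747864422829538590202857045040731663, 40395352365679573783949915596737030,
   155442317033994574134993878318863244687949698989081444903338121803878341640557878482460,
   7895205974542739353632879393273871]

def mak8_11 : List ℕ :=
  [162722295537671438, 4453724299511384618331959846,
   5394436800107710337792499962068873130564441263914636494007246319813678,
   40444112347909267361150222902956817944558647, 131136148449703046,
   36972881185301197437635340097121363891930948,
   8252385913373995037286680873956204415192092768647351547670277084889479441248943125032033741338443815,
   58524334520916658426558131834230343, 84830815634854351469071983,
   37034891195349006087585303727988979535006222,
   184617822189957387071018247449868147955602832275547387934,
   20996934573438039137001056366660670622565422, 40414921765501185636684263754723878,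
   32857329652317030527990501580383129057650990, 75333040879467680157495161198253639,
   28568224256825194711017956132583939435604612409150555125400836564767115521030225959,
   7898744054811212555694779204478625956849206853695260,
   40444118343824063154373152557328051895155758,
   55918480837736424262239979573977180437387875393598209458721485491988167031993941403716124,
   7914894637192827723628071554680588,
   155584357800356476377336279748780432140932617851103477675488648942155591805886464581925,
   7914894545276246175111342669727556,
   116926434569953576211700254428140552891126779568441333575423225581744427901601687062980518273317,
   56778969840944230373826103929193979471609907636579021955261882922332153109315442423940044322243065128992811262982046695061425669663519728789299797326189996476523814907951,
   20997253422002934173398036334409010008586270, 70389918315559499418961411,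
   18179057731091216600832796177146033045766190,
   9757752005432014259367632050414647325071853461615855,
   360156093237176563775410211267544937680816842928931468348501251,
   31125739937315158266241489112412079688179178832782158390055845895651658908087203432222,
   85127914782010998663755879267467255570245193122363038619337550990434352675462905670910704740167961843649551912917596665983541237800710623420658076034449646408539881865246,
   72953782581867361581982029, 16829944366531593178920411357429522778554405,
   31384267484233137563440512706728453, 1379224745855503695872388728674479,
   170503941836184260701702611189661602375968340699824660187913963729091801821216799,
   31683975151919727354461213, 1379224745855503695875696072459807,
   50079666214751725868776248291477707319917379021489326150942246693760200604790480728271429950767279,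
   11224850661455772733302813270082777713502771269945199,
   13097523072372425586871033807711541241638174451441285, 70156875475050985815719566189457455,
   131111460818425421, 16977829945644264113980243099779079,
   104155969059203466975132289304833161057754406832041475486986095255097035792449692,
   16976413742239321535491090543935694, 40447946590437937875449324561738479895445709,
   84813761588724431524475724, 16977839849164594447313350544064559,
   30020630476996782431169957896871667049175864330636825294338966302575795320777225581251661160027676,
   138161997123861485020702391, 22311654046947043533991736479245623118266373,
   16983541597895954436097149760885253, 2582308506760996090985035,
   32661824707094087775900250158661726, 234983267350355715,
   16830581121147408568568180022122725899239471,
   319960647650354232363511030678102182729996437480203896478387147965988893,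
   18174655216374187297936888054831117944156215,
   5986311960295286382699145805411098623716343172604517]

def mak8_12 : List ℕ :=
  [162767101223549647, 903947183796234397778910926100622349514453317538994223, 230246603721323727,
   40458829672075847015216072981940205749991279,
   1908992819454567409514858568045481460612727205605728570903944767885748139416528899606203400571777444431524257391225642665824799,
   1393800436867438633041834724666583031233591, 54749378562695222228673773467914757,
   2606806152162190206304415, 591959162387886806152317385977030682253260491887043332477550621,
   36348509145767898501402618203626522860076107, 140705784599872353563079270,
   40458835644372729291972932465509203686981645, 75360453939883917062725335458643975,
   22203279023656689141478986816741945060328290430480444954244449463613541495689991609378231440830391620218038019463120406744681075231,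
   214335610025737314491097744422742697542732099788717791342863586924982136435754053196303643242032140065700289325881878381646766231743383840945234232140000532716845137948,
   5293733104882242189203280210965251, 1406886417216893923480864077554181,
   1448634630082283066817650941510599982602639334402421500011587345280971153866798,
   4264314867328554620732168030877376341772126,
   28480397179822526776836750711099808542106057266825000630660597882705741027169533980,
   2620066758145965681078950, 20288532526260761528467983288330407251017797,
   33476741307745357479845290187882190101440774,
   35844124473046889749180902090513733095840324362404403680668974806295947756990380143923751362564181853701,
   33476741307738227063693736634677170704397390,
   99115938570569110485692617578290078989879850104626659089713332227,
   76606904623306850987605027160615206,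
   19270139965922599165017750995176681843478459405740360029847162909875454587690118729389451338456325313632615399471,
   32458993231698502944860060326729231, 43644636335193721251511135,
   75540842947472722672545276245311492, 144793903270376623,
   19605882855659525635174582113886036247445517,
   16126163823767493314156192794527760116858215738157888735216282229332117434079506945760963791031995904163887,
   56823195963190973313871299674723649492521172405119549866156636377040271019284212236344374997776079392910028296104088001720525264234279739942961876972218214009709904527391,
   36510721317611282805608904851220774, 40458829648567926946823874265319035157610509,
   550707136798285066214549355952279519835231868302878524414408704222752411351022164902936433406767,
   44844138139016291747974505941598173419443146344578288403318295289375854585054055231819860569326962748747,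
   56778969840942505153970689414341182629641043427481099142266477482393093381260612445698907132480786256729916307085440260465975575825388815505248467902470502151167354866919,
   62172427211644509356415786160732630715247071452124672868530854487532965415618110082622777882197135718430975383799742269449781339933623224101782335206591754140192295082000415,
   16378171146612653394290481973793580833105418417060478947991411520734890478644165837656094614087105611786665717405980899141587642678706710814420892087174622675498507199280717567988325594143,
   7724477123660964829917191, 5047213900340429690263253875411329485716830687434970458400159,
   11985859425301501814963142965473059862843753841621294,
   14985083435742019385074281494847374425463359720968878,
   3242378367504642516540790218530531512475967760353842821431724826851350,
   43651308886416002049712558, 916409648839482816018567854,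
   1336798910811542209564402317562251539218751104924223239712804137777954013747991257450287,
   9401168479548431409308245550318287963308795263730991,
   3134933619229997218661902498513650425764229597415764115729764169347079,
   1673826101133055331138960737803574987900826831496334738923557235858286642223118483183941731519932536881039757453158048618897943279932208820782744089970619405048506274348531734,
   6574287659427829780940510051729607175983395561994989391111174622494204446216957206510982268500819077440330829794714855916752297695871330167863032537883883810168141847,
   122845266036138288396208073939926086740466251814697327514014024617797150304830359226621903918764939337473534982565117080363585193107016717369358690329735361972434967,
   60908494843633146403277358, 4139858386787480434620402786270775,
   26211056551975122023838413824331523,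
   3237024218155576127775854369797745841185936714802072747802167,
   1157595441136710089974159160273707804585379839336508999432062019731715684212245490728463489788215800538988957094131176380919885796531219993412834916570766789151031317]

def mak8_13 : List ℕ :=
  [116530703931955253169539630, 85021545709530203148588423,
   2636730169600435407174231894670464205326571364056631,
   4152072462359749324732250359517267191505226885646052358857816289946072615912164252469850456369029916598915186260985399412630312192140456624192444740351391807205015573,
   64634668993576515363315808367828569193336759582785697378808006088629107068504638380285999120140205310372357778884697505336056292613017850814166053732494703964377536402808199867595242527,
   123656090889838132847056495, 14739897489794261163962347062432846069554471, 997746439515295,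
   116415818433868960055848095, 32857679223703030135322060046699183090581807,
   84914776247657610331425071, 6755824406076205343, 15631125879851107026660571585857135,
   54711231541465558520350965664073318, 21717847457155518412795140651968268737862158,
   84914776081001180183284869, 27455197512541841742972048308054303,
   143930630722872873344664518202739734078324905094303954909667110740043931112701983,
   4053278866352123763227985347716308909387478149679782037553158,
   10897774364519100446801181590275008768343472059533983, 5314790991920432111566015902139943,
   44368356873021884032534646737223983, 39210953013249921754665039330689327,
   702329155341730880486096118968224106761926159289881492997218521140037262263910,
   34166323747003143093371183, 10898339537226513024810604348267026870886670353625111,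
   31385996323366384672851095086317871, 13384016616349465558532982244817493350421615,
   50716479749961069043633197907410800656708698902229790554113527025496456509419159590,
   4913692963167218060349678361529976058060934969827622,
   12366497825041172744077883196209692694205322321257500,
   2633799856205570820803342202402074250720714191885579442325798,
   52008662424107344806764179696713540,
   80110856602194583027190900258155276737633760074903162920021576577937895447,
   2922351505662405259221707581593250986286854, 994464782619447, 1947900895,
   5254305856646549115764751, 10650509328508968690242562957960583,
   380782462681329210586306654920937089647061234951013310934218641057513510,
   8857952178003754879055820949535434630060128663623466470694662, 67931686722074530221149431,
   23535201793833519879928810756023591,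
   4865342196591852160637964956870439446265813999572164669900609011861094,
   421137153517241702290992829363862563816279670104390804091240678494601518086644099929529025247032154640593378615672653510160298280145685766456337238634563985207,
   1517597315162992886543037464187823155746462,
   9476492034847048079507265816012115197263776069867932361239573,
   17651321225342116609790228481666782716399714288729879, 5253530841725114158624006,
   140225495894536770947012037263183196898974680554762603703149238438304274488229927,
   73044945864000079088258695, 94758371487170886578090884,
   5860135163409906167048645237241141302781474765762161116739607, 128561750188899185850650318,
   4453607424645171239022964082391923547177668442996574963892255,
   4174837862764704701875576549519191659641025758392870, 128563964658558743703391879,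
   128561750301185266796480771, 1555829475112322467589386247630744869976769337509511,
   138241545276765536675039518]

def mak8_14 : List ℕ :=
  [38366669221475131740882590676121968752342878, 128601113635486985025395658,
   138270935677313559576724759, 257557622034182151, 4274760555064983558,
   104429401592773566086541899, 138279324028303101361032798,
   160588839631569533093462028003013636233712894075481876290821437356245023,
   442070163828368113697441448360338606864319047054926124597871613760240607967394083001372,
   5321229683274747504086925846238137698148233256924327,
   1419951171106630199594967361551944137583607282907432082683927,
   50893186880266630360328559513584919, 48891332504380994565190532,
   992925970457976215567974238955713828569179754321307210421610519186450204204567,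
   262237008767368259, 63331815857130644329806108, 75392450939580888827751813304840742,
   50895167540713931462078911955345028, 22181035043517491774986638587211166,
   409272614567944940946293333813060665610079756413320961725396749652528482877470,
   1206704945456750125981345895052015202253913547632290419811926604520983,
   94795947725617999398585639, 138366410134584975003239719,
   762330469744647858198216445853494687856116715002665212130583986045006,
   94796685595380909009013287, 723678510823544502218078680160512741415166050093709335,
   4978193841835838084355397260531953537292678379193797753267822874015767,
   2787597072885279603799553299533167373087911, 266709675974330021,
   61296942182754518561021871391534748, 163139011166356815,
   34955272779363399533825574342295083286528006, 87589295960561016813390383,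
   138370672773609943144769191, 1133723439304156763655366828812000240460916654780448815,
   10512081002745717951755471036672662162319666445055143, 42917990612406674401497518326433103,
   47024134057404542641135141345076911, 65109280518786129166235896863016231,
   1849468745231131517752153442941926557881241770311465660070414482669615,
   94795966172362034378483367, 9460116026954805685863107363360022512576951741205137436997423,
   221360955628842810201812572388032478463874634452241910773643051726588981168969982554583896100533206717396646485371367269399907134744428906053973185738966194837922397215,
   31777387163164599302036743, 45947712297140013246479900,
   2822942525017021469485765363504547284950046, 58578375883546325270953500,
   29413850653325749156294338026951770627710287,
   707253608047224741034391550759643345426735984338929656295472159,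
   10484644014564368784219178796169149504436596138841512787898415, 94793419936047608890697092,
   1320789117716860264938663441357621682398704471884774183,
   822433080857087453007849710466874320882855, 27934681374059841636811552200177110425680910,
   1073336781143701, 128600420108658960544825350,
   501766404833608676209288181101842178386044242301758019081338927,
   2220612837577606170348865206770691073805892397074317844036639,
   5322608389879872843726587407728435441086385150704047, 19884459983604256467473775]

def mak8_15 : List ℕ :=
  [8412080464156918547442158491832541978109791,
   1580871265515076563497502860604482381592925132230367, 17067286167152454830539961354088503,
   75421884100483597738841780508888647, 1466901452964442614297935822658823,
   58604393268655591465240788127119071, 1470099364061585389303670432638239,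
   2728996858147527106395654, 1466901382341357035204307926821635,
   14766190282979194518784259075755262010625665578137876088724774458639754781610769782922750397306073423916858081335,
   14299792842941236675109027856694411369668464778754543, 128651514549401109331474565,
   1466890240881003466781872489409355, 10928394415873900078047676091575847612433007954570271,
   766080337910315349419830874778840073797506363518637641461895571958434874368894883921267043433301134142289539339345945473855660751647256688569431609404665644335,
   5331927229686581913335374, 131417103014473229, 45628838158882088680447474743115807,
   4323933136697704481340996879837490340816645879329138990174598386941989,
   65209653799782621225109386302737303, 74306569462118951016731636595163141,
   74306580642328428829379556361695255, 47039662678198621382239738858045445,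
   47039673877689890767556270291168022,
   1680008381433675815940813851229148286374848925091032188445597368891669081855139808018455,
   14101580139068704531178692328928681555191068, 32213561887979107682232516439427173874724895,
   14545276567004991857419916929083295,
   2075110341846487256478474659431254913524482633830417148660882101674117939542554216024656208829837282200964534258362807766211129434205683997420610670125305485716357150,
   6420235638570279251267206562670131374778006418426524,
   3446837771173147604456991402774032491597546586591267735407260,
   26635971488495994555844305766983596911380126, 39256271503051871366534502459245879,
   8302872482469710573742190630463512212391164773026599, 31195358593771496852203489464990231,
   19600913615953981268927332099796119838523398, 94837418312189453142985263,
   51215623095029791472222479, 201231029273351703015066451567763499949217172814116330832350049447,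
   13110060006383550000412322227793970333433830836028677,
   11264719951340974008711969538126253940165880107142018079132389,
   936839180253339418119427238374674209392778170706035272087032970543698627818405,
   138397937317821662487120495, 3247870765878487148466426038066247471,
   4229214618804091923252839938049402703082663,
   5327075670254666125111280532755167721949986568434855,
   412102385302715757239046592505081852780119401347645006023284778249962411188419280376709251847010511370244153502949404194328809613781042395311856709376292500791,
   5285552038001053070105917685443590, 36509130750755922980210517564606063,
   123742320131985247509097519, 34969394488820214410666947728275123481018245,
   26265951898087551736703371144331270,
   175949033701335338815381207602101945192671166303248573256145338513050608599071,
   11296013971808448429077807862844238222336294, 26266249705020391862704011552276486,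
   14101585422233065518695068778151526427795750,
   16891306893463715397448404432976989581362913231945806,
   26635014645811256541311023527041407110529030, 9913129556549285266749065739288649443707166,
   23053585922168706222631279895911031805983838]

def mak8_16 : List ℕ :=
  [3007094511969117379670682907607957740619568318936486342174945365819638125349795788497944256468127526697450325159759613629536467375320852806507428503602987046,
   3033031387311084931082247812352302696803355938506354541600052315109807,
   19601718970939454004518762507597430665202204, 28826120741372008773686962807674607,
   14657481216934726701499476196928992976535893988667420, 131176202457292521847967260,
   61069665425238932842381093, 1143061089966853584696947488508534134406602525984286,
   128679475719295521704129157, 12033926240448916678854570058662022303478699494109989,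
   5198457494279782517468304903245084, 36520820587200770986320405362438191,
   26286532114661822414792162633366815, 72894139372135634020875269, 12673672801455536871586826,
   1143061089966854274301255789373053023840501182560549, 61069644600610393331605965,
   4686107571429461201952717862, 3900396949877012357658731104701788,
   2715289455784388044109331993913412903493273645019183,
   563015555881510129747895879990261776404733123137234955352813986011867742682085654567787588391923323793652511435785999834144686270045395511903787155478,
   37873244799107249921405253280931151, 31438216299622483024897365034212615,
   31489590811246846408743434168900871,
   5650391634914642758680664468203740986848662855169533290810012, 87664833053670272455344261,
   138354871209875122253999373, 145074964890948519, 46996383795815683705125543230832643,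
   27347603873914206151999248313842878619088039, 42964752842532983282012141576519703,
   19965438952013222697907076, 4226699839357696766666391257380007,
   604409573030647112583559009832461750255861817909095346284265511, 56108030931284236262389838,
   3648908835645662701350905612906406862059515142233725658464259, 138439022581073727553859623,
   47069199661649845148720494036536103, 31481671665407546142730157339396636,
   113372214376201572095542654803202144041739172322476037, 138441979487040454430456028,
   10863665289556976924362034375081449673539278766471625738952367,
   1481020691158892836665961710706095, 58633293489153928378714725,
   1222126665944841736832572814701327830294880516394016867793431, 1207529947941655,
   3622053006811232476, 63670660521948554263596332448646980,
   656124257725325768086757048294390119594740889071819619346530741595047,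
   19964993180959164924963292, 1203186637548901, 1211015958102030, 87662877122139066193674244,
   3004221626919248383994527, 5580642404311390, 1676009777426680925189570565,
   90080738538771937637591691, 6490371700014974096876614474268677,
   743050818544982880760638365735004044155737954186166319, 74325709468262779141886704004254503]

def mak8_17 : List ℕ :=
  [806608701049065045474072250030824432273891998985017859698735,
   117158796935519410484834840112250586837088904520417245620396973953331484097843672382166587336270751356576484046911157550162928484070373609452243696761762559217576991,
   87573050931977843367363862, 123803037653412083956617862,
   651820178438954399700627120651103246596, 1275105168619606, 8416008460,
   140900185680141160837453535, 17663716247120339705828692184703117096963435856396335,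
   131746785862490372, 1833088236251179780613066674765448806, 72929177277407801920122407,
   62643079874082943878626372470439958, 49002454019923624895608839,
   269605112910678245277499638002091031274166779400022307935704061319315503,
   87710995400414736060401191, 127106447252348682, 5965449005898815737092374550,
   11864992107028540907868738934181498066081876713696083797171974,
   26306804702395939334956815222923014, 143225106847400053484292766,
   10856720604208105500376053868751004365150293439191940,
   16838533216010949148682997934020366033837830,
   1966451723587603033808399221561573396206143440342822, 94943260235086987658402060,
   17663716249077463123772338741870492568438544793600047, 1273515988961948,
   143223599118630356330217527,
   504790575157247289404499240592670253791353212855449089322283273349020822275055874474039,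
   9115473421530026279494716686950150, 114283338695952549294538246,
   2360031315916975842968105974296043270, 128719507604880399339278340, 63129046374177703,
   74347139334165121898028864525828143, 18424042337351986556423393446623271,
   49000241949996071778473158, 7905128430405191150499847,
   501565538383609299300142308179440846571916135109497202968123927, 1267580343746407,
   1267580342372454, 3751498496581100942, 12132352930536275637698567,
   2410407736855285910234369570945995915031838946166358684520230,
   756200368020365798695349768248047441071465542958756137714719720717153621465590541753051643003831748949349441766120550761393045876164661602103371909218544123934,
   94909284497952505008882999, 2657921955794616604748213743899664321462037204055115439,
   58691733350938050595580447, 235393091301976911, 874786036434279759,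
   31509884410978927273160111466642972, 6087024361379985677981583487040316888255773649870111,
   381650726395470128957596443565597256652828416173245353716456654862431294043470879,
   5338764070655005745469750205330209005241764543864348,
   17608605537112870651406455198222194631719719, 1281384947301717, 20003438654613154227552260,
   25877812630332726036874226651680615847050310, 61281740288959845680697351323072599,
   122695107867327495]

def mak8_18 : List ℕ :=
  [38002495717972319888800396907511839, 629392138339873097124267742374453035640240151,
   14301952126351987804563526364855855, 2845632878560519393701927,
   785126738437613894259153276848805026797132925405001547151832139171629487349379403744739214753839,
   1228403773024810748657550556997182225735385964635280824479135, 113809821352110927,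
   14134247212302167972141545817220983566791555, 40546924515938336269607959382670118,
   43207724448783040722083741146852151, 1530946551662422280662501109530627,
   39313494285301518379007856220763854, 15729571874328587271916507519454798,
   2723956008464909901254481981417367268955488499078197461068457054555718161530935,
   1167015602762440973153967400672548041662281371031578643786553180265760412181918341527881974148471008284537140779890583205259126234409747618536510259449554483247,
   123859299934663833496502182, 9193870576278023114829377653992425651223847,
   143265583808091311955274151, 1820360820250493091598139972667475556572388935145637744136727,
   114190969637855649381435175,
   1081769389824437639391853176467493111125520698712804955123552274874398,
   65196241877730665028569624868089911, 75104525452955586368898725, 1020874524462421679913446788,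
   35335293689089234091438521924733278, 140938519279051200478052508, 51121096926072223112668599,
   104259449436581157, 140939645070710282070797047, 1029663380616927610305639325964226844,
   221512715945257644050792944542799725022022618670705280319192969600423680032966768721943,
   74366275477164106690985760067369038,
   9285748880374807660593406274601280219451528127977059920697476,
   50977359307651694585780866444591095,
   8649846742103432379201271403667791975602297981123143802552350,
   8231181022484324970160816902389943571540347635706886, 76911155671576894636171303533738295,
   61301786399539848336748461191935015, 1519963442282265037240316135710408904051231729462278,
   217447858776980567, 7693554701, 95217160433333367, 6394562590,
   12074127491927456937340090112727595115885744646821380, 1298085977481933150218549867842727,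
   61305809941439564916545754878654519, 65871700851126717028560924, 128751531184001018866305630,
   82822987847137303671744604,
   379703889361916016506070742868222917517127827020978592296926798334656535,
   4536206495093718362250384006533359752709673767734299594735170743314524,
   832540935324071228919684342247205122487232070052230, 27576199814547378124231047646492750,
   1496580134675303285529257819916772018865862530357271,
   3829032783012104027975621410040311085474653663736210185533318,
   346553129805114790272943163786995188434645829795415591955781952255873105976736920425955397731852246337699409779457914321958471749306878912390558402901938382407152435231,
   30180825809637326239676597291581487, 7121121389251621147842584296644166982521479111901206,
   7283197122264140044966281678899484691818328462705098464462596, 87731610240220271832992375]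

def mak8_19 : List ℕ :=
  [3139446978657054761142027570146369406748568015643491596295,
   37712891195391260715499095211258553012476439,
   9296720023448832535561834210294628498413812922077448558893589,
   230502866999394018643471023044832147806100009289126054470952117145333221785021210427268042079985385896441766740784556116404900521532553530216103131481941592214994965,
   49075799840804092063980879, 4288873845359981749076971589909781, 102251309815426966450806023,
   2414933425181384992124543789081892903070206277644058316180188,
   69088458081941526257274895678479599, 65909479783060043362085508,
   6600979323262015090428211212323358,
   99260233844929712655790484915245777244351642645922025799026207,
   9968575902235522078469047998580171770328047, 82860323935864345625582983,
   1496580139477462339628496576763764152396924878200348, 682272574684671668002527,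
   76945025831247691126125204120858634, 114215784476550580285133831,
   942928257319464173363678103651912843166408887581416983,
   806393272600606541731393892146023431476657896316947074750260679935944263433599583244091856965388098741358582211459531413729111038790740440654526948325251548752849951,
   20064274435945019797156255, 20072796426692757218018819, 6193304222367674373,
   1961838979510589929185832984571148958435598074787077, 87770515670099688065233446,
   18469353416066146797074853725732887, 87778190629078921105508911, 125961658549392194993956519,
   607681414041567665270387663043819327446425532099048864359645231, 85141724234574180397656579,
   257902343988232398, 131683142707707935, 20625510001731375790772245595376665007700682421043230,
   44493209835903696663925711804956831, 58759842729586316582127254129534751,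
   1463343903882593537240423641457545112389803445873934679449889393356403066804382344413221,
   20069222761539757704409095,
   1463036569105878304645157233252371437168467629937072221839885570834104803135417712050335,
   97415574422734124101982391, 10763673044756244663727725603717126, 46023096407383361106218079,
   138555304536164305255953639, 74388601334228692805745128543414021,
   385865998597169759215006434810982915549846255204897865949919134, 128681241739328809842661446,
   9759518993902988417447846, 6598212411866793239569035153113116, 18157295832157478,
   123667089579911940322099493, 1411725156941847, 32920461394782887647213437520947267745349647,
   61181801812668681453760591, 73264865916157307463856135,
   3774393034765760318872104360413375991904807483231068219507748773036079, 1411725159348837,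
   46019186494006857828401157, 44487267796372260180078902548365327,
   810544831713604163794319572190765052750790333626476890302707964026318554791939,
   346898646160360510867540397116488047413169173406259804437564435179762572919482600667027044500754485019717233420287580151754960127527143683483711354809480484152246479903,
   51363713521199729917500679]

def mak8_20 : List ℕ :=
  [70736109826303128383173222, 14339675195469608334845384596189223,
   14339664080718972215897874858831911, 27595969888778498387615224802100006, 181561031987371335,
   5586161046917171486852552809944734, 2890828854898880108862799365222638207642462,
   77613507729896043110899650934207403156149224482017877450180969922732313949210165273234975,
   128716642392415871915940556, 11978468765296456032133871393174756277365580088162327,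
   6450090559467627002235161015101465216372068482331394749712151,
   9461002013238346627522614634514032987923185300819269153511644,
   606082785005981631848324262269339552094182287918074303797413, 213082475074220111,
   74403227699796019214142447575629845, 45976963627472795583574026,
   26373112949633954429506984670607383, 118453276338876519, 1562160182467810752230867957973013,
   716416242809210800334069266329468628299255773018928720445625219446138573717640046444583,
   123704866216215215935484471, 17679884109018532050961567549046810042465857239515159,
   4869806089532842600058145225879183607020622917181647932620805,
   124631682250092431609215048629001633244720154053846645661876814757413725161047949980670625922474007674631012589044137461541205567901684828144744087854619929096095281438523413,
   121497731815756713620167327, 44510333779460931083900953160583463,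
   3262132627716817794185290857123901082189926834659038630919207,
   62695074605978079516004691418588581, 61210820775875627702437175,
   888599369188984947085705892699305650924453366203986999, 29773793487481759093649925,
   61344123975417447113457368771927525, 16218919615351412978305714967183700259114999,
   231664010974625885865146216135195918877119157153328917188099445753487684534327,
   158492950055149937136586644404459177972044751687113758575941545071522544426355534753537079374451554922944774109672667322937286295505103979607058048303459995746325,
   257980104227985285, 44502340898623121622975877231435422, 138502677368012295637238862,
   29773791709622789237654861, 2022369186329742724992049632220509805033376319642046937694236,
   84627024590409552083087399, 14339675244583178122690399260176423, 7404672164019829788431821,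
   163468872451223609016217751808852656218465269078817664672366053521489945064783308914711,
   22392251841436990702304277983267431,
   2215818237170252258915508192667019519769178888691595822497847, 143347990130177589536962894,
   87807020089036929881352267, 8649434010114739074734537239,
   2726948163969112061374070633544765109862065520684095650753699820541355076878359,
   143347990184425878343727438, 6450090554977893955458778271105490744278899612883759064154206,
   128725053948945226860145741, 17597688507953090654479912772046689411727970441116686,
   45780132938159613742172510188210727, 43039684958467712449428302049315367,
   386271213423198448116045625700177265570344287561789578162733059,
   15033453605163417441789971732752901000155087849700647, 121502589826022304853179661,
   926337098888273427340535856045349991630088616274902102704930696629300086493719]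

def mak8_21 : List ℕ :=
  [232489013384355417269514501230316292454869620901721248632637821266724290691111,
   991254221091884376748619376931243281216205620970125961284083691905569238066853455877961351940781600762343517349971083054703062236237910273154946988232663695254578418851905591,
   20148354416630685434513694, 26503920056261786020897814045102963899953157,
   1633137639791561520258724984077711074769864125079067669081664290480478684071509,
   126536459945771016380354446, 29489220085868671250001839388834031426745220,
   39374340174810335672276286143871205,
   5502627810249643536285061669132823517243509796083332738010801653153839,
   20148912588089492220077773, 9822929037496348647412358, 76977944668544860828309282795760717,
   594869354153626376207721300178189358019568074952425517248605161224947583942684,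
   1165444703615591009336648022852203416579024594700587603695035456547131252826350701346209664198916428674114661095125767532928359369707507977006913055665768361463300464258079,
   47138496951095162696100016623521134796818364964032313298671055227119743362398515666937007003519333093134393693717888941225910043260332354893011022897595346283774281763702927867228717077,
   230886929934601094, 78060132103477934334048679, 15343425601643204189317743547030901738469391,
   47166115886346385745598507574300335, 5265266920007806157596850643917296475484964102895639,
   74376811562953660243362262418984917, 63659894157829167107100932095082526, 81952518700865829,
   12037451931806414902787665756790584594100754338333573,
   402933054282563506919161131056150967203590271503138415443972,
   405609230789917661387447536376485363153051927433610707075095,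
   17330408172131453047135956945079527077430684340514839,
   14317557196528533241917977682074403325854429123483182,
   20259496494897549268341408951876457624094083259841557, 21975075066478649313631646,
   62718995120578511594565676545605639,
   1017626265331897241485767916185403512385443456759296545722023,
   1192800630889144461084032876640666671771289491184924747728444565451495232389774957812522815752500896452614062348435970903774866730982733870833938121377084146786635027054622,
   1559322037909031, 10713866804390816696326402649392973, 65250559108151437478421787863679023,
   15268014791356938296399543, 18274452909800222199438937840944805, 95069955639548960431607435,
   7306936552017839551388845733,
   530834303692309264224069166202478795359842825362679649592791474854685167988378848722948,
   9790009204603343547967913482632606635088295, 62717218668819078785355346285351557,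
   219241831422156301802209375236809448295219940803048509945938542426325022,
   12092352480500916576590200041904818908488495059585822,
   19525971517048214232562042384437964051752391, 32858111046243491789539574378959726,
   39958851889938996465625913768969182981957023, 5274049035881435157993812705862031,
   21451117824815276463713038120679771866060261698226351,
   64679256379510948239182288006426904655987645062903928533310087,
   32940432324697071073045665099952515497546935,
   51076156618169791184998203243106838173418906748257761615012691972,
   23439871348366162244014903828167755, 11982417318581339819418143339348132830314663,
   1390115772419872474656112107373793555173612891794995283249409153685755315355653,
   5022329037186166611178463060702864114771602907118324414848007,
   793173873143921621932775638978172422360702250554084495863404487559866557008436857475548104708002498947015215908074388131427709575710201861495311973407,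
   40611328501331338471247122402416133,
   6083339868923741358517797726585646630522069269191694932539422]

def mak8_22 : List ℕ :=
  [2638135660282018377333445157710537805733893232802837,
   17333708342848921217491804957823393562182150796028951, 60120942951303044,
   3254373486622005516562325745756336247, 3638541574937974065531132858143321318490133,
   9307894599288565000020072814859060966372821487747476558084103, 87878307837290220317496013,
   5840397923657125181792473091675541304674249747086679485290223237070854,
   56837938003951342579069655762771975158016266060554373789815372865138718296259402611073563586571969527188867115531905688402692695431637149801727635675254199513258282582039,
   141089080357824255008182703, 1067126253242366928180235141, 65270424455497855101763686427193255,
   65278956125108693758387033765584406,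
   338933302558906175641080495585349270699035299108549037153380729757343,
   31346754908415050189665233999239454, 95134735588126110594891788, 97550011893450119714361869,
   34185389689832985466815302125502767, 63662688174806997724889246, 97551888957697685356730891,
   7130245594765906010362016151, 63662688269046318821805837, 63662688166127722576216110,
   501565537998950100549245095943735916848066107549289630478106671,
   4086474258305222045432896720326706139426841579846860617547782,
   22304038581403420993682233704897711,
   3434037640683473907308392953923263549406631147389898134126596,
   1870895465261223803907492124524047644661246081368103,
   14177805610451036103918562168916553849507127,
   5367312990764734999935401211785214795309807961532831,
   5503580761023253925296438889877473445863903472079127841629044842954791,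
   6685493519203931279970253559383153323353588768934690513312605705714004442418096102371165906544320699197482289643537297036557764234848488018083821325838824635384779423,
   231059765787709623, 10156749709739596953380721064687896598069968287825924,
   37154988274218087170456942203623013012113164,
   6395531477170465875914864461950230341853566770743911, 83014262794067271701680814,
   313779426180187634194131274327267211838405943,
   1680235657556493091259838779696334305952668875184713667198596028910534698074151,
   57896113744356404761683311931443349819051520992162560671875779054075631923334,
   228617225582507286461327989172935202671724169792310258986077895180577796006816124557587139979047104095187457747814548986609116411449163017687691527638399731966295408670,
   41127077090266930359891963653659831123288341268462431627964239645058830832527928369771696940285507565763742040673884059618765741666266800096782412783917507404635230209431573189516972677783,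
   5593988576175334867244623, 38081388848612629118518003847182531, 181714134609567491,
   5593988814341441666940943, 172964579763627639733053485027346579366988480559, 24022172190978567,
   114479590832346424725503498, 114479590832346424725503883,
   203851973482107483779110043482228211788334218182684606587798382169841813615018006,
   159117146791361711, 73373776034112100291646215, 39783081973731198807943084384141363539607558,
   60099949763285527, 672256052146580167305359023, 15358779436412078071552079591524047684185126,
   107183300649832489138596887, 28607946009473228903854598110664966,
   172364455809320685430656617938966]

def mak8_23 : List ℕ :=
  [8422001126075084031966611927925231736269862, 24851901195849888708595802924823599,
   128952782635781763737016582,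
   91538558285229464338422481017022970464640025017181435402330546996718901723420495194488870,
   34205652316877279750400824635712559, 277376729642824868608304373425797249416480679,
   140741203236621646, 145750989976010262, 140741203018436430, 140741203018432590,
   1334241187753911827876275409997912276875000011554816022,
   11618971893758251896819726527589339524817596522745271, 52394451454761129213189152876011077,
   63713358841304770403019487, 600091434056978877287302692895,
   69231594732276267907014049105182735, 11862406059514733953321991979476215264317223,
   145775729541254406, 145735498045796871,
   1317362502336002610306511793758375621658345719413604374, 85384752913496206151077679,
   3505545035594458124801110365193164138014389286469661, 24067802460458246,
   4536767896212184746295230958, 61323013439998551179335726,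
   28609979566409493923523025531869659668807726, 32907586816756347541484306350389423,
   41154884096757659661893647,
   641862410632807617796098779280379023554351308933495459051638532208403247,
   1966907691854980172392195762711845277809483173775584823631337045884974,
   10002684512820793722425547835421552940154966, 12980742621082402586429030012571182,
   61861118846053518825151379893950559156973372860855292878389918925854858625073449651261012505571013753290727059339838975464896572503977939882121054921072335806589806546386973,
   1880664116953324609840312560532157639979571176895197293363996,
   11616368189747980433504872505951574377538434066068911, 20224580956912142577986694,
   11618423449385970587216146031154579429770866341985327, 20224580902902933033479374,
   4236082108585302807628965048118364707031519503378296395170299555491503,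
   16829885256926114796512064920785814071250688553046220362263373455881966094535978905724116519425421809615254973555350992039220713333842770347480364060,
   90517577690789963, 143454183415599939738140727, 138703709823081752675936643,
   9467241071581509213016080956316608016320139962504796, 114365062514757813706319535,
   81425715981607086, 74464969980589410407230355741343775,
   5276576422327455312004247188143336255154735991385987, 90460951709106854,
   24947368655657214234892508923428895, 1696548055457418, 1704598968467503,
   116799510966971802257981452, 126128729390938632350597125,
   369264075946401909572513451392244711634501096328888490928926638, 262855862526865419,
   33695380676776495625221550418107191007379511, 62757194127792123850009477181744743,
   1702584243603575, 40651925076987670143390684313105678]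

def mak8_24 : List ℕ :=
  [1685087060101376964504593939622164567528367591492367987365619745575,
   5256045517302883923106752502697337156689064495068819816845131,
   5649985127607225649634788750649830025185560813329006,
   425832079259042820277250745515818360958843371306515067203331048889377243728845101385546067580202486131560251219766371784346252803859507417501205933453994013724,
   143484384959899446464391958, 95176158180113987515612727,
   1191068414005441061507458506312136285179221452318501374022940163333439225616960166740767,
   10803341646537730946598476954136540610272984717549932782859623912140,
   34209656175611423222977652267508083320557387,
   691034475828499736448738988880889322569520033438444039868590033742105564820016889083176466974088113199970674460924966385119727134932227084720457777938410311203861532,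
   65329652132280812560090709084602414,
   817036843606873313258336217572116457936330295022529102606374478764017365686711,
   2888383022272362487374870690309640972238624912550543328580919, 128991082561889869883334278,
   5265269440643592658439170794345171308537395215788398363017263,
   4795010307456511428540389376008158436958799174027699167852510886353248585965216193853827147510347583104582148004828702370694896342733840765610360860,
   80116719941571230183725079, 14853791777914898003084680760130677681162829,
   102426092730267822793467143, 195345050542077462, 126635739260026391165421901,
   114554578727945268224851973, 74490905008741356473484495682535463,
   26451167308221564030927145411555039,
   217535258732211912852365567341225744388979285277745446780175664250054589579278135552224007537765507924007,
   3038621780068195003239937002260263378772142,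
   11819475920160513690165568091392693065261597788878131883431120538540463252064905743600972771611502540831694670934564404682920291686946295856992270756828151838,
   8219891576943771798007158124535565112675341186909021022327621176951118813627441341320821218539350406236637220641904565816889825175972797226775134464969937225494663951996783076573396078366,
   1770960005812902, 4096812143, 21040813098159219067362371800926532963810333,
   69251284182731618973418205754055175,
   27144568383109993869199656144331885318050995086772000815501778037542370333,
   63840998129060281413412588704557605,
   2958153172911186587099589661593523042752278400816730099526053972434762460699447,
   18623475532333310857981798509223115, 40667311375143056724274402525243941,
   108674431421908214418679491473424934726082929383126240973252108251348240427896081372721399091440650289166,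
   71701901706333300829781308683891758, 80112365866231163916401998, 6119784688603995658284321548,
   40590780092318799782045763039708034472013830,
   57448332345462694076886589234218572685241211698592201236048592284239767996436652367806493,
   19639507788566271263731202932390424434329647,
   563013781558821068124829117276187061468192097882183634672475845204541138313624020773060747853766867709206688150518475623559906020366675425714949270551,
   1773668258882674266048984555900038933203752880289107691098947152820690949542216045983783,
   4999668737539416554391307890636113381982225851230504622705737906917142,
   40670274155626394812256482299897347, 35078375141549165435712669599468864582320197,
   35514960941866828133305146425502158,
   3027241513592379092994848299366675970362637303347993727452124984261679,
   76897153484105071087170793448931375, 34271308514085038085977600715451003412499014,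
   18622287121707132475571987267979567, 80099105012344053338009935,
   13357297808557678076693925914578259020537413,
   40786241358697863867185770935306116392498883286182222856409858069956183797297881104042112785055772,
   348424764456376047024389980956851058040632878216742993742393783075336328665942864801806908015089952582289655254029176110414383206675479,
   65193638642156745557459571940396868,
   3473272181197098446141643362417274897702529693165752110547759442851911]

def mak8_25 : List ℕ :=
  [21848836721861667098011850679109501001191287, 47079062327766210205896376098541431,
   4106435076567652503942682355819581879676740980191218715928050077427561421198059993527786753251868676,
   2727818156811098007645292952724538509129590184377264640221873364046551157993399,
   786201933819813269271111343281143158321970899843883629677481346759231913429872690889102701922246179194142575455382906894331730251926015583019517931028502,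
   40687712907725743690244770761716782, 133176067417229746324377347,
   3050850378941422680601596796458408898369071, 75621737041741146963361868909649477,
   12733722741566260550760015, 74509517170659220316895199745965647,
   4163215147884839450677883935573843868668134474907695,
   86651844908637628808582448275362111798848001738840204592545661079260594598245371216522820750743097321046364201775,
   129015059177286780199123971, 2497985014320908334953661804317808157,
   52252641684617138369901468421330341, 18589370385783517675177883837672039,
   1276557336452831268695889535999140607022, 61446379353492168748353589315659367,
   44132437749173115538675118, 302619761647472536979576070679534107565297157,
   58985101168308394417078510, 58985101271981899850859365,
   34294685688475601264765341940017622566699101, 159358834206479887,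
   569956597342006168083225452099274502, 63191839374262756520512285, 1843385471345895,
   16109556966, 2152845026294336863525142540,
   18796290487667488190683522090169682017489538171011079, 35548909900066923348396564069382351,
   34060844257669967740021893049710923989415118209797934307291750453385158656162582586030345211084847,
   80746217326251075833986663, 4900787014634986536447970466054772031039803852701007346551599,
   133176288976101818245609677, 40687716921077013186890234400635063,
   37204923899982143107326849837531080210066264434121051129923712516620291,
   124150446914493085716524206, 40595288685266970950664881124835089723309126,
   143535992369209265068580550, 230780459275271663, 61361864634106250214244366,
   2437116338310129505394580099711777101888806059325094906150443675255860317527775,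
   6221706548117085, 47228212065998280883612948963000332, 31666784586686362646604691760511181,
   80753515808474593747877879, 812511496007577548205788783, 3106765276390909486848587,
   786936628176437474065613394237981078176122327318018861418514639814521762954197535382124254724127,
   39455237364992983242032616451666054,
   93690291861706652229336723304267850785119688526268928510018191877562680366143996520331311,
   3407697646673846597266980837048677843725720145019168843838367069496074654806809156367277161630744630037783306868815572599151569962411315775113924384837349474077834676898288151,
   8355862903357450376071489316644335032044804699884945576627177986537746480465990237335834069321999554492300966398159238203470164925328054802419915371498819098173332420282438156878600077343,
   24522113124223288990751933294395751958118212,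
   20998908621297513374049021374597245404500152715243558, 31630382970187525278745547988710471,
   485836538434983505658823616810486238554261393261274804906698087509369153593017213329260336152006609746982,
   18328089095043274673800413459536519]

def mak8_26 : List ℕ :=
  [5285047010790291976825680444700762651763623745159214, 7890472007031638950678897812184708,
   15403708645642990374398527501931876723744963, 65241928163520084339229276183361543,
   80766231549084950557011455915425985230890406997086982435158319845599113014935598,
   2881746712707868490604360381651662267642235311912169683835550,
   464417780763745494258573220903988710431718883219472059758391841759075348929079,
   6116295487404494924202785541504298902180801098552964,
   550173885441959265462617745027834011721608316309755873681504302648672149508526997734832082130003068719014168058082710639340100843051364847336494,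
   1988231618916850778564505470721998955297797064432935, 75408969941285334181416604,
   23087308282080728069242366447190769207807622, 129053324623993240814373711,
   297833924327886438829784252361560148955957730866228494738781417438573252081687,
   63752847127047052795353840485058199,
   3805435274805147758472481886468491591689897253728742009850639969083679,
   10027513958726150835493535, 36421465345290155456786471, 121727519730858629545638428,
   25376560753122232991565951735057388077769119,
   297834089969699836337307128102625195740189846148428695976689354335079018528814,
   2715017208283135143607102223166746520615016403042334, 104789414905064469,
   75406756645373785944505355, 527145011206421048532096387944314883, 51002343609979814163281934,
   32419289519947958268863363, 77086883856229821583256210219466791,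
   38099638297172604156607493240524773, 35525215763466091433177465254576142,
   1221038685932025768617848764825999101907865327520934728069013053888823115857018358857775,
   20339022539739513027044484, 472443267568648966274889490613684000786153321272650836491334,
   1428597613862120105908186690610895930417263934308016375274791,
   5379592997251203653611089409403751,
   539199442194333389400384139963459502102745053115033151172292508300645,
   426077458759466602493541266330732190364570057763696578823982688789302661798471698825352234373636760455585408579769908805790254970670009166226265511130644348975,
   39329975244878751584472704776206631,
   3313644090081696558525111487083367223344504227636142782014239694858891399528503,
   20853086023779801225136937607529559, 75642973020913235091452332747323687,
   15352247062258740592645716064125081829841114335552168054625333388117378500509775440177675294,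
   1900995419645447, 14461361370254031619190770404163621,
   19073659349445194828890402511955911152694791, 32265715433331261800164554626532931317986823,
   59017933481400537445628215,
   269641942799193782091352113507144379294978038622151786211901435025555511,
   34229080520824090208066207, 143585743238036159239167628, 77086887582606635829233426457751079,
   74528867291214238036381508597724453, 1905436153487196, 76942031397878173933660904940896268,
   143583711790345041958411861, 24443765116635981937246539, 1904340977751639, 213219579447083339,
   74527086298275651043349790868897829,
   111391990053889769927294486393310334258255720442361476067840857126134669463519278]

def mak8_27 : List ℕ :=
  [46094740030274337002238923, 183382889213829858685968515646660653935293959, 218115798478632522,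
   1986308020895772, 40740045797396303762371161498845239,
   831484186647818699933168626559422628075421453409103317554672553423805049995311,
   433976287724959615998959020239132309241745526217114588333960177880271530505557718561591246019424414332585180377510795513817796313091,
   19798800227140469287806943175382407234322463, 40023704133430918779203400013067460997700099,
   65380368142252749829228765244995719,
   1431275681420922492893391137710738973586984930872576231694150691826724861920866612543535,
   19104750655102257955258895543946721194962426302569500,
   14232248585963495683532970613999621064887303,
   3409564997838787873601725455748458063198807968511180924258824974451840457034599175983926414030641049663484522841629168495032706155926364748531929075117525974737741037147521054,
   78287691170198047905954844, 138767118816083328875517606, 59063307854414191583601189,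
   44213326550795276499637774, 6073410449751135187621837127142344625782567715775463037075502,
   66211726168160593742599351,
   6298718804533382148004482958308332980098934727917353329429929219063831,
   22380797275793113130809744675209305012857222,
   17362941247555950420503249606681960784502943390500517, 6877788437565914212872845930612503,
   770043516681504949047623946528713986985637101273183739821651283410972,
   3408058297880443309996877, 19860193706817463595674893664928323000381772319308855,
   6937537864798788260375766760687396173350006156637585990535205617667,
   128982808445525797375360263, 1645524284069356409854058286467721314959397,
   197196210763114452087905923958027026694622895184568516790265448050499276524133515046801722152452273615716955923872339740941417966109718734801266964168707,
   22156537375460744542712405070854430168408385196916742, 145839126748865318,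
   123967072977656690449055767, 1975155861799758, 40287426495408614554580103559381015,
   2102865772352151691162767241580678794444804, 1982908565340959, 129091723868289326909489158,
   129105528621573994559469615, 40019761712841027342489440590635063494986662,
   31299326959352153110687721456742830, 104865968210600863, 1981551566131031,
   75041179359551391400984622, 159462493165197318, 5887510967913645924092477444,
   1158816369919389342213129620513351595429348086890841452102776445702294946831079080722479,
   10029060398708052640894035203280587183259164, 13075164921901536849038660,
   2254737108604192881308321602771123897419780039820801257976351, 59069506398617503215858204,
   316569366691023838725641200765282568721669148, 1982908951622039, 1980456541230630,
   32981985237536070318064919514381367, 143601388332713744436191526, 117046336213250488462783564,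
   109797844796901286, 2991404285823857739]

def mak8_28 : List ℕ :=
  [74571238704035649842436968072478759,
   187716662274231519301324149766371797172254714629111350487304984837881334151882370842663,
   69266064863361872936913566063398734,
   676739036986486806857606599554022178014449971415396056746130049094351,
   114697800066072956393364303, 218191368646339367, 466645374682022030358380060,
   3001056875527820704954717520694662346852280972115486,
   3705608439330687863376668543143880259304988, 478912214062654842024111765069740822190652956,
   405637097655466275616672241250457815590451399840169378310560937387525401004324240944358614857358349317915270360802826975020867710581162399551370336389960212358864437278,
   5472022619450642800267800864278564389988265125586140908280988, 20414580403606164646476804,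
   6685769044221978400409446771173076412249378038516970305956870, 75920920803255648206345295,
   156848699541583402046809368168159691051774831213468804, 33026572707253661342568265699219654,
   6364331226847095694513431437699192779050346268693285192781347720349678,
   126541622656545964573596263, 51178321643870770647354517686845450,
   23195921038353087400460697003190547465461894,
   804768413088959175956687117756182151171055342232561191924368930680389600499471574299151010364578626348381533853643418715394241231983847142827852038191,
   16363299465141736762424876150490657142092103974060714033179145162301087390839174158123947779170739527341309644269256310595343461916586342228954871023444359297959560794990753252367256518679,
   15077788824746537461944005275581107898840354072577317,
   39149819889817425879776892247414265294780431,
   8905642099516536591246846818512404625138159585552801871836143,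
   5380218889213613370012770686195526991806445363832222,
   8354467803609800447428264133298842887270623342424087, 129035033236227142439681070,
   124262674837177234025298757, 5708415991504958156610241568761446174425182,
   2666123287784135521984246322097109976250815892989383,
   9497007814361167859003028652854018465066643854096463,
   2667151200915966238968721326980796596225666768082478,
   504548813707518040688206145436419003920711620360274921264038961368855750535755258379403944454565882273406540207456169960437474607006481346855069280765401805777227468219875358,
   164114827066478414, 6781436513084053470663652732590595, 74570251908958502974693133383641351,
   37710343690122216148770048173445340034838990,
   453443649789549369729671821480145097980834974712532764021862411137584816421770120709796758429343,
   5687675784487976362836377569840010068575031134651243998224103,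
   2656143553062591079190019714505801424844000605289246,
   4105307081841638022482148861607390051860335032608519939424295, 119001865614177430,
   30168268128844577683174696067794115, 3598003722242371160788434975, 213657067158248461,
   4595751160704518521422980212989100046, 33025737020642853598804034698107587,
   2391112177060720519977493493626448065208180871603658657301654790996007,
   8826186264223049537847596677906932679668639088016973350481794658376455425109269162898631246647301680574667779860038021681196045761680606161700906038067253983,
   124275937569884782648006149, 28084570258493391112245628238009217238606182, 22953219390508751,
   18385829750386712393576245229655959177535235515482159, 129018873922628022517173895,
   1142693534043727925289197908507822450613301383554685671,
   6453964160403201003311045189443459026267900401092413757352325,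
   1464820123272016456443713392416725573865833908839077132555215203536541371189902269894536469800151678819446091989560369658622999847230190278148126,
   41263048416429816538819833793946218610544199709665782882714792395654568447680193453066236189451052798912336617416511968158969006934680085059475169767967315971864061386266841266892353067735]

def mak8_29 : List ℕ :=
  [143694419511642133288409573, 11104934311357611848454711913936647374613765432957905418923029,
   20312808960066016142121420, 1327484336630172194442031968877900522164423456536395831,
   7952044286898645616232527319685321636497866770935846,
   9882863834644159473173804647029006536956614, 20446827613425958458680453,
   6235001927807242169573608312680806848820420613029218043822135, 97811742747484701147353093,
   129179500073827348716600526, 34323202311269484698940738603062416698769463,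
   17344110373051440770269461951610636,
   364200452821783382937073897972676910724847057038571553020599764700544521223238,
   2891162381777779918480294055861542738934104410874584555244191,
   47148476234773213614285281069513783, 14608133134346984628887943563066423,
   22483023301900343864052295213522599, 27366070833538498152553408825963824181238092,
   20444131311930195643479589, 63815592190778484321975916813623754,
   55713845896733935468615145131417163126652690616303531332937699600638618699163533917974259826743,
   19870753526482500475480145151394842272961132110762021,
   767600508973587477348548602154856907714348273563876388378197499501138433915799300654448087335690604328158312589426336282545326099264252910397503847462,
   1469143455305655313283564760138554185466049533116705272119515322757818564140571463779877,
   3025860781556911158352542755811400330780438651779902066476346633406082354665845358458866024285672554786309874250856059705598498677731434681637380723157930128376725535,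
   66717422651495774304430593746334374, 41306582743509473721928340156647637261522439,
   40704494894320697564709157009902744014050350,
   11008691405509346043024083202698466914508713921905286,
   4469931173309084250213064571108193360705607,
   6466027142932397695366553210034367447628099599238254,
   32365008778122203228160919117505318669562926,
   10613757301900131628219924337057060711059353341718915, 59142486293877383850653773,
   5408825547050604709546619704374817066330693103132175,
   4469931219922215980210463709625706317102374, 88024961624223478228766255,
   12043914127509787739729472272515897174030430, 18772526279127085774073604884286211,
   12010108582213963242437301672224833065822323422134588487522645391084163788659664601018760301828704974039559927292190,
   163984809531325134, 5692038763290692477219181123896989013538139805041693308273541,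
   7468730608039314375341203471792188535570749578852794029591319,
   4466102961453886595464571527500897655457317, 129166661300846607002549511,
   121857791386512075349689733, 10898631899852445420389054902051789, 141333625746286155493148037,
   95364033085165974982930469, 1026531179333224142527662282907014413749765063,
   245365840944519109382254462458119439906231121402516419853233802529672112913564,
   1083168961792471283764561718419501509592045505533643585486871,
   74585221228173521275655015819259814, 88044876816773871868388910, 49458166890016219365821387,
   2115394540149157, 150675542314582046, 33913859921616127634001237509144607,
   77991328588002904584128782680429595287371852921137176704712734,
   10930046859294415843891886304760505288584336418094239]

def mak8_30 : List ℕ :=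
  [301452594812427888249431914880107979744046962984621278970427094635767241637934,
   12079461476763651402805350696326642648285094, 182207976302230859,
   77168013507348896243264518799491111,
   594205165446690199914356881896736991152162176001926228860731399,
   7241101938449292697812070807019738577161340197394064693075247,
   19134516784193950568449361632571364096390383, 35640814870957192925471539447772206,
   18075861472084538742367605525347959420226312293449735,
   34335366777428765593326620664272190982987343,
   226980787043297567064609525214335225823113778270277780714050326640572894509089347908093634049868293621160529655839,
   41427347551505815431713685076735577089187119,
   2732181786693587256832058282104752202999516202547891765037802922545613415413797,
   793573456578901961113532717200515443464485652510468540946845746235123756927354265968843007974149160228180218002550767391168104221853696608745411444759,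
   117170621413004425813586639, 615666375170489101338676667506876152070669995220731296058064031,
   38212572101891234068366336930011654, 49508121114624727900287023,
   4438579979198597869811125635720339582702149429942885910347063648209719,
   1266020029943469299671531908934633373945792189976614940982327, 143721504470894494167074005,
   4214390390561487272521542352474620423045159, 74609993762302167167460649050605935,
   27498487886531618123173778767760465639935814,
   718364445725852887492345624420807188050366221322692985511477254,
   1744147405691495035294229130763706765793574928491617862836574949053388971815030221192370394002757559636832945626951531587192549837782689899884838106386351720518940790447164199,
   74612711853175380276783348040859685, 7088116587810260065477056840641455,
   28660857928295851681839620325491199138274710214762508072319032280380495147476975671,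
   1572664162800420044202304415603842357237018417656530049750343444331316155052071,
   24806564215216348374420219392036751,
   1017445418577777626477805161163764782010747397133798014451717, 2197399526984799,
   83282482770718884766434597, 78402133905949259908137271, 78403241570785364595574382,
   78416522879319055995111022, 2191505111038413, 2215948609960325, 59176644532464084427210798,
   1741548823426784083620722139673180880637001774, 59182178591719117928853583,
   78415425586299740847349303, 35063794276016396055674329304688256127860775,
   88540240269130340511326290789941089057041864959918095541960806096601597880056887,
   146235873187134154, 42156363046727669068826719091834115,
   3075913987021887264777271445905605105664666371082716978162934495949596768862247,
   447786156137621947896164923068163480895037981607705736503957358103798625125143053910592133728095402256248376647044430334700384944131,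
   6759402154058995965919826412059703, 40654838296898718207610458754939589440569413,
   35647945258132301533767437218684239, 2686740471180719342157599,
   65460857406796107560760544294088011,
   394203375068915144738326210937016481703376981160326338532451035346876659172087601839027208502457836325413,
   969211036817948558580208330855380704015217118882821341162418442885832165392754353459532919080453,
   5283365152091484987084988774904358603182965004309445460106759,
   520337186934350694506145453420423802944721669448688405463688493268914146230938568134541353306884585553923,
   632985207176969789411869156175060973785522035657253078228698255662575215220328613448050622976686902559889683658313875325535514387061056974266958352648154019705877,
   14634894782289355577513655]

def mak8_31 : List ℕ :=
  [5848070234241733013897132024085234453447839383351, 2280025269244071, 2287584944324631,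
   46487495454554899259326477, 9920556156979636069204513152549174621765679,
   153950068417480671085388066039431703138664106248653607,
   2250683862846134477939563965432172157850245007113032747771671, 119213018918437231,
   4438166371582246455, 77179608184802319692624435532729999,
   352281194452254684926553012553461408207111827051546734540121283757648660922389,
   129134588873065884348538103, 143771522721184566962421781,
   687363600041896531341455112383240031896091781,
   585009627943005333908673001945196211335925826292966021018097238701334807152541151548572965226405017823451572695802539031837431349750425219824929996823,
   71145508267389248766507085, 74377029304610881500777332372144135,
   27509377567451982253123676692547438968238135, 3996825126175211381589448347360798,
   19917968697873595568667166, 607848124659708982611164733065527705478031447146795515542241303,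
   12965943092354748526817967, 2254152386218399, 19868423214, 97890612585562783289966607,
   97890612457522816286326959, 154294851468676349431358050474088666080654116419272742,
   68772028947252941269399302, 77186742297940857935773503288508463, 59211806884154928839543564,
   25431964348342692598099109687387872866120863, 80003748067024548900372487,
   2674234281791449215591524140338649665699934637643296410111708732725129679732759,
   109901637757543549591031430, 8442002349585388885978374,
   13630691895990912553357889965393703400593542217289828858872041832487,
   12087798410861352208155642723160824921749550,
   302331428392928044651015265166767425357178862933877752146066228706800893427717,
   4940486012199974947373369326529126335219134447484934, 2269605149834927,
   3552143875587544021204998, 8245158150258774750532232316088777473701673463037703674053623,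
   5483324766969811652113296825465960678833841464763564186140682,
   226669940201038630917479198229724031577348578487241766784238436943358094741115655652471670999125258032831494151375589931028351126738018077320835551705860705221137041195036,
   48668793965967564977137772350348581, 123655358353710346, 59210677156204810415806031,
   1752484291226143594442609824423145511, 5482669012745680011293088676638723,
   43132882385694083134693862268263622, 73709290027559597568244487,
   570864765323711047361195576388082219752924107742045529286925725242349556316829516824631,
   11019801070080820810972197737760076212821814295284492, 88217395814443711354006199,
   337889615582415661159059891338651994537283817348521894639002715237413,
   1064876994166388144815613778734704176908886655743298192638443979126686373133318,
   12037964203493902734949701635370887433849882308378702,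
   1612832903189773760951467242481223119712438065111986773318692103832574569597664192236637582742503417034391387534743986756663337470409247431805855324953132707973431324,
   47205071555231818296089482973938125065355444266876490917686205809530655860872929888410202302855096778625617665078726246438585298872695960177876167700384987579603129186423205763532193815,
   1104779081941969501262631315839108091177194153089624005950002884688613]

def mak8_32 : List ℕ :=
  [4575072694718649487243440257369932419801997163572302,
   10910191817564570459106485869127748733755183974199802817943683,
   1773406943064692940164725303449288041863727989327757271214088819056261,
   40761827072163268694894461207798338268510437,
   6942304520599016748173626150263217009859975409033969042623341216224411248732630026506,
   1581444881593009574766039651703882754122700338518600126368003182604774400797774,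
   158576825949799488805449808670399403400208621975154280144995600933009535382099645954937207152980967351705894444348941270925148636457695096780857463573986366340142,
   252583771038092935, 30223913162736432006106759,
   3285085593912656615159637936332223359784488053007176483571196904938791,
   15102406004704470498171410847986450209469665581529381,
   2252083020358238297122190657773239118242191715667477, 27854316311759828757409217789043886,
   105209522586181478, 105209560912840459, 733266275359281666345402380, 96206071461201998,
   1085615392739874723260468942,
   248132790571686845495497343721835747492490736035656410087203996400837764055063,
   258818001133148806, 6044629104906373153466089478, 15462662459134768208385887814986905258040836,
   1772814551712737328835590762885540453397540276948368612269830480276519,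
   12002275822579089734814766194867982428723406, 16924963696146069830936012,
   139050693453834217017861415,
   5099408428723465464335372042619830412721134864137789087794168812467719, 258821260119385290,
   5578380268353034602621596576028890887387206, 139050693548409809335815887,
   83355119534461505180354636, 51260250927945229386793754396476711,
   228344158009438122838604471093932052750705897595896740423772385888619723106738159747103,
   5503644599364490934471143922397263, 30456927360996378148974806004684910, 2356908118950492,
   21669183762492729080000505493905900432261167,
   1001479149540924508357415897234426009262292128501008943971042274123055,
   2908064714572118630684348526401574750329371580786953598683419889317697342063020517969255739107737868343920550848827105373166805703695784645025965011251407090867031293219045423,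
   10256965915811031917083724,
   3040326561826942601911869738628133804042316306979740358727094276356133,
   6468554071072719730788679637242748948688284844350448336899127,
   65474368785075727756995421681028847, 114700659225979888808824527,
   549309932364940316443243470412852794278414652448948812657302032482380,
   41996522911808382787598342, 95470338928818980038548428, 137857558141714042143700508,
   74649984148316394857218869592898076,
   386066866451333202911621271147144317557579462412549536851221708, 2338148261387484,
   10715288028409144344921566894620719, 126942410715126641496073061,
   7121521079698932073804478581571605, 2356897346685397, 19956567994507763659108407,
   1781913364338187197557923206856027612084098109499789283388040674964247623015478742482999,
   77199070646651362777926656935860078,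
   3302216158710761794756595428442724594351115215160197381095479,
   1052347009325602977101494931932100445464378174962412273843991881599405088796067333901199343083409444312219832142749890677805368514569567473796485745303993800404749618990022687]

def mak8_33 : List ℕ :=
  [294832642690331205337610297983489845774142632454442664997917799138222761048161608539198962533251120234672104019415687501790482887661835699418063466457160684782298993232928980982656139395095,
   8308636033290263715554928930001965668702363008944111,
   33585619009039050811791958860469451001769038,
   15886345065998853428148141253919309289643389051293751, 114741295825937419297005093,
   5327681920227896041025094820098991051525766638545998,
   10503413929989913951907065027935162580675662,
   11260005772606399858695957642921046876512472228300232624485431,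
   5325969059348039761159229083852484270649328602786894,
   423475558394099689132128667338210410446226187842158354867446786986471479773313923479446641780480110696779251535677331001530591442792626001180307790972607020070,
   22199686781511947396794965738694209031944134865252399, 6842624167214412086706689344832558,
   8392910321533543073598285, 138994246695841991017645989, 193727333735918574,
   1774795501353170116865779301682482700130113361450148710639571945929766,
   41340226547811422233390757786557564346846027, 12810404947597129158937475,
   19813219681185335503037083019809334937668427, 42159208969458151084896820197733262,
   61712977989936863401518759, 1365934651382394317967532656110657372647512284,
   15661307796550309710114015965207948615776271, 44224216991569734036906092345703782,
   37212439983708125896310479918620113401206795,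
   50613923330245858235368927554847393151917440066730673255120371053718500499578876860928714325376028,
   45699669047775247836285983778602959, 141482528107784238255451429,
   1715920090167034145928259330975594014267457125, 121993727798071460594845359,
   263535867552261893, 45982037153325903547638963790609382,
   14974701613699881707047288215558919357842628710509902,
   3145490637629588342296803971140718537316806305976958759663475353657280309493798,
   143843321459216528177010334,
   538464631749891058615010142002313358681778391291783177606650840590065357291543,
   9524845181847582607771218516438635445932014067072223,
   8653674711722585017425445277752378882055820744054587934113815,
   19638182154641069334547296852342366151142447469590607, 20597458956772108140727243,
   31825878074901481618142058702997278,
   2697679856214326371396285521878346841229354097740685924703801358417966,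
   1490745580541126957413536022957478374868986150951652984479242363388287735039379118440272733259148406263203339246858425042469412436208486442051867884375297247228733334109552663,
   6871901173351492487202465155870896933390778549804741146183215,
   4513762925292349576850845760365348106244596305229787049291823,
   16125955606149427517577665655974412768089117686647627,
   11489534038242374460386343956958854857556191, 23253554370856103511756631053384953861697591,
   6696394723520614656152394816210875890955881977535862336930210679354742061892503413072888079998725556982483587256582990667676150254863409564392520942812046655711759143,
   236531399119754343, 22136438821365832259633479898034918, 8514993741649831522280559,
   6157559368303826681291914929132469801026183894138891,
   8324365382876923642781357268292278174499200469778690092302359,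
   845717427825428334480582503047463021929742374320160745847526156270598958903463450983271,
   43168730640500620985118243152465797, 129228408255877889732582735,
   1098717550273884549129114495017322002352104356690254582308168379808970, 218233887397181703,
   6836367731766509282336661376598062]

def mak8_34 : List ℕ :=
  [904698854914022514746886015880726794926216309719039580452210863889665944013,
   2417268451473965367998453255923138121125498226747212431385879426374634219556634462055469126134349733921453270005622850551442739166995847448371029120569159416935484626143674396,
   573303115833881974908726353041619651160338232391709522724262069078521047770522401877682499225165722711875904591494776744022534014963938764623726454697466548589741130506226895344252072624151,
   18323156335643223552125357870709564857468196892856493257450804340654990905164911746736670279331946590821106304586960485200001028137557974177070526684006601159281022093203495462474446840753183839036112926,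
   169059441696967301, 182559615899140111, 36894080532723031198866607777518103,
   69454579646663298746251769465090581, 55861938762585485377516503688065557,
   3250655624938186332169063572768469, 124453911996028286746659989,
   2488264537123243760048271870759617293138997335, 231882092844104919,
   6503918525407824662077449806633715067666677592579698778439735,
   2773531430602313659750206397948249684047865038287863,
   242504022520239866999491924640332391684867985994521919070514314152909133891747220531152511041582,
   41348707271416853214628130991090018782472222, 15676215729211327644762101217702305255938462,
   40880197963462655208528073759654959,
   5916938844533768224604694159619633845374673922112276022689823,
   32420516799313594677016315522861190175021534,
   17002449131643323169656072614263569758881643453766110,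
   31670805601623832234931018718427350162495902, 14310104288084317149028527900537213218478494,
   7682678719176730915733792224640820988857718925449630, 26654646254908609589714224257718686,
   645505506181903678471278109574571756567973087223389317886411263653936461058681418385074231086491905912943182096077397511681830924636588874338452819500064571421,
   68150208182526389757065710861948420, 14308285125606303886863918033858290707072021,
   15779069077034520948733062662736465682107499370727813,
   17699337139839065766360697509230331650526984435717716,
   26843644176618190926566276868864892213180181, 26654636434219991859224230045739423,
   48253758863469105428276277466629151,
   4430947984784064936887265214569545839904851812080355673209423960740275428274506861718288449027794033646956476640022867282033032977973269,
   42209200599115250434577546906752046, 85796251604265507643529546,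
   11918935560982568608607532726736046414871693894087195166114068,
   55863175337680786951720816758096662, 33105669365774968604515392052808681066246740,
   1844195208565439230482640844760408659821575965387755519057524835092050889944654365625623,
   69449390148970331809101207799090198, 6163430339119720561612866889565882328093960110604343,
   1677853804214737577387968721994590076734789177271839, 112331600175019390473899679,
   51730576607676045381772372, 129356886431735214468795599, 40869937305018484553962831288474631,
   3822828569219257772706096454037275414, 56468590276599461102220364918475023,
   15061910597757376610530711238030963546275742025168902, 143863448320472797075473415,
   12089264462764989716040132,
   443150283552814420517639628986622392637672038497974387784972668381279286379382535901038,
   69448637808007181233663807653964869, 129359569709871070376368302,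
   6969111061965671774570693622494224848055574,
   10630130809246534689260549511326762131515352186617885,
   33594809948374063528719969612307954902499335, 37854657267558224302691474182169262418821127]

def mak8_35 : List ℕ :=
  [70615895354157262346521255850164247,
   319019502427475046724289518035765028044425460355258113917310447971860526,
   53783543374465234939079958, 11138823877706884658716183384469930610511036683049282538785878,
   85848327488004629572898949,
   2085257832403901189364164786384946984131384053864028668997780961388439,
   28903395449713319156696392867182457334848471, 18193322529156666508725441655735303,
   610957488366868756525078099136666669896066896381962254024725, 129395947278426545345675333,
   18193560233526317333907163349778487,
   1539254420910434668442619083153939164126150352600939342572107146855493,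
   28874819907548715755562476694072598, 77268514463472646908298288378571722,
   35703074172689409659831389782627077,
   1539254418043506802597136773762080708436304570836327363938709310091030,
   399016364736912850946158272626452976899117986644262228728345459508222165173246371461883434355136578466310607726840044261936965967441327718598298252863609110549,
   9131259340607485349775210171172565160465205461994848005020974,
   3510914706790468553083412652356908177203402781732140132618103,
   9131259341329775422470892982986156825135304285326737827451951,
   2066049756122637638325570124912433521776080822343136363938926,
   4916985494403221339547987895084125986590321604345722579472247, 122070039677314455835123991,
   12494556256376247177507015215420458532630154251879702,
   4916985488041638306296748948972465923418424032151589746396718, 12905180480763914772153375,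
   1531964514320469189702686823702942147235540058864212706290129284688295,
   68917110981815789905252995, 26672653396659784024282273195285450,
   3271720613642180567129983968402510550, 20749740111658328091452778235293059066939971643397167,
   22567837035554089222123663871316519, 19736300902924478486556863228805143,
   3719659091034351835558970827243200096130439, 2443997614678152114167740649082060334323191,
   697908005418540768314705168323223256689709119309409195032668912144564536096043774771246,
   6928404914273567619305266606196974, 15639006309486038975855442866369463,
   2066051271609884704663988062146265697400485116266563952598318,
   6928416082071338522500099483911446,
   5935066613764193844113369214581072808024155844107411688978135905885486,
   1326510671866234173522924567160929903684403671239863668138680107012424420682223436981190293580262882516639124986762868097653050911554487637535899889955411068450938108676145943,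
   95590167600332433345166471, 2073323228141167921745579750789776032804115734,
   3311198324287768387852985075863331472321077501660443078347031,
   23172784423611801839839542574088424687704067, 51320610311621662236234348709165718,
   1539171397196388787093002581597342643915280789951397071974605165055854,
   12863190059368426464097854042618394772157487,
   17009728830626866203481062186371968468568991836334511,
   6240733108120712822676469867066560558998810649944027750925142,
   35703074253541076332991261205396429, 5340361561825367026423473189903283256374329648277965,
   398587314884159839002668918402886085328506571685826998114471206883698495414017085539500348017810570733094454373476610055672065679117916635211476735793406543381,
   69469677938475874756510654973275414, 38590899503066576649296818132098629716836727,
   8905652207415944548197381336903932176998960221976120413292703, 259207641400753485,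
   2464576656317042638056499768476260822572374023, 3093754196656064461847421528741716204109959]

def mak8_36 : List ℕ :=
  [95679057515163499679319150, 259130301245587886, 40915652627070153496011222093980614,
   73914194101047677751458823, 95665782822069171859967022,
   7239689613438715681124260799624985741226074641137693, 15830886693942707003915285,
   8563122459044933853980668706308913229285085,
   3463783101176985614733319562270924973966148378213815, 5782848686591644359585959800400285,
   33173982661800311213800190108022021, 14348430746223470930140718212910227089539305715449335,
   5902895155447466327154902141168029, 8426408994543299983810263707551511489560834119352494,
   69078483806106394324124421, 1666792627668282110139654702410956455871966191861909,
   261533902125448362552588612788179937525015667049351358964201092902593931788117758481827808720107730918731264688149,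
   28880777172231833420536598707034895509772062, 29412585420493866156983922565793793450333982,
   14042221137876489974365996486353554838728309079343623,
   6173590501575591795711063908240800265115679418167966,
   29412585412543430515612312314597517156716445, 34336623892032049226988809964320076419175342,
   3933235341802746446688842326595043606567111275644090830191709039343101741058131361001008063212661230062267831785013054055930200373165299916151732789842018343,
   1345971065888317523020462, 55902647313358807678402647724191406,
   170757204493228619113269835295333541546921432004024918688218078342164012479349558551,
   4474473057445317265807960078665220553507155361311131001953963603163167,
   3026360416094715859380298433260256487570624976424429878254766146348374,
   74121603845837928133945057884982851,
   34823867690072675147842995613105729223453377596416235398429335261095,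
   55900610379906149890518138965473667, 508541649428845206810440756768757127415381097778821167,
   48766028142812216676552165881852811, 30533792731266334907236900692352131,
   8117914450932557443510830568458920463167465632705259537469316,
   15523946919582708428907783190513565274260817038410862, 74732963167606697563171398839976055,
   3323227523791537824872658074576879317804069423960644924645463749754099443827758,
   3286467005135374284552754865399119, 4222491569087435428668263416221698652998509694812206,
   47461028282485793830891635328988181, 60299782997284952296612977013208452,
   276676678075776442370892737370936459649678347725540832712609646,
   339948052486065068127430710682506123976069223840721003313214360904092363521008988383787049569184673322769336548275070308312655454123154040252978662350833056913432906825767,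
   6230024609491758216326602022431750325194993859686259270751510,
   15691203316827473442011114330311398013322655,
   3312927162867570811189866848118429420775312300651099076639748230821755459636449648983171182746305249842901943200984492118661016125323283597897070568953525295,
   7932622557864246489806797086429158773773627858401759523534879,
   3315243563169598696936923336158530121667428987081777104321623,
   14775659729534199277586030566705760611005663266545575,
   7108747764174766253411282024166987488508484123670533,
   3178172587768601739361068571809296063875220317950830, 61668955818110773909740112212140037,
   4322020345295407360465841797605055216589801885136258735323123640434727, 96490359110816223,
   2263263761615422597250955723,
   1069536647305454829002398668237040908630312491988989427093548176871721902800917,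
   4650767756515601328753459307296689886819891937971963370583883327210501,
   339944203833412227255438285285524451167591400970511510668344352227886762876952381941699104493426185717820978382784688366198184631379328400204502931889800065637052793749524]

def mak8_37 : List ℕ :=
  [4646992635995855097586809423059914, 11031460262778816496727252279068256976187056793321519,
   14898035051725952289247134, 10647873885670112636584080058229302292705903229942404,
   1565376272860728241340765689514813464523256078227725931139936180250133,
   42351487696621931040288205, 1351536740171821623735848022699550219044397059,
   48320401864587813556955191897104494, 137244066919882826,
   1124560818558365341224313403089579109756865712666717,
   7772572147769662496962668020019650649427973258597179942279113832596764030900683718508302808256924052311180376065440206815253,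
   331375297756534680788565137588284658152280953739207280126236233333527,
   12506219007335169152695037690522769245045965638225670,
   742828508219130564095202211100533281300332286808066237370468930619439190728379874165376225140711159302289359653053145450055048625283320767616196280405,
   71384024599225713289501718, 6159300727175843662146070,
   591554069456744166387003728513763064966779937428363367269436695, 139236600700229963070455079,
   61769497816613947074567296776673070, 129476232369132071595733316,
   61684235507549488308358450637701124,
   1057843176603899838152252232407843055335252176279489455974746262011487184775877742297127,
   13463046339619392670287893, 40795264495656497328787685991710528492988831,
   73935811279502056289269511, 7173484244890748502398673243017490248094673393032631,
   21900146662758011999497854181607426519978673868636190,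
   7700213913644066693409995222007002799223044187801093,
   818183260717100887049589073643768948198827074404747121041574459766808188609403974212259044514833019857638869232959568353001804863935780236609406695316539711739217838109,
   267428487748876115030985754147372187455969214617078894537816201978511821231564556560924958325697201207196503923011058386951694474487240800320265746959923224126904775816312181538462075980218388,
   8336555577958736542243123972842834273620713084247447190373460,
   15530966111441523496696599891895830502043075935778261,
   4037227134840302460234101056220025009960491892308225196964548566136704811811625877701080034133991124902655769781660652724054252787847412695350279733815405476295025430,
   41390100678441435809859470914984483420842991, 20742189210740903926714646,
   33136142436533251674156780427693116117791765,
   22223195194463319929678768306430100171819407729764710,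
   5287064159678918858771468719480995491629812802802308,
   30328965253436563200889590007899170936224839, 27360212717685174706786948,
   27919573096061135919470726706924921844751686, 12131258400015597470078534669290752064881669,
   9095026519467047839361979031049928718681093, 27617425815030853917413788537355335,
   75865878878770300294709987095348567,
   168644796564055744662089297337796608062336561320659570144936616947532607688234942430534169659692279063986556633108,
   15130357614419308426243052296313980251255602960840047,
   5285776833286624745234904254666637586810041994213252, 18335462804551828465600048864327556,
   268319842422623437, 2213760219107194756, 16949723866036127162656460648742991,
   40936553798351963400773722983529109, 623631649549865019088476611763410390,
   24458040275970266504240661875527160082634198, 13659269331969553447768662617358343,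
   24461480624171463222494602459729749484934614,
   344875747239971313446166322302973694364232428479333122955888084859767282825609375153997260530371422275513632465103699202029595796701204,
   23782059906240947843819883307762692720966534, 18241810075292588099794345763730691]

def mak8_38 : List ℕ :=
  [257510573117743307, 41511897196438771287294785094470549342932134,
   967171262894446512428967266580711240737614978989564179145366094588052161499499761631263,
   29717718373576473362363399,
   997890806561771222084676662285983359568522436787951181270854584767924190515502,
   77319607263458788793997174441127047,
   3800434060547233423391522805865384410627767323126224044690559532662815,
   26733645547832068791040435560133781, 88366125216885834684571655,
   75886161288411730743305871178213743, 10490804968679182922078950334267399,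
   13008158734534178428295673612295535, 122190110634555325677618949,
   601484116599070232105477481495, 27943155145495706577552651583875081926224207,
   1196220281890460838189704293220787049439230645157227610687848513800636945575534097793100116758458009162061407204848678,
   1475575026869876700806271574665833286214526269390530125745608947563004358507061116678958,
   5344855003955771146958208328115003867362448526964848037508784879969420683276349693000536495202314616841995276982760168720069235735926121925256996913417708101955616799,
   14007807355248572863108636223408376377514423,
   16155222356415514325366317911444982023609117334841015,
   14352572507657899206174672835414524684554807,
   11616254054530008173291336909331468430866631407480247,
   2581420049129828354423745234972579413589159664526221288971744090150802059173834482465907950168675792585428582248450258602888328719395401237915026577754872837194338327,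
   11038830525085209744006311707940613694384622948116631,
   7092020827442866096044977727112772728923831, 3752262401811820775111036188783803665635366,
   41510365866108028449150326024732351614026499,
   5462156451647892207506448926468608912250999857479727,
   2253285658215783328321322714406146363306848084917982376067422683023333781207266602158450207847038122258635359965213488332379330998448722764106895818690088721542325258076291119,
   1407274470913440968158672079632119865162819143572974629232330779429286,
   3639140184305199949158830, 2765137966453763, 35770675731639523223392171214241797,
   2956212690549246988847724335467882440684459297654714949020802657288789,
   691034313415005497146927255407292139733744070918776188276652912213655890845303111009593601001606887698600934781625412396366879963159564128736781618016888415865274415,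
   12161819499973533275262670562338173281286272040698679,
   6404582627173302289855766518997752859737143,
   15718890758610854710567036184287310905236922981907195242167,
   1151723086834314961177777200902543789214132972480106340941011581016318028401168039235144081257314414510556781977493048302416468658085845056227754452604560651229467157,
   63869526110897851467692056751336417874195295685406446436630751768804110013439001505344243883173691313143580475134507461519639088857665743323907289537327392387221009215278784397399162911,
   4882787738250167849875411611242738402476863743611158,
   5331682021250492464928711778321163072513515837350823, 95699243198253445956932271,
   1329110175217960922923051256832492253674397734023465622,
   15856352173633201693184806421227737635478174532248213, 61621806286928052520436925743825354,
   4632686313458585132083690404305853362003488509338630857167382,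
   5361662518673299902963193297234775300723783762988183,
   8263830283171708520453538653995520045013283232391021527090261,
   2878072198904061579607896026974200245025587757459528271608239,
   2362252654389226613016825490287089625124404559908513703753061205159185853918810927541295026643824347746536222456562808276241414843420618274512242458990014030864711711,
   6197300424381644682346629, 218814637918730374, 30032318118078141387996466322630677484802182,
   30032312101979627051945080506838734021857486,
   606745483622764893348516740363280676153658615216330989640644323067814338592754050985697581465630,
   35217141396371851554829605101619982103305674, 2754213499696660,
   20471474074764170129319774639643059265212839,
   4262501421050053400639754138044016472419120034453359024416846944141342]

def mak8_39 : List ℕ :=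
  [1547301966095327745489489938920478291345731498198682871357608489517103,
   6891179387777652466404885544061371437735736503276013483065391,
   3947625744813512656044307141107395584439275089953886, 69070424448236169666109956,
   65619438753080078192094933699995935,
   787607385266332915033710332713565234372529969849756361957275702414559,
   20816974945694824690225350, 77337759698917760182849910629785734, 20816974945694824767727622,
   4264186413683447350559143238371771761556479272276476721182893724925975,
   61803426708417749426975616044687519, 74792020321963185166593869739861334,
   6235079429546370522717703, 61294431389375567, 1072512185689094613893120239,
   122225011619459015417729031,
   753318739687466032537816924898159676883634428438949971082524148757430264627138391196304718954543,
   4140046973031604339612283542612293165089161075613281969015732221117270,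
   95745731132520086939559939, 7743709697022684221774336349749860830985296289734821957153950,
   2845972921962218986226224379183647372368880293013666433210412586500182,
   5025556417225132589472974453850824791418219382221124191023903386965917,
   6131233719519652928279040274804134046449378462414403495114780803326682986388547596514567730289910721865905088226553268237320545076188529807584096894273405316585619479,
   18453011311297879108803417772846169088459109793044791,
   3949530105757023850005086884659311653546520982980884,
   24663760264115480464959367697187022356123287,
   9313550659183881817557816206254634765296161815348434421465108,
   71787401282718282611462684556397231, 7700136519616790361645622405754011151763289329893431,
   40812894828841998573237219867799711323529620,
   1538655033018964449012593083559341378267762751686871521519819259824423,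
   6191529905843919742076563725168717821591280346008266, 24267364975754501732318988,
   1045443400847265520614679429, 301104440876666989500071361819015928123348097080540294281485780,
   29446315312978386628484898864708597496416533,
   9906901967654632620000514595529617197660078391828248717878293,
   1198014934366096769381314051770913287617554844800710659422642468913383782620781119453540281474003336522894127234639797749891987167431855865993393565635055040025677313039400998,
   22844414110096602031834497322199306, 3513500239139128926305611117881674162536717648143639,
   77349426323835675991793946898129941, 13221687891042584117678421653304578452191051755464615,
   51399189906022363719984594799167767, 493344614320427617944653357623256914585418864129483796,
   1136677792577997569413675239754970799442513437518615810720626764943154028122390021723064482780345520747508617004571079791822520657836597273517814566505211112965509001181659174,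
   35566146767701097065326930392940725337390677, 74013516009094568387338399,
   7712623122517610090890048224318179573529090388428335, 50100349051122555075177696186860035,
   144057237459502027312757780, 233182005027911150099151020048407047946457221,
   50040392147776262579494747030591607,
   3459188953838205900859910046234361348196620835186509540904069,
   1720290324867514076905533350606769129575274787403823, 33252060368199131995631877396310303,
   34719062914409143693259093, 4697009294304748808996230475477767,
   334070939436056634735317795498802261124016031333317411934226179366815,
   2161438170947678675707231871317412995307631, 61945664134666052156078467]

def mak8_40 : List ℕ :=
  [10923361728690491857480928233002445122262987078074607751201181,
   5902689009212404453668723251013447429983106098068267665444231952596731209645998841269239701793252967629325791777027394185071864675737665002345327024041178419358203926,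
   35577035793788000180148757792916036191922671,
   9205541339208741606065422142878857702977659889938973,
   12523100821826679970886979896972035758720736429613333,
   1725625739550091681769026277147231941150136318876317, 15990598072979260447918539,
   30115665551092417442121677195212133391155293,
   12522415765599731087757828261072608114238418154569291, 8584893743268807050596447096306223,
   77360422889684066670646212138531860,
   3140587709913325787451568692221272925168378015895987043351,
   6708893484480961251017325889294551576337430754170632346617260453248990761357115064376543650041322195685780030823591898247965640723877202089025814760753629674803953694,
   8773467368277246546031876, 4083630629295023294140292542818929178159643438454534862604933,
   6592355379938425017431022594123421718853312698044806,
   10185333497532256898692782603691858350333206, 78883297117438173707712663,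
   9535153700973894942423729464934429, 255221820541885106484069473956344582,
   13571956605963626267807173, 2912898096569821, 70907781668152616190976992737230862,
   7561887958058014983460727045595298599947701298659357,
   1368580927917040112912066552377447459100475648564055210145699625468578871520329943948606038123506947098449025859865846822311919874580470044429982240996627128795556227124822046,
   15346045831010968538175643635373896927857997368731159,
   7717156458829159025248625661504936104387116660323895,
   8465273311055246548990094686476069276816595072825763349774085912452276429023376933428777758464977815129610802593183097399940523896879,
   138214006748556216807339942, 51418110117401448992058156708879620,
   2915052139520841829564724599515014175784969053477193942687796764664853,
   12279224104109360045808435616519018792276358,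
   2935477960176757401488658750314943209081469259831593221014663,
   5468229259756417928367488183525663264330671635834599,
   61883290875393132031703576138374918580497030304961013185738892478991230469023004013745951651052824098430558516282126232449913305386893962849188276414922752663801793142063134,
   895574812579031585807905890567369257938164508498509183040140440214997879488284153294265552118300188983039195390601307511859816127749655105108345721862224253087280978845514328479011133960432679,
   34081136711105626529075869, 69569658671732184170944853053327637,
   942214758661099288118095044073965489571026508316980639, 254075733145868484,
   53950887410485851533400260, 83061173629299394700641350, 40767807781652308810769128327669908,
   12477216538893735478081331771536141283079298752708630, 129595467227554943975073743,
   139266891699850366430548070, 2372681988324801772748886663,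
   156884859885226886356092473020102602663893943915425776807752604819555244910366555111446,
   20857296709131641784378756, 139346715913283198673135982,
   4864599454454381948256277868132313493240710155427936579988957975720981,
   44363142329176370243854836309191687, 4706536443484334065430269268995267,
   61975463341154671287485870, 8780513862446901111817748, 83666077853307709215017039,
   4481407929286025966849942718847471496272405964925122849560814052966431,
   7935832931096557091141855549584157377249297844033786011998612, 2921616284588694,
   74802227165716729458740201720381487]

def mak8_41 : List ℕ :=
  [61999887052946174155969199, 44930925395496955924955377060490116,
   5114579266563154314920652011693059696265275774560591978994915044622340,
   5568037572897967824886475050984711, 22730126003773448290590122480720916,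
   9293255732755058048105692128590676519342464925583003656467622,
   808404784548643970123652070894780362457030134076495331266663, 144130032842712485330178735,
   5481132806629679268287887153645228242098613310673583,
   311410601173766530171601672738544730784176681385574561502156753690851295495214,
   7170030526777945882674808872956935, 144143498677686569704545062, 10597603491375825927749322,
   2495494136144359290675555350975531268303087011227528780000582237683718,
   33293106015018812802907621966284846,
   2942660767082670493777983855033348782233025715110579459281583,
   11939150673285609528201786319700638267147108300249727686365862,
   4659390216925349464760840787849776795495911390543329164860373764959110,
   8847088313083553415801889345622242569346350226400374772189158359890018251975412485889549197507895451406520253287115773172990846754238477305053839407,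
   2645655781890661733655501704623515742535187922599673526378700823734687,
   5394281920728849370878238878605721757522475630644215641512511429294870,
   4928089732287938341232499584011359679568484080043858982994350, 42507046689255374915118084,
   1318958217893097561204365512031440442405586159,
   498963647339069021353105368260806558076659485514459997155326629681063,
   139385818619977891566472397, 35825772983027339597011971921290534, 66730702259714819401478685,
   151522781804269790, 2955566712356868, 151522739114810799, 2969999413084182, 151522771863871143,
   2955566712356886, 4510999621425692684, 2971897813838559, 2994751768036887,
   19233815366937939556925137114810070551494669,
   283750396058184805344921935040345759282019400399816616904228902, 27504290879135996120825615,
   25540364141992896608753953691749834997029159,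
   158848006031738432296346280367953535340953204436806843216876342487417262,
   144140909005428537951295535,
   2895900532856513664329619666308628223527294209682775436416919006618969939378214,
   334927386724785650285135738057061067797681087622874175602549148872333260197294146795575768723659122511711787728929754654234332341805885947908,
   74098437681845425713204998, 74097773644202000975616974, 61762999869607890419079195298164740,
   115042531378927891663965519, 61762992359190881382442654093945118,
   61762999887825083716764261621179542,
   628640133259309543182937942251792036237352602939659076783937612318618834629808499217583,
   35262659102218611625421702520489517522533639, 3717325245820111921771191,
   4627714973788817629196675698599760234934519093840759,
   14385051396757285223227675536371356442634499,
   9674143980183295809311312979271334915130727713156245360517807,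
   5685144235004737233432168209327279, 1172449326991329443216643557632111073263310201683971,
   5480789530092046609240559924937274698584450382223383]

def mak8_42 : List ℕ :=
  [20066806590703977913651723777156847122226971452111328534259905998640674883543042269705757795855062608157221824997764744356312660637577461976082284590,
   136460472742721389501875270, 3269004687370733898107174900214281924,
   77397715729487701856736240043080375, 44958191258080346048393518865655318,
   53654427434433342314909717, 16187823744407354111082532716937255, 139429938297849737374476615,
   3050218871280967, 3041869785202708, 110857726964191287, 3035703285907476,
   1088033253733709891990907076,
   735028951031320921754719610787851082101631395203404468739465212031686565403928647240329424011286,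
   69302594488893551473349581, 78959085876358571858630879, 499758581247083505389311513311839910,
   7060638818923409548752264101140693, 4323035546182964869585367675849471778881567,
   83741635639734999557933063, 4957633929790478400993346673404798760168734316298261,
   66812416329664832789025174, 5862165901570051496649833535901774775320599,
   117624948506260026080545655, 95864286298923460893891028, 78971776975089194988742925,
   42548132294640299562500103,
   1681013445185269257271415239837019565324203680962386114252006767899567599896724788513190,
   20633921786692999308241304406520868326672785317234694, 80720777518699167717048707,
   8847575811328945223874463724187887475787615534188765076652038, 133838947081259419771653031,
   1466268619102413383864186095205050612290095706245369095602845633270144590881992078262318,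
   42391769798473918771472367213534351, 36427803763813882240528315740859910,
   1083666849411595344198828499904920211914874743067740127007005458498820,
   88634034142281119822184477, 59615842920966867337151847,
   8136009204229112563480595207435438125049641048867509743396599,
   12209534273396032674578141117556068907649430, 5672203332773735257983222267688598,
   25052047628148905991582426534390039, 25052047703638289847847771688862028,
   909794087043346252784028494733161289917370475739314090363545197636806191890031967790520059559940,
   6863571507947756796500765619805267533745848138374662798624959867887339542848660027820793105982158806095699843931358710525639770871212743640051875887,
   97965215947217229986530894807840131333005153946885101361063857482361443427775210026293399289324319591397587391200323319592720348309116911946094099454623954455755625948845848052381289022246,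
   97108373913089232837621967, 138898434982738957354144413,
   4489396216094944930553019661561141333725508031037175771901959,
   8360899021588020103569412898881759113869169292763503, 129664826732290647799132364,
   1891618819212167970616964047516468230, 17415799375915886692320768216795216290077012268417110,
   96920788146375325, 37937812529895574118684042636908467908006789,
   73272900162807131974599635245484235, 7807526288681540363246786410138199973167151,
   152054099486354174384748375386363376503974831626793721210351878632636438,
   5299203111285121384902352370911262910625314663094363484346772,
   77405737676662206928902909391024074]

def mak8_43 : List ℕ :=
  [142842154811078003435913038, 8072558551254865604205468108637422,
   293946703285770031521346319895065058217490568988160050701099332376463959504834243812309,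
   4882099438504396089868799420826083065818560001740465340420777295609877,
   20317341144316949475467491461538582392792646736810150, 77428297573952639919944916551267631,
   139456252720474790131074343, 8477876797175452579538336069199752182087054734672101579685967,
   38649799455540622509161932655144007895267534, 69577876117841054874670825311710798,
   56040457284843857324851152948476110, 953699996593379151504751054714843067759037949353941383,
   59670946013261830119274262,
   4751706728612879854989256298961112951342959818837517394483425151680558,
   2794740732550433669835420413408626481400996305991028382708952134180614913229110033205482834228502874886133567395093356653514224089542041936096519837239012320304300071,
   1051778635790053520360594753807339725101496243012073220435916108230291140280883015815088420431511362282524389120382284633276055869396583643250927956587998765669381475629370582474217025266594271,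
   61808312157504294522648428052351525, 7278279148697541972455187466444234230753625777373190,
   39815680990859140654275061452243999, 17061431696026344612760500902971413, 183178271323988037,
   20265822727761327417022223454422689100857669, 4356099309861227506490769006861839960637470,
   39815680890840562058929425911776287, 17792976384909792745347795167307464526138391577937446,
   8785473663430351845275678, 16977375742710690466262107355384586709237774,
   304556688408439145288633924487816277721955926106408432828672195762534894410578248954418944802846,
   74160939448330617833344324,
   2184601152063191270295612355629472390006290704178455272617531848184231,
   593464308499607963609067706554535428689185863944644142116780128185879676861477,
   11603331485006344433943699582640214680875526, 77430080545085762173920599210115093,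
   2440691132588887352270595085252083011244741452535125408067286144710575,
   6545755245472587868379173906472680940764689917707373941229093,
   5348931409885989934433778995711251663378007991653369410224150,
   1984505923135617760569761118574062919623409141140443821653913427521031105027091460565911905283762772745806572519210479967414926100288748505717004640515522607,
   1051843942393154815503687264226083055397029692797831756207038091777525713396803937124190374253237628549824887141785163869975057174404545920973895719042960640786539322506960175870428228197548830,
   12457742253318020590641387358385612978066431539144902688290165203370994051993356803448815160253785535427366344752809292565700805890021945979555812966641378720827354761812975029912207729096061068486901798,
   42466547604800020, 3867787122170066014372064886791748125,
   13720968069626493515097391610901691536912132244651895, 97998778777013064740201351,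
   1132607437384004749453847443229012507610763740728128710464706492655670765814005858066487,
   34597467271218771697423425474637190868289799, 76169524160973556244699512775539869,
   141876794697686131976485916, 22763194245915590596896433625846686,
   29405906792563413737459022957431708194321879,
   12493527185715364943236697958761225545290065417647879,
   9854577955638640541064164885395247045164039, 71444749010319207309638675289258903,
   43349393132079042812505309883727621,
   734428297997162578367777551750611436913974017460503538673075059877290108811142227676192904840092,
   2206840778756586084805659127357032868515495, 60455486364647016946999123066170757,
   144216616565973508588745228, 59290459748285425232274220424101911,
   71444748993654743827013505198896902, 61886618107919253279032133842652060]

def mak8_44 : List ℕ :=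
  [10891002572707577633132938880991644510647, 32460694593952400224939806151244438581053645,
   46754047572204295885873076449609933,
   178354917577009670349136567416583801936289255719150028873929833268166180847155160328931780459626551,
   3549726295696948126160829003019980951589431349611376857448477,
   22259219353447296525458664251733226524751048459298309, 25361219316576194378737348919297183,
   6231895403416354716975158554635496241596209618223127, 59967951987967577901566796041236311,
   31694089045959935908238988485226188350176295, 106064567906892327,
   7760659332970155293048297434472010555089616919, 5361940403430739406297850953334830,
   2878701684472058773202060527928482402487278,
   4022581701147148700966777546383618441879496569886519756051683471701217563119882276048152870025151916277764,
   5392964205707069977899128858100980322111697579370119, 28908542904041287714924337732009143,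
   33345636917483981812642125488595511, 3189758629830413, 40302160485078810164857624837635879,
   71387716778850485755912544133408514740514782580553123253714948,
   13640494107585666085663315025584144296651053885378999,
   10045178607052612454388924430955205972420231, 62113846526757442919677463,
   56064938416824335621447188750802123, 167548162831612822, 76185570507384274260160323841860622,
   1738375468907501555708726301868797959850942141562886, 104436095923252204494417412,
   20381524424715899535239736000988674432477472223133751, 35879702653795853795488774011285127,
   314006745131743956136925190418239854094927048385956888437488182829754506805277,
   2895325621743242524262170447564354138806484378691256495012895, 139494743239011958093139471,
   9367519168994251290894401510232665613716225676704330934532485,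
   3418621885772303352654090062033013871586637562772058937237166,
   32046370339212525966702920886395447,
   5394263103877176091225579566377658610201281924214205694993451376217767,
   56065999413189780974753020006120455, 51499399937885627738868643152841291, 124580194558360778,
   22777267148282180097032707032791070,
   1180992596853590946563090710655187831093134440237110859809896291238988614676510,
   16183444817750556131996836602881123858926654366679854,
   287584966812262062067020867101239068994239452014695777068126172246519250821219647117767723117320668619731683978614921863956237519020253149743484010530097042169020940319,
   35880296746536093954218281114274206, 8923805887399066630404939,
   3735457881753330811438420922606637320022100343049873412, 8918020603858376337966599,
   17131505500290334492839530916644671045763863, 41217145461550147942028281317935492634289157,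
   1643150085004181617740189901334442215781601672808668344039429,
   18882802823129947755616700650041058476342021,
   2651151638567988246937124480382935412733260080185849583647811375272212,
   18882802862351564740003530531007367673876741,
   5048990046567394340934817283566177024484631280470358728114222,
   18483129264260398947438317656623847168391116252675476,
   34894457745816866432166999334121120164479767, 29498650972777601396861193626570091249803367,
   821560086183464600834996559230579341543549082880133]

def mak8_45 : List ℕ :=
  [18488975258825727307314008656952356129677249909228311,
   34438400140157596211776243770259808500450071, 17528092174444663884250279960331483010081198,
   953426338138226715667665341287950168241004452130973989154781413529009217102685785610239042623346582778958584118446226916294000354193112694830,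
   20678371681634651357363447514612865395512583, 60118372691474697312983697689721349,
   25577429463749101839950048136839223,
   2497114828119165001383499696648187846717158206442483849302277,
   1797904985151791096789864979046345576245278479045013497198164183483157,
   65432810877817700386411589534374302,
   3129088771991826970765187960658073807870448580143407445981549242767774,
   511868330571271912184114882967324636920995995887885047333395731555565211033994020686413912483137276011262856514249155426843717359414260594109389865756,
   14624885298613731919181644, 13145742120032587728055720562276828,
   1414893219468580933460295836412914642455344737635817487905127863844294103138333,
   965487611189753378109125468601906073382431081190890750299648560488462600503325,
   314852529349434309000730418456798537706310624894189702724596571080662102181533,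
   1663726305497832236721027268042067270113508401140608463455004, 259739215796393870,
   47284988235125855147261991, 56979321829798484807195823,
   3030070233612723220376774229169576217292756,
   17020156725441034124352525702645133494480120665431863, 43386199611340702172168298662909142,
   76560874426189150999435212, 2854536956841893622567779097182630215417887,
   63625926163325689874662499529928660,
   25995387688691882199221232618596686714656524651055074211568662544764192789271719,
   1681892771856775298295263071044893844058320144059910,
   2675880852218387923087734846244813653438127557839853733563911,
   56691696719611455122715927324534263, 63625945961849883985061857189355230, 82995359261433767,
   22845254375498061990755295295570094, 43392500647733688295040190969300271,
   63627349390856537081229972685502284, 5382004832368862915513312187561804,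
   13956133348323922173977385279791984933765179839708280810393947397189321260599809964769284,
   4487131046070997008228712154298143, 7746005741709980983001131514381512287624120749411846,
   2240291403531143847883334512569026765177374036343699048270301823247917276143280639958872495973800712186647537012572514070106115614653309648925,
   17761062324967726063820154399914146371427143394173957,
   37951831164229825473166958908833181053420381, 33938812991138780856181166794536670,
   74903821790725348033200729468970564, 258009146808552718, 88653954318575306260418461,
   73068197328096067580194916145299478,
   5293267351791164105743939897803672568696728629920582420002909642729094,
   117205969059569676567844421, 30351535895869952047302238195136793195369812,
   883844481864086506639313590931075566847295136077077105883433721560541,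
   34434625194513158596230818393265405460927751,
   3220464288863147674077731617471308468190955988811474446654941029089451104172113246770739193240318312971088506322949359626232745120971272773130010496592108309189046728015347732,
   115198235592685088959005966, 4477074424430831242701362439, 71679541460045701546783452,
   18774739606224066729372495186264503, 3266450736846254, 7335006617090839881995475246]

def mak8_46 : List ℕ :=
  [144320403031364275919475983, 41121213431759384172690681081189647,
   1888303990087458731344780477549178993842898356765107217269805673054222747303983,
   315798498883078427385453883733206552204401019496409415607439847426953886455197,
   86327671983537325711204255, 27704064055834246017127582,
   4466284002333700349020734454292391037671137718996948611329440962983325,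
   21075151978600735684618146451189775221108901387366610727589768180826937538325,
   4667930582640981696142202655730224610877600423935332178191401352837525, 87628953104696871,
   33214477296144293234744498217946765081319055, 7718064519950663, 160726793901227687,
   144320912795064540199697159, 42474915812594267290430536910110749, 3308782446518279,
   77481426335936724494872189379543086, 3900791513361000718678959, 63816076974464994890166799,
   708120779274808628887646015508699487409836558978006091172937757, 139555678541104804962940686,
   139557744591711901939687575,
   170503852485630114267842189136823321428992852817268640371974724964291017286824110,
   2196837179447178527332761018821917326582766357686546354218287303794657009779988797313111884274653330589543781152323523877905151898282651346272276,
   21091243762946327990549255, 129810851662372346857863430, 1804750399522391794237744509001316869,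
   36515363449131366138271964793066773, 13171963653260201686779989573056541, 241940081393183767,
   241970665312223244, 6396909730605870628672143523166852767,
   9538536260874453130616337129591835019246326622990874827554846,
   4432089942206641407451150950877769491631382,
   198420497625057147298433444202687628399688406489514089324001419331577626334272311420331918070726578315874766036647765514379984269353026936007208613388328588149764342839316,
   18203431631276468879178558622145183, 132308243281123915368941084, 3331021120501279,
   71041955640894346954393449198795743, 59771965309404641386067983,
   32099338251442681879796875909675341,
   1425039215741729174331084046183339357707986729615189980003187758791495914618901,
   9753160812331085649307260787065404206009153734119700,
   62149342158223232646706468723250324615986370311117552824440039147510292713988370062232186455504157968606594025211302687493,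
   6310400904963425680539317138741967805558469085514073934405725,
   26895758786461162328152193619491431,
   1867667050158484411099834032671334387101498255350559298950463523009340901232916,
   128266406636232320388545911343831787022463954697544891476406077960003641012336244418263119790594345640552155652022253475670447354243037970126042431509,
   47670678618277701939450603470748447,
   5397240500925260111379732271510299634961066393025148830691951747983518,
   40902358335732035832452457839084847, 12311819645476191663279356823,
   8487629209535377789914835978313367424137208465952033707008075,
   15800471917706578846728878211292694820036683,
   16945478137475975976687820228078813680947835764511878, 62402905241470414172543187058510495,
   8694697865678961911859597378704331090502638354587673984283270, 126706658290217927,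
   7292704718341528480388445283630011016583140011482581631501103,
   78376108600211226503846658370361812797754838399900]

def mak8_47 : List ℕ :=
  [76047307689679989842570164784748071066817588086315427184461,
   2389103420449135561983074196439015384580358155681613,
   339944088028552593790363177663451324086525364180474395817940081952867059892826760753976985056777993950378198804913925953103233816160390007403920688834799039131356816867375,
   61856328382991758, 66957188917153369209737127, 23975718282624192909856394201530398,
   144360575772307621963318923, 67949713634475497039477727,
   1812626114244642540853981500494129412938494148460484845499318293, 242010453266319108,
   48984045974331479167949853, 8729294277041494541164214197682183,
   4165406364900280697809782232896637752192415628050157130481677,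
   14452354296650976263882445688793995870609518,
   1002963997495500476570720805592559525570705282304424061545710596113776740671103993145267121770836983366931719264855189735136084698411082790820578116380,
   106157488348488342268446346790301191391565346655227905199268358466492178017262610037304438887151912962988965046080342410639785795644995463594350224550418680928493507954006198652819030278165,
   41063727583826665673077229367345247, 3390695970604039, 77499807267170900334343458097124365,
   65784555416795338209208509881147941, 165455063469221791,
   2325342125291462297750032154781805428342806, 62189238371258755194206807,
   126333232204366790512555319, 214729479691850503, 3404679140768165,
   6896258961381690457016449883963438,
   838542374020552287701508501960885898898005143186401467658709622673181434538031472465732222058533,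
   18499883560335619530867544424730681239620779052852645,
   3529212956438028373843816538393791945823122389114693597660884849437102,
   4916479395221709161076808110419342912207618207638465149712925,
   3091154978637388589970371751270354457826836926364434747952886971707663181427127,
   7837346721108298965150058652040601830814764758216510758746692097218270042679135863519805058031539089541639421964269211615261,
   21970882174841719137200364861130395551594309134365989,
   20416922729445705400751007548799058759559821745513783, 65779444103183958592726293360219685,
   19948919408160284279093346718699485470392343,
   5011254746356726632791453704001380134189859259131075831153332381554319,
   65781290048466227584680589475190415,
   19129271571783004973916301173101899180024256825662199885825095525791313337541893,
   1846751853961967596352218977216193601130301292590442057079372079418848911792815091103925439157416087339235868350349106067778165268796937672999,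
   13744511233989279876449272609902460183058382325752167, 7432434542063029651630749725523463,
   3989492244619210133868565955730269760578565, 17239770008812104060992373134569503809498023,
   95158394990909235545205305644199342385582311076295344133,
   2961398388409772167781378162618457354683457666552110106441895, 144376995609262859899782831,
   10220905888805184166837070532906162518491158, 51580906773114242475381653558403341,
   4324166505788454365684062799003671, 129846493124272592059779102, 129846493046767536488397959,
   165479802017234055, 80945827874306177006516878, 88841292317656473983466126,
   1176342364252620292822016342350571422280705525858884092771450720734148433018903,
   80945827793496620790367766, 72574069021648038426070223,
   38074738187494583843188041773967071856215574]

def mak8_48 : List ℕ :=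
  [105783469423451311069615639, 3470109983142407, 139631346929000959723833694,
   96112046392390642922575374, 4960039221538026345596541266437785956184776592578487129341999,
   18256864623338391476245127212916211181494631, 1145924670945817603236898002409775170779687,
   18256864639730934746731097550093288042672167, 31300355504590402729129979120908967,
   203851973486756292503590867074266827936475477647449201765542136685241262036484134,
   62222592032871466681005983, 25615865688875512903236188524455720889876503,
   8092148054418292226312887, 83970466059237020065996215, 33410055410695568417213728619264055,
   25995324362800440005576608994278079873917303117117906765273814398972142750269445,
   1619282512039062235308431664061615644763205758824171288551967493849125,
   2803653464654659588001320961420127218175013, 25617651549675861201774035630148747766213927,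
   83970478029132448009289742, 121597655890928120530591981016793531958885401462046726,
   5618012561860126385588247281803664742837746383271175, 237582347690859149,
   4002787091226610373512469185372007634478213, 41155755865273570995898340905734166,
   127543866758807682994494494, 160880029752790551, 3471874931556390, 3579099759706636325,
   214799246964826662, 62227058149747351652730662,
   2516545491333349449748037770338056103289658629377523336247392918831159,
   8188545725770522059530690550348421629830916824537453327674542198648689026012275332460532203584098661178524018587026196572021060876778995767,
   576601749934321680879672850316253856783979637832113046564411271202478, 120434464888251399,
   68475321148131043584651731046236190, 4001149499211382165661441390385462949969957,
   33238987469374685933101669455826418869036974, 76660932343298757897513911,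
   113721531643659958622437191, 36493233060488416376090388475150391,
   1215983338096241327108198093965538511426913045917917543687440906297885262348343,
   144405885651191346023674799, 23341938756859513890907262188377391665381671, 3458702096998662,
   88865207991268388062101517, 9103109153436206711698346969573712008840587224464927,
   219591979008984741, 40714087219204597734126445316276234,
   40252515515579878888849517539967147924520991, 32134452186013177853548953404110156,
   434157657006971292823266655207471,
   50505017823212395695628355813646728093317990063930572915327543441757839,
   127295331359619114762396566, 5829478123012122689383296397213708,
   181690300417222155374507204334838922417911414390154501, 76274227055067852143925319253884938,
   32130073742868610126313355907194415, 42519537588670850993650472522362911,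
   63154645527279572325761061]

def mak8_49 : List ℕ :=
  [113759310601868314681973013, 69772179500074520275771893637611815, 144430198019034779471735735,
   23852284439519555831464025749864205, 4371197850206791113500977733745381,
   175312348154034669801342931616180256021755413527609356274430616285769870818279462,
   41179328821183094520036332300928014,
   579865114374515855930794928120191278871515162817785743075938676957873592604303,
   4019111473880466087354918, 144430198001657547737300399, 2157445835150609597135416244246799,
   2157445747706863366961109546506509, 18845722941477385413091629075535526,
   248705901173732627823131876427284540886685992794889301595712482244152000565493314355247,
   73616240360575535, 21867760462132958112637304052165030533313575, 62260001966864119157808462,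
   62260002115118968290997807, 16965597453440041451938393460205747976667150,
   4014684749553937227512487, 117679170320000038, 40407741336539017900979888293150730,
   720260769844754570586259045837059670217453531429700249018052145461918036918310,
   244869059413440389299551696461764719325412756100491245031392169296144618756035744767682204483654635504096212955361534648478578111656082145287,
   152109774909804124, 152109784112515487, 37816339625579279243255702075412758,
   709396196973098792433022922775762728648716, 111350208316398062, 64678224972989173029928991,
   139598922126147129763104037, 1750909018456609405179027307255193108373045263,
   30700023843385922071006243104550701733774127, 7471300886805246996050491350338470,
   120472573914939669, 3523204043930438, 1256999083398244197017599823582618255234611821167270,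
   33425783449150391638353986591339110,
   450590399351100475890445383169157963376698697840096971148954750910319645369310887820493984890927,
   64644928577692453230418215, 5459193955807765831781137064936014,
   835774949277495620817107460200821041027712261740867499327517,
   1227152601319659301215746842113898705092215111191431927896641088298782,
   35106154932955570676709038, 10906279893201706663849676,
   1227192076350613894820750035458798028586265575207699099791542328492044,
   1179827153872085140795166000940813306132243472051048554781999582264301999292431874946353988651263191372541262581745996043120489263570455034980357409603614,
   41630446356785263911576534650172188595801102,
   1594023049421809899482499068162176418188877898930898518625367642017379705952872773729318,
   76510182765259038350829299923967148590294037823281080816826071038686266082342240791370686384799020197051108984140292927465034088478,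
   65281108481930873750348696235388266283179303765763970925802665064289098073305454497741296969604780921378869675015578256022807722675557972715418607014687141617437007706083391404234145792006,
   56163093217181284015222395090701894, 139599581003475093234811932,
   5848133743417707810958076993135388, 260024469695287942,
   10571739511182109037348150433745649354571665766426908,
   33528910512797444313336306411222888788075429, 3542251105444326,
   11386043578090450038809776598548494, 49579684930546081865086212]

def mak8_50 : List ℕ :=
  [37782122776132755660198, 694792033676106729659764947733348088409893722598277148,
   8257546621193175232635875425427647108522307940283420287099086,
   5869112065582596349992930549068439, 21254792123033297134764804, 46985703387441506440993189,
   2467222521844995882093747624351725612297093124, 22939657266609213182248100230785374,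
   1217653774666301410352105332291794259970289840152469268855899355948163644614053,
   152147128467375910, 14955624022446414721600634346564686, 63962767727747736148291599,
   129865173770678303029812302, 1671905170160931996397435964386185888369999893,
   19557360026893386311306635096792838209462478, 36001606253392272545537484408809227,
   2820262701548861471182403275057644282496589, 47758590113028043461119496461507063,
   18750813607121330569655157955735305814742903133745158, 115395905634227766562688717,
   3577217126621684888336929709945677, 62345495154939206352276300,
   107479559316304424010775095445620964958925937604523727877179780319107840733263621,
   2622852779035265318639494007471892759197801771869426548755133126357397924681339892453245052301596879852566788643884365420025771616579136520247,
   2826411246947515978302162018597370834726062, 18388173984608731917070145766183940,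
   32860911252804026719821729970319246,
   5887380360627045463937186397902364826163790349846476195363771797097390,
   10928141155472929227734126, 6174633524961001108739065258014529923629011370348218790595502,
   76729694826423697461619879, 15665520129885871414055697630506165607869607,
   24851181632028764188816588184759470, 51639774719054782239678452058862638,
   76126415430516928978137209265912942, 707451496827939361745860938816723366996606980,
   237730927747419084, 51639179248645594052318232252956023, 20633946712343954063494990,
   152161160502577527, 691138188913814123202567261809661211999993887,
   1225610754052707920171603508678670962487870552692229,
   38510344926150298812931032634842663773990879, 237730910674649423,
   1298084891866559006638404818996895, 2596159142242416627814781976192391, 237730927787310111,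
   1406072639759832004031384092092259382858146147214609302583333,
   10805106082639431496224434820914451268647846, 152161147579545463,
   4181393555341501270501757690564697125039278, 147423760065403140, 2141628923604098896059304261,
   16940169190329741862396863525636727494610169657508115902593281877748349307842019901577975763663971289152392926330919,
   1514154467358208336533949687014228974534389016181765,
   709396334853817560150292512951064718621701, 186156694621021390698827561853991352679479,
   8279832439563702945695628308449423654071493951226630,
   8069182644910612325304872752500683995109798,
   17792779039382513506945781741928944365422771880213559]

def mak8_51 : List ℕ :=
  [21658356402091567880535964065204896874440708, 2292996578026670315771697045725414176089621,
   5274780569009942153185822956076087, 10318927804158575575501508351620759320804357,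
   111483920513953669, 12402423564960228808866279400460183, 42553187202200661323767592629055791,
   264628714309118873828341366378704551163957824080744471,
   339076642427549423082598631794998976224370942235565169823381405194018726568432487067969823339133526884818916459041990972604496032052618306573275215266508522204803760149,
   34267045113487355304634647,
   955950194677530734950909723900154683434191081254178632753847712004921724168077568145317,
   11104289106787095031693141910819019404307444908861072766864806, 75937013277436248466674799,
   38992309518094806760922451082739716, 38518686496460496451033586348581701521074079,
   21287703807003898740943821, 7642308337688758991556706341192722518170923220220998,
   3491198347497035067123623, 20058500316994216049499569253597893372442533,
   61730246864511161668176675769129973557853897959942902345064450055970732470362331336151599,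
   8200393146228891279077743, 497957307316111533889534829525997100522889570675290302693289271,
   66664496714436157082906369458886339241200240826881216088002631457612955800378843460077894241497282307877666737153311772634855904950663042809499149232867215746210171971436566,
   3667904264407301, 3592745403966402525725197689584462, 5891767429001839352671830520702671,
   9472213139990676506966466749057356612442413900181028141531166,
   36615083607996061858242199775613510, 58115129321720997651067167, 58115129321720997702022431,
   2839061503460713351028686905724276322787378637865096099443636893559936107853663,
   129897693778606434220926598,
   5214525251833678219544557143302220656919290839600425028690570829026631,
   5124973607610973316869144968600203994165034696278347355076978929439453,
   53383811023735450819672623,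
   2165270587655707061422475465593419837865711668206819008548554844170167,
   1109469360871834996385791966859504948709259830526440671347442565769547768575847,
   59962644283363822143837679, 9475582716296324449656018105942566, 126811769561958028,
   57428965490836123099405003, 8044168083638895892047936792230019382980829887830593858699295,
   4676216956192174774452671105173435181244084586737708803755057870976871,
   40282528754615066874621928708007704612114790, 12286924201500652551138350350315170672041286,
   595641826994729881541080032899176189722900093208099717624892591154528372136714480826215,
   1382699622727007904984636143960455993930106500937936999417430594730966478109735892616550221626029784240501132842788484533161454166593684282050981497311167365003785247,
   13266393081584365304926515059121519, 47775062096330761392244594942158620,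
   315045412659362610941389198495944841322482333, 108884479738861927025783135,
   35179058639060559109294502,
   5288183163935925104431069009546830654165770434354717965161508250845197,
   70331001489857048878515717, 686818350627610992761977979488647674016322976103,
   10069169397705161695616180899035211574471473291699596366365925,
   2789217142802603221188544912387049125818174139136320292593966635968133220626071039420740718121120854435179039591757881147502548222028780533781971511178952743,
   98061473709903750515011959182901341076380220584624740582758956716482571137459562925744771002261327099181303574315820837585748842573317888120904134789804881686200652981056459272074952751,
   3693309131513374, 142187880482168391937818637]

def mak8_52 : List ℕ :=
  [5908484363863780684859900937952157, 18417112398847041343681037675400453,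
   28255932994147687513404427677601029, 24745262604653885660770502, 2353000493241817940604879703,
   104723496317385749605924554, 9856625289346340685765190254887754535010334,
   615292058905279677479659625180651454389387128546729596178939868, 62428736879596547778948558,
   13284992925212428988108516268511572,
   5939573782928463999752266569139771596694266166575749927689518, 89011908356146718067070922,
   2977458915587759463165780231358424265316538945222387903257702,
   33509082048428145419133897678445135, 129942391592734099224317382, 57465531898361831771626023,
   1508698371358698116797384295345869005751230862094114081472518,
   11063318295971805193569155023967244448472518870695951,
   19516763330468204186827368823768303907943059391175975,
   3331302438872491499064814160161719746731447300762635265690858049561977881712806,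
   142200090775433478020462347, 142208944658082363310778251,
   1669303415405583053713694055438126239292250969341957,
   13241079397833394337134823743872039458439183,
   11800230188523167892591986620352462330066339178217477, 127103788563079684,
   11128934422956049104901271267049518, 40940074589516441259581773420479622,
   111218301932020943372713100923174137675179089632310580811923278272580374956605470,
   40099094463486656970157564981248692068594830, 65880916825830392846653832312531150,
   17024000218446550299691905313859759, 33516172775330387397369762039782694,
   250608185122011349222990267201637702924169859005202061340410166433903735941215657044015,
   139274062802648335257964295, 2840698224397763308818178467900083324007135628128334980841519,
   13759492917440211082159111, 47797411865837828997532481008697355, 3733775622996430,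
   47790610422235190939169282204283275,
   425865123086288416801631873465179564848692937204223215118991471004965750532714172556251768755650908127262,
   1016279218800228387533452432120590363600680782370676581132468227030719217837098609754967928030296253961393259350815213292467465409594132633921024688167,
   89007866101649811995046663, 8528093213234728849533471058313455795377997820452438993813278,
   5850785203175667632642511627509270679501595986803182908799494, 135605197608737623779467277,
   966866053884905268592224915011282935214506607, 144556473122180624865341003,
   937328197124931584322138331568082211570188911, 14157838564388917833926117613167226307006598,
   34083913233052950018771445376123183, 38198993871219380888271772899182875661466662,
   9946707027601781282685047061078217062445586077198297028645534,
   3372633988598369574692437965427324938841915810013359750335406,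
   7787019060099861057176707991529313717095566235979910, 27017698379010296402194528544906885,
   5412741182031175390717423728234397913959953829421910473470738383795229,
   34978114011031382425256645632773349257831534, 34512071261568567940331779894576869763207828,
   5234962443023709957064672661432347649295454423243543304010656070390201108786232341135448860803612807214809388246717375899979075512247685422558216215]

def mak8_53 : List ℕ :=
  [2617830336012597653863439,
   33575775342208625631484815744961768087918647084127726812718146202566502055095,
   64931145699722263913967550292581893, 4650321234572430, 142252783833176335536536202,
   18493130216397326477716505096301188675629559495342999, 53475787442690816974929998,
   79385505277347908698438671, 15418476267645286, 77629404937303099413496498885754893,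
   1283691906083636053485478972693267068348710681990320677152027306111848752873502,
   62419937530548573163925935,
   1662615989266133453690035090355181928881887413746802821198241133182144963195687591790492,
   36324711726702238510198639715957837695664337850122964594268283795859886423473790353667266523588194235476799303492696408836,
   139832225274384749144267654, 3811671653436711, 993518423236336815656231, 3811671669957543,
   1899125649516227978288308754768199700, 22966355149045378129173205842133150,
   22966355181137658229293501491852062, 14939291188107937221886726,
   65899573803800971078054416769613855, 13524897420690015533253962914314937727009274244104350,
   8019277512595214334415516048172054, 41673139820792315030349606085273606953107487,
   5803230027741205852968170465263647, 122747521485130690444967711,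
   41399911920131447755970988086947087419804598365735648318443373527881312159108364388194266926999912244483896687412796981279,
   27956637374389003905031710,
   137778055520171842620210894038268297957794230589845599054519139572068652948125,
   5459363257190122488793790840979961674563295261481375458657951,
   1619347601715904710607241128348945890206552536717203063900452279615630178838637096262422,
   1179827153872088907703472793820122158763572340918350110872639164139014428430865575692782372315479535155029861229292333777998084701115823778809955626254382,
   873942460124073658362724064168250352340520123330431537522908800305201349826535,
   19868328675697005086269845071608694007633258347979164,
   1200580880900006586011074957374530749273138233527385053885155249078010768739133973496236045018758858545801566762009193933725166858124965119189319691,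
   9758105613710922107069726365399425875993813819877063583352560292164755863827009570889058630606167568370744381553131302305957151421975496517,
   116883737113710794049495866214547020698754422604761123730071912346677666902798339149726381905190272236514204191893226772959549562396887639588348797795455402676715368501989610683925397526,
   7083172915609039057196131256680987982368517545112030833181409266249434959620745469103248803591326987609395747575139737595665972114559965744156892407261771355408510117788118633003160196759771412484904976422,
   6775052538855340900959052,
   825087915504000841644760120346754355366719182449009344540388709089343015,
   13769607486196287640127857436073561472839635767585183, 20835396065327297685851922699536405,
   441470333791177989194643013346620012910565545283311431521819626831901,
   34993156340883583985604980955198824013905719, 27962166696913722163772739,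
   32231613218511554977128383190193415, 127730653906668587799036812,
   26030186982042365502120747853676574, 52014576841768570447369182835557927,
   20837884407002809950379202704965927, 27972128315953835860969550,
   21797195863081345164200106772342277228731591364347543069829606747914068389341881841769021159905466874512926,
   9654017805036700821574983535615073450083462467305271,
   4158740682855449218228878086316366862991677525590037, 20756371974873129247495427,
   4588478496946004039390765311438110541,
   2608483142484862625524763896211747143516240844512377374711793611286661470815632308552506622364118075452577153579090919863867186157652145369990607929374,
   10335335786797299492848762098940572701296150]

def mak8_54 : List ℕ :=
  [39649130473830762081142504180012683175218380096322784018969943890094203850243335600951674943006695609779703944912966198276461942154898894879,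
   56267623863960275423402239650721559, 71666092646264518150255515497013790,
   30207180417719422721156960553951991551392663, 130117067339247927297877708,
   30207174424773737092681515520776514214310679,
   1776585345075003315040296005938550401559563841483173055876682177339303938181684975894583,
   36684753268633503873526440389248799, 990871582071769487844837215,
   14526125155092817314717949498211189538567199,
   4774733853157843915426455200432061576768230394807407663959591826798758206733517004125247296825543327263015071450095165778587320150651479200403082166189162524,
   4580297370949767348950247509515206807861454966679775281292454, 47131506804063788744899999,
   2458436027697673906333766596863360618800573332166764270756528306990886, 3877607073845782,
   3597451459247086730477599, 18468590553562802036712884954146360310749567776064744479,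
   5820169707111342351676200428465287778295363699104500677810902559127417690383849842767505218209725283785858558773303561946431255705166544673738253496274301991,
   39981169733601517152730069848163862, 10346224864070012614521180334207572170658564,
   4884227087747125684531244585292580000060178474905122917337142975661050287444832758194234032631000894607628500988107890847110371724229674012423005223831608988553884693,
   825648021510833413559398651674352533203163740965490127426308,
   13965954325336854336449316905790832512731397,
   10411573650071738564647367304254187607998558922658028619439761884759235880189124811058704078664168687457262215887246320289677554702761000191519798311,
   1017813597575399132939083153046189490253977970313032564129963155541299209050345281698910634359132357340691080404528630514998463460633051015922381989246857039392807231117934207594986524616294447,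
   10514544303056650547325337896169765709116064137358375257188547919536353387941196347667512617101482448969197348220217050415383328904486767602345835225402213176466183230731890212313184363790144759135319474438933,
   118063095141157895314102148, 88994008498986598633456908,
   11193996372985637321768746466191176447819781, 118085395453323370346246788,
   114743534186767710586204435605195950348292841426932338445714101919069639030494936951,
   130115335134500929116338637, 20812505140277783954430211322704477147757735353860830,
   62076963592200594057281328605358479, 5387371127067491050042772035428912888444287139059031,
   10153553709978873160210293422588023087302151, 29057019954299070183416774227671372,
   16093673420771095798967709135274007, 8036778081702821535997553701643274,
   6406559177273567014245154784911343467186375, 115540075745098008179560198,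
   15707669983630877053614021801805770656901519, 10153553719845724297847158364980870143625415,
   2874960482160185404221933494013866269907607706898312398432655,
   4878289958326297899308640079001831804586183,
   75772016688574193311987728072043209742973279111136253404025653822084410811904784964757025347318621305515580199014586070212046881756,
   15891418461105248218906806900131157414669623,
   16220268153785863904672273606733841218962956518772759, 27869941367052234,
   139799728525416635256575134, 20656861905831546974716709270647381623243316427489335,
   38476386941518276377086715953587501725943941,
   12261443008827730187998155133254858438460015906373351830527948125637394636728483819909098571289743907350140629097694717149538692027418781034383219153283579959,
   9317514943844607840253315, 96312986981646500532352387,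
   844376867923493407765486341857279265698375417064507784579460248572116594752606,
   8531639936732419889121920537835912819184126728480333,
   7513502305004826636009625700496751884501239, 50397528323260325502138700,
   144699774484523650724416919]

def mak8_55 : List ℕ :=
  [127313980336816247, 4053410762415047250338075046787731617335524803193695387532721519478071,
   104845502543044694669701891, 6663146728470097780748929554977131791341352466843672042972234,
   43059567923579877848479082054846597, 4612501227736001981696643090945862077025102279606327,
   12392198509354845585383248971960312867717143, 5585036929497441768850037532787141,
   22007880304672531586794717790292264516714631,
   3421972550086586949069290610518643841168563960460494,
   12392198466210988647840574509155506382981893, 6373920621663402826416013955147863678124167,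
   3421972562987611958489658139009463146116567205806215,
   12010108600552993200984416832983593931493420807581815016300148124857027868094802112130672053976937543827851195711503,
   8744408723467433785386304455780901199414047,
   2514217284892644366098097489225784151480733875644100157347909250277537602469917,
   7438852977805585085123045062835411041647985979351968522567709,
   1544595602480910192817480478568248849773207693061431, 13008156041136013415923756724325143,
   11092103428200949911481617099135378483298283894163921695417933,
   38487276047642647489021933197716088444324045,
   13780668746433482468798977914809803854261416193314350, 5022585166693285827759825327282700,
   8722943482609275826035804345341636144494447001838669319372846, 139910290791878346345899527,
   1183788183244072557734851325662751922913059654601934627808055569688860180893470,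
   535883268349555534754497503409666400232547246323821971059277568530704357828527925027251925784196908788850991287157026139995122825472283232359879326085454888991,
   1918178092808749744564219605077932057054706409678665598939210859628756,
   10752922629007684559598956728700947675066772088357407,
   20789814354858156718885255769318742515435085, 36821319539038691220084262220512688651454597,
   1254520707035025566480517461090504884492174772731807,
   17441033494439660258853322178235931756961136651404055,
   672680267529549361850892435482552508683535606320959611506636, 118099488653110991214749258,
   1254520705085503936230730943954230248815412039993477, 56399281279561857678706725107007572,
   23491863503221816032580226892324126604672845, 24784171088205688291772107102648721390446748,
   3202687075991948843389802883326193751448852,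
   16254030961187447503496933077303056423044661695791015,
   36821319530966936038011280408887523835658061, 5355757896072415146240173280366540,
   27070538171718546153358771407659437801734935,
   398372789956881173207808872615943213014397862599178275982854478813381805338824574765755826416008011078734828612466232374049222023156009829632530260918050357462,
   238105294409568663, 53547175500512774435373085, 1220144651222287061352555799703,
   57591420664147790556481046, 2236366828255264379572470164615427899419658354591,
   5200087348561554880721224031773720888716791600713650652481893058756701,
   23487742953674086750251644156652194089556446,
   3261058045284144780941015309635707004664379068961171444652832340203998,
   5626140108290749116873131415214486553760862901167391326809675179666571824651950592751517889944454293888376266174829575496248655472449071108156201501468,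
   31897379745040068840983818753099267179620590, 57588728887051313075520070,
   17124692933444900072437833766414267518603444768214574,
   35014647041095116350893463268511601334157397,
   5555889078201919152288238492404782879751292149227535203262294598826659332774148481994007105486410310676148523260602889731187729929166482292779963414052392671740166164,
   4254160332155519036635982]

def mak8_56 : List ℕ :=
  [24473859055603234382312309868693,
   199835733537001307611924267222100497743356805052441763010839788748972997583544230990477414753786029097529140127586142166075423472171633581660937712084087207728824426067988,
   19664509922062044708931369709126535,
   2515793490651377671720877515730573571160422396645400828881168992897410203046805,
   1551422359355357381125196387376253613635553360483871,
   3164048435071236446380709356295606252377594483238276,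
   5622835691839846818167921171494518332150065015105781757155777234893855, 4023314411043566,
   39258355386559612588089291577440854,
   1562218187142881337194673606521769778945457048291655435156150831387872982726324393273820,
   625946313202792895780294188342182440157691337401882120274681847899878740045818362050212250389135794080441571728529602149272087226878403936285,
   18862517357663402952181538646656343947241734, 131323061146231382, 3878342053724956,
   62073223891548230780537472448200735, 64981389991953131121842462,
   16890490537826431288839397023268558921596087, 25779818973192278507794237458434279,
   3636878900252157040422229727337320312579674476883601007227149034586118,
   539837735178860940355853214173664805469779956274146716751567639957174767732751064409480477338748617631966565138201254559076746021260562100210605651988,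
   106565402524518614340951721331210834004078050763139449416669700155093050697089094045640028829126044401881476231363611675191808266341085263555554680271984536522969930439727507209254833618965,
   62594776737617597396445713075340949,
   1940651752575457412891127026183794414338666708545383402500372,
   623913194041238584871844136951450034675482287925485606456955359523740,
   34701426627550234696519747, 38496889162594472860575288787451356553233421,
   18034888108352488237603838297364393034183494, 220156290158053981,
   76431749739476643609327757941165962, 56304623908847083267290362474921989,
   23025409486044518594469268075799982,
   106059136111220783120000830542329637518808851749233127692242106537659466526,
   56311230530783951138420844082804636, 10691737408628414763669799, 4760412310664443678788468575,
   1573880779856301234750208682142954563448277237875720238444188291563566,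
   23133427332085716676263130439020600006493187, 40336012320053364167906557889210510947708335,
   24404618702798157069849258119298606,
   3081516465910556081373611759214802818519666921082334796780448804206235497984223,
   1961984890293103561948683506789332464644102, 136045152533290659112049999,
   5437101238024419956331644326128786467272778305249443999931998,
   23997301389454879706898957997246367, 35367099995035908262004055,
   180177928760002487878951610679686069448700147039794466901670687,
   5023029758866352443108253257757858735931222419948232440616903938989597,
   3616308103132976137849992414084679900127907675197974,
   11990336644920802109421629377483421110310386099236870, 130079651886012805801883341,
   139951096133916558501633103, 31132380848141691130001101,
   304103833190401275391427803253245247743876569983701438520812933527638,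
   27780215101533523965866366516815910593443567, 40335606115143682196322439234078108004385966,
   42888260136810257544155094,
   87507449997258077947766413458365076969959792857559016060974240044839951176781002765653,
   96382517358800374397452421, 11992437453784759955717083207497202012719644414098190,
   1097072929084815189400079435430765327553656956255037934093635501679138493227146133561971728137752067788170776649170052994077384737999967748127]

def mak8_57 : List ℕ :=
  [79527514405766150069690759, 2356718560044962403168579185214803686650671,
   3213599266737433048410770990, 23044761367572999142798916377794719,
   13350066353607193928729171326895306034703143159332910,
   11090202317831017845884166029734747015115344457974917,
   3191599168853446070710228076874238496614625293734972113675598585851536759373239,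
   31921317858026184332158132005942199421581574, 33596718255549890233018335,
   36349420218344472198450879023985809189503014,
   14282936092854274089805398274188603990882703956256439,
   768399676623695536632787853634810248403738658114445155516164545896384261287579380384566787089957801095545600587472792634928605491956620593141961981982,
   5457193163259363889114842048780604941593586111131976276630956955811751,
   31917489653173953123428231714518564538033527, 215411374404168559,
   3638625032328439362937035911480699521535481368691094489536216525621084,
   4251205367274476066766459084829461429170638, 27092652517945945040723027499146171798136183,
   1824368525067508598377680392086385660189225645415479,
   5741021954651058200347757511823426726109804464433930851647655,
   1631893552486528421362277864041574374077625510245245049461458554891687,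
   8732918484036275499947202984290559587624894588890355039777287,
   8747218063164498619759972728904954372171063,
   1631893550871204184262203433344604823549819511807564764584758831744175,
   6042328997213499921242233505867806188758941343368049406662329260810177196300740360990158230496513990762303180135625493707882464123735661675936980494673717181561176092,
   114059063396058688670687270, 2758975010751206333087765,
   34062566501921535699958751040897589139695022, 37982026891111620893548711226278685,
   36683955055042734354641881244106807,
   2113649321148416823554554651329623426367077354052765456821116654945021888299063,
   161513279732056999, 76184679050644871220035606, 30007354501589785794714923757274836,
   59706967599193509306854749, 10207685361900516733625638988525658984939567,
   8336037798749039429008889567892277909160321359088921011960982,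
   31772604983928315081375371742862127, 39107023366310885517464985700812654,
   34366396139310387572267830362913966,
   129487384403386964271809668177100782623788247021765165580397792991658775302472064946678319440101298405423,
   62566510472890616715610262,
   997747192291312448973960331349228634932877398142310350942980701026589523775134394284591,
   47894482645348374787954359926527375, 3749133814302412247861356950461835070293447641399301,
   47900601669910130262556265237593229,
   834880176161495514781984802397008221692148414446408016381063, 220202061436043166,
   3264007762302815351898722363619738407, 39821291384289982386119440859189922240659471,
   64244814477951118717560974,
   1247682973629939022769846964776867631261073636874043499824402593001335988210156087279638,
   945426553785819300515397613492444387991063850082948193225232883213749751223910594995521341987772245692787676556692058800134,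
   152646117341022127, 4082983279525918, 1670322431713582773960969621,
   615726376849641328600621725678367, 127262887127811165, 43661912333525921056103992139449437,
   19005471514176941245870622248277661]

def mak8_58 : List ℕ :=
  [4161608171274350, 23109307306313732611618375614024439, 35436942009596330305928221,
   72533013596647932242772074985263563733584581272909354570041339892858935,
   42721080421035589723830957985974799,
   1636713336573805727418580508429609063629242250634167382298541755990071,
   878995260830113316708289650532116073044337580383989553308595411157624024751919,
   140028069531562629540894031, 7518729749962388278884779929712588135928622234515207,
   10384625870268606177621572432577295, 62663448224619077976494231,
   42721080397613084014772572038442454, 77727921448476892430536686833928495,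
   36703953994426042308756191722119087,
   1288332695532270480973143344373963209161622709833977834390514253956380253749270,
   16663457852335844761217118, 873488579069161548231826453225059797, 20951892604883648114601430,
   11004972092517688359392686, 144788390196891284354373207,
   1248171007643477858758415566898094783917680679854037722329587293508051795273892785504151,
   291286094904652335628956134403923860951537351642367766243540292491203886159172364942691546398534568796843740744900484650451719558023,
   5420174360619022827465878938876935, 1080652563547182117368032518615173265391118,
   197547099274094317569796791821323134023267069338855657669675450388,
   9133727394039346648213338982251453299751443258096913182238671, 86793375845692790548880462,
   204975947143627360367780906072322226344335777763910, 63507507246288542588129839,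
   25379362743250602554732691136382222,
   10100777514878268283607477127227204872073044461243768892293135,
   10305374833705993598696118980834374915814073769577236250633651369252481986261272015003662072061359334896355248193572755592262672547412123844366380940625182751,
   62663443124603558657287052, 1064350943105308955789405876323402127306134776709141,
   5627022672551389978189949810020742002574054697793005567782243136438310,
   15971840057736551005578132738354438559390916437906781,
   5189969386724385050365836523947578789271163380224246551007405402936238,
   5809962533547490295218301897193691749867986926501591764541166329482434410781381540057501299088446609800738228719360154787609669856900621574328545075840433356,
   5190593109271722488711249053340127665191642497370539899218626529490079,
   20543004720863712974471995270115412193912740238238735, 119089384127040185811732254,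
   4486794330265453687986975362123550,
   70473368454852195307684479716220382363666211022184700496642203810005012,
   50550211377065043739021020,
   433053314346492594086937752731677166116251399984022337588263550558311099296286084986243889786744923687225378903396338825157080439887271233674983512525218743499358543317827589,
   117082913861388077313710254206294489617096703901254680970535408904252365640737690712057613905657171623185997188981622668891823495089355380090857621036794302757436463282495155952421175334,
   7200746115283812425736659016052354181710627403278695573039077008513873407912334739698993736584642433470453661075474821127527253824735623916607433604160137445431295339176977671894293120840189758062748500006,
   546270200902313079707133205514602680044771300046299408243778110822550715376425208385888342149086242536689187552603182749879650754520786213753945396416975599076941220697981266346939923529204508548023295764504914561302790164]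

def mak8_leaves : List ℕ :=
  [4800925335842029572]

def mak8_cert : List (List ℕ) :=
  [mak8_0, mak8_1, mak8_2, mak8_3, mak8_4, mak8_5, mak8_6, mak8_7, mak8_8, mak8_9, mak8_10,
   mak8_11, mak8_12, mak8_13, mak8_14, mak8_15, mak8_16, mak8_17, mak8_18, mak8_19, mak8_20,
   mak8_21, mak8_22, mak8_23, mak8_24, mak8_25, mak8_26, mak8_27, mak8_28, mak8_29, mak8_30,
   mak8_31, mak8_32, mak8_33, mak8_34, mak8_35, mak8_36, mak8_37, mak8_38, mak8_39, mak8_40,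
   mak8_41, mak8_42, mak8_43, mak8_44, mak8_45, mak8_46, mak8_47, mak8_48, mak8_49, mak8_50,
   mak8_51, mak8_52, mak8_53, mak8_54, mak8_55, mak8_56, mak8_57, mak8_58]

theorem mak8_run : result 8 4800925335842029572 mak8_leaves mak8_cert =
    169808226154283146659436149247785828352 := by
  decide +kernel

end FHP

/-! ### Soundness of the checker -/

namespace FHP

theorem force_cases {β : Type} (R : β → Prop) {a : ℕ} {d : β} {f : ℕ → β}
    (hd : R d) (hf : R (f a)) : R (force a d f) := by
  cases a with
  | zero => exact hd
  | succ k => exact hf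

theorem lget_cases {β : Type} (R : β → Prop) {d : β} (hd : R d) :
    ∀ (l : List β), (∀ x ∈ l, R x) → ∀ i, R (lget d l i) := by
  intro l
  induction l with
  | nil => intro _ i; exact hd
  | cons h t ih =>
    intro hl i
    cases i with
    | zero => exact hl h (by simp)
    | succ j => exact ih (fun x hx => hl x (by simp [hx])) j

theorem testBit_dsw (s m x k : ℕ) :
    (dsw s m x).testBit k =
      ((x.testBit k ^^ ((x.testBit (k + s) ^^ x.testBit k) && m.testBit k)) ^^
        (decide (s ≤ k) && ((x.testBit (k - s + s) ^^ x.testBit (k - s)) && m.testBit (k - s)))) := by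
  change ((x ^^^ (((x >>> s) ^^^ x) &&& m)) ^^^ ((((x >>> s) ^^^ x) &&& m) <<< s)).testBit k = _
  simp only [Nat.testBit_xor, Nat.testBit_and, Nat.testBit_shiftLeft, Nat.testBit_shiftRight]
  simp only [Nat.add_comm s]

theorem rowmask_bit : ∀ i < 8, ∀ k < 128,
    (Nat.shiftLeft 4703919738795935662335 (Nat.mul 8 i)).testBit k = decide (k / 8 % 8 = i) := by
  decide +kernel

theorem colmask_bit : ∀ i < 8, ∀ k < 128,
    (Nat.shiftLeft 1334440654591915542993625911497130241 i).testBit k = decide (k % 8 = i) := by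
  decide +kernel

/-- Bit of the matrix number `h` in the row `p` and the column `q`. -/
def bit (w h p q : ℕ) : Bool := w.testBit (64 * h + 8 * p + q)

theorem xor_help (a b : Bool) : (a ^^ (b ^^ a)) = b := by cases a <;> cases b <;> rfl

theorem bit_rows {i d x h p q : ℕ} (hd : 0 < d) (hi : i + d < 8) (hh : h < 2) (hp : p < 8)
    (hq : q < 8) :
    bit (dsw (Nat.mul 8 d) (Nat.shiftLeft 4703919738795935662335 (Nat.mul 8 i)) x) h p q =
      bit x h (Equiv.swap i (i + d) p) q := by
  unfold bit
  rw [testBit_dsw, rowmask_bit i (by omega) _ (by omega), rowmask_bit i (by omega) _ (by omega)]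
  have e8 : Nat.mul 8 d = 8 * d := rfl
  rw [e8]
  by_cases h1 : p = i
  · subst h1
    rw [Equiv.swap_apply_left]
    have a1 : (64 * h + 8 * p + q) / 8 % 8 = p := by omega
    have a2 : 8 * d ≤ 64 * h + 8 * p + q → ¬ (64 * h + 8 * p + q - 8 * d) / 8 % 8 = p := by omega
    have a3 : 64 * h + 8 * p + q + 8 * d = 64 * h + 8 * (p + d) + q := by ring
    rw [a3]
    by_cases hs : 8 * d ≤ 64 * h + 8 * p + q
    · simp [a1, a2 hs, xor_help]
    · simp [a1, hs, xor_help]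
  · by_cases h2 : p = i + d
    · subst h2
      rw [Equiv.swap_apply_right]
      have a1 : ¬ (64 * h + 8 * (i + d) + q) / 8 % 8 = i := by omega
      have a2 : 8 * d ≤ 64 * h + 8 * (i + d) + q := by omega
      have a3 : (64 * h + 8 * (i + d) + q - 8 * d) = 64 * h + 8 * i + q := by omega
      have a4 : (64 * h + 8 * i + q) / 8 % 8 = i := by omega
      have a5 : 64 * h + 8 * i + q + 8 * d = 64 * h + 8 * (i + d) + q := by ring
      rw [a3, a5]
      simp [a1, a2, a4]
    · rw [Equiv.swap_apply_of_ne_of_ne h1 h2]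
      have a1 : ¬ (64 * h + 8 * p + q) / 8 % 8 = i := by omega
      have a2 : 8 * d ≤ 64 * h + 8 * p + q → ¬ (64 * h + 8 * p + q - 8 * d) / 8 % 8 = i := by omega
      by_cases hs : 8 * d ≤ 64 * h + 8 * p + q
      · simp [a1, a2 hs]
      · simp [a1, hs]

theorem bit_cols {i d x h p q : ℕ} (hd : 0 < d) (hi : i + d < 8) (hh : h < 2) (hp : p < 8)
    (hq : q < 8) :
    bit (dsw d (Nat.shiftLeft 1334440654591915542993625911497130241 i) x) h p q =
      bit x h p (Equiv.swap i (i + d) q) := by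
  unfold bit
  rw [testBit_dsw, colmask_bit i (by omega) _ (by omega), colmask_bit i (by omega) _ (by omega)]
  by_cases h1 : q = i
  · subst h1
    rw [Equiv.swap_apply_left]
    have a1 : (64 * h + 8 * p + q) % 8 = q := by omega
    have a2 : d ≤ 64 * h + 8 * p + q → ¬ (64 * h + 8 * p + q - d) % 8 = q := by omega
    have a3 : 64 * h + 8 * p + q + d = 64 * h + 8 * p + (q + d) := by ring
    rw [a3]
    by_cases hs : d ≤ 64 * h + 8 * p + q
    · simp [a1, a2 hs, xor_help]
    · simp [a1, hs, xor_help]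
  · by_cases h2 : q = i + d
    · subst h2
      rw [Equiv.swap_apply_right]
      have a1 : ¬ (64 * h + 8 * p + (i + d)) % 8 = i := by omega
      have a2 : d ≤ 64 * h + 8 * p + (i + d) := by omega
      have a3 : (64 * h + 8 * p + (i + d) - d) = 64 * h + 8 * p + i := by omega
      have a4 : (64 * h + 8 * p + i) % 8 = i := by omega
      have a5 : 64 * h + 8 * p + i + d = 64 * h + 8 * p + (i + d) := by ring
      rw [a3, a5]
      simp [a1, a2, a4]
    · rw [Equiv.swap_apply_of_ne_of_ne h1 h2]
      have a1 : ¬ (64 * h + 8 * p + q) % 8 = i := by omega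
      have a2 : d ≤ 64 * h + 8 * p + q → ¬ (64 * h + 8 * p + q - d) % 8 = i := by omega
      by_cases hs : d ≤ 64 * h + 8 * p + q
      · simp [a1, a2 hs]
      · simp [a1, hs]

theorem swap_lt {i d p N : ℕ} (hi : i + d < N) (hp : p < N) : Equiv.swap i (i + d) p < N := by
  rw [Equiv.swap_apply_def]; split_ifs <;> omega

theorem bit_sw {i d x h p q : ℕ} (hd : 0 < d) (hi : i + d < 8) (hh : h < 2) (hp : p < 8)
    (hq : q < 8) :
    bit (sw i d x) h p q = bit x h (Equiv.swap i (i + d) p) (Equiv.swap i (i + d) q) := by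
  unfold sw
  rw [bit_cols hd hi hh hp hq, bit_rows hd hi hh hp (swap_lt hi hq)]

/-- Both matrices of the pair are symmetric. -/
def Symm (w : ℕ) : Prop := ∀ h < 2, ∀ p < 8, ∀ q < 8, bit w h p q = bit w h q p

variable {V : Type}

/-- The set of edges coded by the matrix number `h` of `w`, with vertices labelled by `φ`. -/
def eset (N : ℕ) (φ : ℕ → V) (w h : ℕ) : Set (Sym2 V) :=
  {e | ∃ p q, p < N ∧ q < N ∧ bit w h p q = true ∧ e = s(φ p, φ q)}

/-- A class of labellings closed under the exchanges the checker uses. -/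
structure LabOK (N : ℕ) (Lab : (ℕ → V) → Prop) : Prop where
  inj : ∀ φ, Lab φ → ∀ p < N, ∀ q < N, φ p = φ q → p = q
  swap : ∀ φ, Lab φ → ∀ i d, 0 < d → (i = 0 ∧ d = 1 ∨ 2 ≤ i) → i + d < N →
    Lab (fun x => φ (Equiv.swap i (i + d) x))

/-- The rule by which a position is deduced from smaller ones. -/
def NodeRule (H : Set (Sym2 V) → Set (Sym2 V) → Prop) : Prop :=
  ∀ (O Z : Set (Sym2 V)) (bs : Set (Sym2 V × Set (Sym2 V) × Set (Sym2 V))), bs.Nonempty →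
    (∀ b ∈ bs, H b.2.1 b.2.2 ∧ ¬ b.1.IsDiag ∧ b.2.1 ⊆ insert b.1 O ∧ insert b.1 b.2.2 ⊆ Z ∪ O) →
    (∀ f, f ∉ O → ∃ b ∈ bs, f ∉ insert b.1 b.2.2) → H O Z

/-- Validity of a table entry. -/
def Valid (N : ℕ) (Lab : (ℕ → V) → Prop) (H : Set (Sym2 V) → Set (Sym2 V) → Prop) (w : ℕ) : Prop :=
  Symm w ∧ ∀ φ, Lab φ → H (eset N φ w 0) (eset N φ w 1)

theorem eset_sw {N i d w h : ℕ} (φ : ℕ → V) (hN : N ≤ 8) (hd : 0 < d) (hi : i + d < N)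
    (hh : h < 2) :
    eset N φ (sw i d w) h = eset N (fun x => φ (Equiv.swap i (i + d) x)) w h := by
  ext e
  constructor
  · rintro ⟨p, q, hp, hq, hb, rfl⟩
    rw [bit_sw hd (by omega) hh (by omega) (by omega)] at hb
    exact ⟨_, _, swap_lt hi hp, swap_lt hi hq, hb, by simp⟩
  · rintro ⟨p, q, hp, hq, hb, rfl⟩
    refine ⟨_, _, swap_lt hi hp, swap_lt hi hq, ?_, rfl⟩
    have := swap_lt hi hp
    have := swap_lt hi hq
    rw [bit_sw hd (by omega) hh (by omega) (by omega)]
    simpa using hb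

section
variable {N : ℕ} {Lab : (ℕ → V) → Prop} {H : Set (Sym2 V) → Set (Sym2 V) → Prop}

theorem valid_sw (hN : N ≤ 8) (hL : LabOK N Lab) {i d w : ℕ} (hd : 0 < d)
    (hc : i = 0 ∧ d = 1 ∨ 2 ≤ i) (hi : i + d < N) (hw : Valid N Lab H w) :
    Valid N Lab H (sw i d w) := by
  refine ⟨?_, ?_⟩
  · intro h hh p hp q hq
    rw [bit_sw hd (by omega) hh hp hq, bit_sw hd (by omega) hh hq hp]
    exact hw.1 h hh _ (swap_lt (by omega) hp) _ (swap_lt (by omega) hq)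
  · intro φ hφ
    rw [eset_sw φ hN hd hi (by omega), eset_sw φ hN hd hi (by omega)]
    exact hw.2 _ (hL.swap φ hφ i d hd hc hi)

theorem swC_cases {β : Type} (R : β → Prop) (hN : N ≤ 8) (hL : LabOK N Lab) {i d x : ℕ} {z : β}
    {f : ℕ → β} (hc : 0 < d → (i = 0 ∧ d = 1 ∨ 2 ≤ i) ∧ i + d < N) (hx : Valid N Lab H x)
    (hz : R z) (hf : ∀ y, Valid N Lab H y → R (f y)) : R (swC i d x z f) := by
  cases d with
  | zero => exact hf x hx
  | succ k =>
    exact force_cases R hz (hf _ (valid_sw hN hL (by omega) (hc (by omega)).1 (hc (by omega)).2 hx))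

theorem permL_cases {β : Type} (R : β → Prop) (hN : N ≤ 8) (hL : LabOK N Lab) {z : β}
    {f : ℕ → β} (hz : R z) (hf : ∀ y, Valid N Lab H y → R (f y)) :
    ∀ fuel i r x, 2 ≤ i → i + fuel < N → Valid N Lab H x → R (permL N z f fuel i r x) := by
  intro fuel
  induction fuel with
  | zero => intro i r x _ _ hx; exact hf x hx
  | succ k ih =>
    intro i r x hi hiN hx
    refine swC_cases R hN hL ?_ hx hz ?_
    · intro h0
      refine ⟨Or.inr hi, ?_⟩
      change 0 < r % (N - i) at h0
      change i + r % (N - i) < N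
      have := Nat.mod_lt r (show N - i > 0 by omega)
      omega
    · intro y hy
      exact ih _ _ y (Nat.le_succ_of_le hi) (by omega) hy

theorem permC_cases {β : Type} (R : β → Prop) (hN : N ≤ 8) (hN4 : 4 ≤ N) (hL : LabOK N Lab) {z : β}
    {f : ℕ → β} (hz : R z) (hf : ∀ y, Valid N Lab H y → R (f y)) (idx x : ℕ)
    (hx : Valid N Lab H x) : R (permC N idx x z f) := by
  refine swC_cases R hN hL ?_ hx hz ?_
  · intro h0
    change 0 < idx % 2 at h0
    change (0 = 0 ∧ idx % 2 = 1 ∨ _) ∧ 0 + idx % 2 < N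
    omega
  · intro y hy
    exact permL_cases R hN hL hz hf _ _ _ y le_rfl (by change 2 + (N - 3) < N; omega) hy

theorem ebit_bit : ∀ m < 64, ∀ h < 2, ∀ p < 8, ∀ q < 8, bit (ebit m) h p q =
    decide (h = 0 ∧ (p = m / 8 ∧ q = m % 8 ∨ p = m % 8 ∧ q = m / 8)) := by
  decide +kernel

theorem ebit_bit2 : ∀ m < 64, m / 8 < m % 8 → ∀ h < 2, ∀ p < 8, ∀ q < 8,
    bit (Nat.mul (ebit m) 18446744073709551617) h p q =
    decide (p = m / 8 ∧ q = m % 8 ∨ p = m % 8 ∧ q = m / 8) := by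
  decide +kernel

theorem bit_lor (a b h p q : ℕ) : bit (Nat.lor a b) h p q = (bit a h p q || bit b h p q) := by
  unfold bit; exact Nat.testBit_or ..

theorem bit_land (a b h p q : ℕ) : bit (Nat.land a b) h p q = (bit a h p q && bit b h p q) := by
  unfold bit; exact Nat.testBit_and ..

theorem bit_xor (a b h p q : ℕ) : bit (Nat.xor a b) h p q = (bit a h p q ^^ bit b h p q) := by
  unfold bit; exact Nat.testBit_xor ..

theorem okE_iff {m : ℕ} (h : okE N m = true) : m / 8 < m % 8 ∧ m % 8 < N := by
  unfold okE at h
  change Bool.rec false (Nat.ble (m % 8 + 1) N) (Nat.ble (m / 8 + 1) (m % 8)) = true at h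
  cases h1 : Nat.ble (m / 8 + 1) (m % 8) with
  | false => rw [h1] at h; simp at h
  | true =>
    rw [h1] at h
    exact ⟨Nat.le_of_ble_eq_true h1, Nat.le_of_ble_eq_true h⟩

/-- Bits of the output of the final step. -/
theorem fin_cases' (w0 acc I : ℕ) : fin w0 acc I = w0 ∨
    ((∀ p < 8, ∀ q < 8, bit (fin w0 acc I) 0 p q = bit acc 0 p q) ∧
     (∀ p < 8, ∀ q < 8, bit (fin w0 acc I) 1 p q = (bit acc 1 p q && !bit acc 0 p q)) ∧
     (∀ p < 8, ∀ q < 8, bit I 1 p q = true → bit acc 0 p q = true)) := by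
  unfold fin
  cases hb : Nat.beq (Nat.land (Nat.shiftRight I 64) (Nat.mod acc 18446744073709551616))
    (Nat.shiftRight I 64) with
  | false => left; simp only [hb]
  | true =>
    right
    simp only [hb]
    have hmod : ∀ k, (Nat.mod acc 18446744073709551616).testBit k = (decide (k < 64) && acc.testBit k) := by
      intro k
      have : Nat.mod acc 18446744073709551616 = acc % 2 ^ 64 := rfl
      rw [this, Nat.testBit_mod_two_pow]
    have hsh : ∀ k, (Nat.shiftLeft (Nat.mod acc 18446744073709551616) 64).testBit k =
        (decide (64 ≤ k) && (decide (k - 64 < 64) && acc.testBit (k - 64))) := by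
      intro k
      rw [← hmod]
      exact Nat.testBit_shiftLeft _
    refine ⟨?_, ?_, ?_⟩
    · intro p hp q hq
      rw [bit_xor, bit_lor]
      unfold bit
      rw [hsh]
      have : ¬ (64 ≤ 64 * 0 + 8 * p + q) := by omega
      rw [decide_eq_false this]
      simp
    · intro p hp q hq
      rw [bit_xor, bit_lor]
      unfold bit
      rw [hsh]
      have h1 : (64 ≤ 64 * 1 + 8 * p + q) := by omega
      have h2 : 64 * 1 + 8 * p + q - 64 = 64 * 0 + 8 * p + q := by omega
      have h3 : 64 * 0 + 8 * p + q < 64 := by omega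
      rw [h2]
      simp only [h1, h3, decide_true, Bool.true_and]
      cases acc.testBit (64 * 0 + 8 * p + q) <;> cases acc.testBit (64 * 1 + 8 * p + q) <;> rfl
    · intro p hp q hq hI
      have hb' := Nat.eq_of_beq_eq_true hb
      have h2 : (Nat.shiftRight I 64).testBit (64 * 0 + 8 * p + q) = true := by
        have : (I >>> 64).testBit (64 * 0 + 8 * p + q) = true := by
          rw [Nat.testBit_shiftRight]
          unfold bit at hI
          convert hI using 2
          ring
        exact this
      rw [← hb'] at h2
      have h3 := (Nat.testBit_and _ _ _).symm.trans h2
      rw [hmod] at h3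
      unfold bit
      simp at h3 ⊢
      exact h3.2.2

theorem eset_form {w h : ℕ} {φ : ℕ → V} (hN : N ≤ 8) (hs : Symm w) (hh : h < 2)
    (hinj : ∀ p < N, ∀ q < N, φ p = φ q → p = q) {p q : ℕ} (hp : p < N) (hq : q < N) :
    s(φ p, φ q) ∈ eset N φ w h ↔ bit w h p q = true := by
  constructor
  · rintro ⟨p', q', hp', hq', hb, he⟩
    rcases Sym2.eq_iff.1 he with ⟨h1, h2⟩ | ⟨h1, h2⟩
    · rw [hinj _ hp _ hp' h1, hinj _ hq _ hq' h2]; exact hb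
    · rw [hinj _ hp _ hq' h1, hinj _ hq _ hp' h2, hs h hh _ (by omega) _ (by omega)]; exact hb
  · intro hb
    exact ⟨p, q, hp, hq, hb, rfl⟩

/-- The invariant of the loop over the branches. -/
def Inv {V : Type} (N : ℕ) (Lab : (ℕ → V) → Prop) (H : Set (Sym2 V) → Set (Sym2 V) → Prop)
    (w0 acc I : ℕ) : Prop :=
  Symm acc ∧ Symm I ∧ ∀ φ, Lab φ → ∃ bs : Set (Sym2 V × Set (Sym2 V) × Set (Sym2 V)),
    (∀ b ∈ bs, H b.2.1 b.2.2 ∧ ¬ b.1.IsDiag ∧ b.2.1 ⊆ insert b.1 (eset N φ acc 0) ∧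
      insert b.1 b.2.2 ⊆ eset N φ acc 1) ∧
    (∀ p < N, ∀ q < N, (∀ b ∈ bs, s(φ p, φ q) ∈ insert b.1 b.2.2) → bit I 1 p q = true) ∧
    (bs = ∅ → fin w0 acc I = w0)

theorem valid_fin (hN : N ≤ 8) (hH : NodeRule H) {w0 acc I : ℕ}
    (h0 : Valid N Lab H w0) (hI : Inv N Lab H w0 acc I) : Valid N Lab H (fin w0 acc I) := by
  by_cases hw : fin w0 acc I = w0
  · rw [hw]; exact h0
  rcases fin_cases' w0 acc I with h | ⟨b0, b1, bI⟩
  · exact absurd h hw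
  obtain ⟨sacc, sI, hb⟩ := hI
  refine ⟨?_, ?_⟩
  · intro h hh p hp q hq
    interval_cases h
    · rw [b0 p hp q hq, b0 q hq p hp]; exact sacc 0 (by omega) p hp q hq
    · rw [b1 p hp q hq, b1 q hq p hp, sacc 0 (by omega) p hp q hq, sacc 1 (by omega) p hp q hq]
  · intro φ hφ
    obtain ⟨bs, h1, h2, h3⟩ := hb φ hφ
    have e0 : eset N φ (fin w0 acc I) 0 = eset N φ acc 0 := by
      ext e
      constructor
      · rintro ⟨p, q, hp, hq, hb, he⟩
        rw [b0 p (by omega) q (by omega)] at hb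
        exact ⟨p, q, hp, hq, hb, he⟩
      · rintro ⟨p, q, hp, hq, hb, he⟩
        rw [← b0 p (by omega) q (by omega)] at hb
        exact ⟨p, q, hp, hq, hb, he⟩
    have e1 : eset N φ acc 1 ⊆ eset N φ (fin w0 acc I) 1 ∪ eset N φ (fin w0 acc I) 0 := by
      rw [e0]
      rintro e ⟨p, q, hp, hq, hb, he⟩
      cases hc : bit acc 0 p q with
      | true => exact Or.inr ⟨p, q, hp, hq, hc, he⟩
      | false =>
        refine Or.inl ⟨p, q, hp, hq, ?_, he⟩
        rw [b1 p (by omega) q (by omega), hb, hc]; rfl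
    have hne : bs.Nonempty := by
      rw [Set.nonempty_iff_ne_empty]
      exact fun h => hw (h3 h)
    refine hH _ _ bs hne ?_ ?_
    · intro b hb
      obtain ⟨g1, g2, g3, g4⟩ := h1 b hb
      exact ⟨g1, g2, by rw [e0]; exact g3, g4.trans e1⟩
    · intro f hf
      by_contra hcon
      push Not at hcon
      obtain ⟨b, hb⟩ := hne
      obtain ⟨p, q, hp, hq, -, rfl⟩ := (h1 b hb).2.2.2 (hcon b hb)
      apply hf
      rw [e0]
      exact ⟨p, q, hp, hq, bI p (by omega) q (by omega) (h2 p hp q hq hcon), rfl⟩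

theorem inv_step (hN : N ≤ 8) (hL : LabOK N Lab) {w0 acc I m v : ℕ} (hm : m < 64)
    (hok : m / 8 < m % 8 ∧ m % 8 < N) (hI : Inv N Lab H w0 acc I) (hv : Valid N Lab H v) :
    Inv N Lab H w0
      (Nat.lor acc (Nat.xor (Nat.lor v (Nat.mul (ebit m) 18446744073709551617)) (ebit m)))
      (Nat.land I (Nat.lor v (Nat.mul (ebit m) 18446744073709551617))) := by
  obtain ⟨sacc, sI, hb⟩ := hI
  have E1 := ebit_bit m hm
  have E2 := ebit_bit2 m hm hok.1
  obtain ⟨hm1, hm2⟩ := hok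
  have A0 : ∀ p < 8, ∀ q < 8, bit (Nat.lor acc (Nat.xor (Nat.lor v
      (Nat.mul (ebit m) 18446744073709551617)) (ebit m))) 0 p q =
      (bit acc 0 p q || (bit v 0 p q &&
        !decide (p = m / 8 ∧ q = m % 8 ∨ p = m % 8 ∧ q = m / 8))) := by
    intro p hp q hq
    rw [bit_lor, bit_xor, bit_lor, E1 0 (by omega) p hp q hq, E2 0 (by omega) p hp q hq]
    simp only [true_and]
    cases bit acc 0 p q <;> cases bit v 0 p q <;>
      cases decide (p = m / 8 ∧ q = m % 8 ∨ p = m % 8 ∧ q = m / 8) <;> rfl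
  have A1 : ∀ p < 8, ∀ q < 8, bit (Nat.lor acc (Nat.xor (Nat.lor v
      (Nat.mul (ebit m) 18446744073709551617)) (ebit m))) 1 p q =
      (bit acc 1 p q || (bit v 1 p q ||
        decide (p = m / 8 ∧ q = m % 8 ∨ p = m % 8 ∧ q = m / 8))) := by
    intro p hp q hq
    rw [bit_lor, bit_xor, bit_lor, E1 1 (by omega) p hp q hq, E2 1 (by omega) p hp q hq]
    simp
  have A2 : ∀ h < 2, ∀ p < 8, ∀ q < 8, bit (Nat.land I (Nat.lor v
      (Nat.mul (ebit m) 18446744073709551617))) h p q =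
      (bit I h p q && (bit v h p q ||
        decide (p = m / 8 ∧ q = m % 8 ∨ p = m % 8 ∧ q = m / 8))) := by
    intro h hh p hp q hq
    rw [bit_land, bit_lor, E2 h hh p hp q hq]
  have D : ∀ p q : ℕ, decide (p = m / 8 ∧ q = m % 8 ∨ p = m % 8 ∧ q = m / 8) =
      decide (q = m / 8 ∧ p = m % 8 ∨ q = m % 8 ∧ p = m / 8) := by
    intro p q
    rw [decide_eq_decide]
    tauto
  refine ⟨?_, ?_, ?_⟩
  · intro h hh p hp q hq
    interval_cases h
    · rw [A0 p hp q hq, A0 q hq p hp, D p q, sacc 0 (by omega) p hp q hq,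
        hv.1 0 (by omega) p hp q hq]
    · rw [A1 p hp q hq, A1 q hq p hp, D p q, sacc 1 (by omega) p hp q hq,
        hv.1 1 (by omega) p hp q hq]
  · intro h hh p hp q hq
    rw [A2 h hh p hp q hq, A2 h hh q hq p hp, D p q, sI h hh p hp q hq, hv.1 h hh p hp q hq]
  · intro φ hφ
    obtain ⟨bs, h1, h2, h3⟩ := hb φ hφ
    have hinj := hL.inj φ hφ
    have M0 : eset N φ acc 0 ⊆ eset N φ (Nat.lor acc (Nat.xor (Nat.lor v
      (Nat.mul (ebit m) 18446744073709551617)) (ebit m))) 0 := by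
      rintro e ⟨p, q, hp, hq, hb, he⟩
      refine ⟨p, q, hp, hq, ?_, he⟩
      rw [A0 p (by omega) q (by omega), hb, Bool.true_or]
    have M1 : eset N φ acc 1 ⊆ eset N φ (Nat.lor acc (Nat.xor (Nat.lor v
      (Nat.mul (ebit m) 18446744073709551617)) (ebit m))) 1 := by
      rintro e ⟨p, q, hp, hq, hb, he⟩
      refine ⟨p, q, hp, hq, ?_, he⟩
      rw [A1 p (by omega) q (by omega), hb, Bool.true_or]
    refine ⟨insert (s(φ (m / 8), φ (m % 8)), eset N φ v 0, eset N φ v 1) bs, ?_, ?_, ?_⟩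
    · intro b hb
      rcases hb with rfl | hb
      · refine ⟨hv.2 φ hφ, ?_, ?_, ?_⟩
        · intro hd
          have := hinj _ (by omega) _ hm2 (Sym2.mk_isDiag_iff.1 hd)
          omega
        · rintro e ⟨p, q, hp, hq, hb, rfl⟩
          by_cases hc : p = m / 8 ∧ q = m % 8 ∨ p = m % 8 ∧ q = m / 8
          · left
            rcases hc with ⟨rfl, rfl⟩ | ⟨rfl, rfl⟩
            · rfl
            · exact Sym2.eq_swap
          · right
            refine ⟨p, q, hp, hq, ?_, rfl⟩
            rw [A0 p (by omega) q (by omega), hb]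
            simp [hc]
        · rintro e (rfl | ⟨p, q, hp, hq, hb, rfl⟩)
          · refine ⟨m / 8, m % 8, by omega, hm2, ?_, rfl⟩
            rw [A1 _ (by omega) _ (by omega)]
            simp
          · refine ⟨p, q, hp, hq, ?_, rfl⟩
            rw [A1 _ (by omega) _ (by omega), hb]
            simp
      · obtain ⟨g1, g2, g3, g4⟩ := h1 b hb
        exact ⟨g1, g2, g3.trans (Set.insert_subset_insert M0), g4.trans M1⟩
    · intro p hp q hq hall
      rw [A2 1 (by omega) p (by omega) q (by omega),
        h2 p hp q hq (fun b hb => hall b (Set.mem_insert_of_mem _ hb)), Bool.true_and]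
      have := hall _ (Set.mem_insert _ _)
      rcases this with he | he
      · have : p = m / 8 ∧ q = m % 8 ∨ p = m % 8 ∧ q = m / 8 := by
          rcases Sym2.eq_iff.1 he with ⟨e1, e2⟩ | ⟨e1, e2⟩
          · exact Or.inl ⟨hinj _ hp _ (by omega) e1, hinj _ hq _ (by omega) e2⟩
          · exact Or.inr ⟨hinj _ hp _ (by omega) e1, hinj _ hq _ (by omega) e2⟩
        rw [decide_eq_true this, Bool.or_true]
      · rw [(eset_form hN hv.1 (by omega) hinj hp hq).1 he, Bool.true_or]
    · intro h
      exact absurd h (Set.insert_nonempty _ _).ne_empty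

theorem node_succ (N w0 : ℕ) (tbl : List (List ℕ)) (k code acc I : ℕ) :
    node N w0 tbl (k + 1) code acc I = force code (fin w0 acc I) (fun code =>
      Bool.rec w0
        (permC N (Nat.mod (Nat.div code 64) 2048)
          (lget w0 (lget [] tbl (Nat.mod (Nat.div code 131072) 64))
            (Nat.mod (Nat.div code 8388608) 64)) w0
          (fun v => force (ebit (Nat.mod code 64)) w0 (fun b =>
            force (Nat.lor v (Nat.mul b 18446744073709551617)) w0 (fun v =>
              force (Nat.lor acc (Nat.xor v b)) w0 (fun acc =>
                force (Nat.succ (Nat.land I v)) w0 (fun I =>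
                  node N w0 tbl k (Nat.div code 536870912) acc (Nat.pred I)))))))
        (okE N (Nat.mod code 64))) := rfl

theorem chunk_cons (N w0 : ℕ) (closed : List (List ℕ)) (c : ℕ) (t cur : List ℕ) :
    chunk N w0 closed (c :: t) cur =
      force (node N w0 (cur :: closed) 30 c 0 340282366920938463463374607431768211455)
      cur (fun w => chunk N w0 closed t (w :: cur)) := rfl

theorem valid_node (hN : N ≤ 8) (hN4 : 4 ≤ N) (hL : LabOK N Lab) (hH : NodeRule H) {w0 : ℕ}
    (h0 : Valid N Lab H w0) {tbl : List (List ℕ)}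
    (htbl : ∀ l ∈ tbl, ∀ w ∈ l, Valid N Lab H w) :
    ∀ fuel code acc I, Inv N Lab H w0 acc I → Valid N Lab H (node N w0 tbl fuel code acc I) := by
  intro fuel
  induction fuel with
  | zero => intro code acc I _; exact h0
  | succ k ih =>
    intro code acc I hI
    rw [node_succ]
    refine force_cases (Valid N Lab H) (valid_fin hN hH h0 hI) ?_
    cases hok : okE N (Nat.mod code 64) with
    | false => exact h0
    | true =>
      have hok' := okE_iff hok
      have hm : Nat.mod code 64 < 64 := Nat.mod_lt _ (by norm_num)
      refine permC_cases (H := H) (Valid N Lab H) hN hN4 hL h0 ?_ _ _ ?_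
      · intro v hv
        have hst := inv_step hN hL hm hok' hI hv
        refine force_cases _ h0 ?_
        refine force_cases _ h0 ?_
        refine force_cases _ h0 ?_
        refine force_cases _ h0 ?_
        exact ih _ _ _ hst
      · refine lget_cases (Valid N Lab H) h0 _ ?_ _
        refine lget_cases (fun l => ∀ w ∈ l, Valid N Lab H w) (by simp) _ htbl _

theorem inv_start (hN : N ≤ 8) (w0 : ℕ) : Inv N Lab H w0 0 340282366920938463463374607431768211455 := by
  have hall : ∀ h < 2, ∀ p < 8, ∀ q < 8,
      bit 340282366920938463463374607431768211455 h p q = true := by decide +kernel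
  refine ⟨?_, ?_, ?_⟩
  · intro h hh p hp q hq
    simp [bit]
  · intro h hh p hp q hq
    rw [hall h hh p hp q hq, hall h hh q hq p hp]
  · intro φ _
    refine ⟨∅, by simp, ?_, ?_⟩
    · intro p hp q hq _
      exact hall 1 (by omega) p (by omega) q (by omega)
    · intro _
      have hb : Nat.beq (Nat.land (Nat.shiftRight 340282366920938463463374607431768211455 64)
        (Nat.mod 0 18446744073709551616)) (Nat.shiftRight 340282366920938463463374607431768211455 64)
        = false := by decide +kernel
      unfold fin
      simp only [hb]

theorem valid_chunk (hN : N ≤ 8) (hN4 : 4 ≤ N) (hL : LabOK N Lab) (hH : NodeRule H) {w0 : ℕ}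
    (h0 : Valid N Lab H w0) {closed : List (List ℕ)}
    (hcl : ∀ l ∈ closed, ∀ w ∈ l, Valid N Lab H w) :
    ∀ codes cur, (∀ w ∈ cur, Valid N Lab H w) →
      ∀ w ∈ chunk N w0 closed codes cur, Valid N Lab H w := by
  intro codes
  induction codes with
  | nil => intro cur h; exact h
  | cons c t ih =>
    intro cur h
    rw [chunk_cons]
    refine force_cases (fun l => ∀ w ∈ l, Valid N Lab H w) h ?_
    refine ih _ ?_
    intro w hw
    rcases List.mem_cons.1 hw with rfl | hw
    · refine valid_node hN hN4 hL hH h0 ?_ _ _ _ _ (inv_start hN w0)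
      intro l hl
      rcases List.mem_cons.1 hl with rfl | hl
      · exact h
      · exact hcl l hl
    · exact h w hw

theorem valid_run (hN : N ≤ 8) (hN4 : 4 ≤ N) (hL : LabOK N Lab) (hH : NodeRule H) {w0 : ℕ}
    (h0 : Valid N Lab H w0) :
    ∀ chunks closed, (∀ l ∈ closed, ∀ w ∈ l, Valid N Lab H w) →
      ∀ l ∈ run N w0 chunks closed, ∀ w ∈ l, Valid N Lab H w := by
  intro chunks
  induction chunks with
  | nil => intro closed h; exact h
  | cons c t ih =>
    intro closed h
    refine ih _ ?_
    intro l hl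
    rcases List.mem_cons.1 hl with rfl | hl
    · exact valid_chunk hN hN4 hL hH h0 h c [] (by simp)
    · exact h l hl

theorem valid_result (hN : N ≤ 8) (hN4 : 4 ≤ N) (hL : LabOK N Lab) (hH : NodeRule H) {w0 : ℕ}
    (h0 : Valid N Lab H w0) {leaves : List ℕ} (hl : ∀ w ∈ leaves, Valid N Lab H w)
    (chunks : List (List ℕ)) : Valid N Lab H (result N w0 leaves chunks) := by
  unfold result
  refine lget_cases _ h0 _ ?_ _
  refine lget_cases (fun l => ∀ w ∈ l, Valid N Lab H w) (by simp) _ ?_ _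
  exact valid_run hN hN4 hL hH h0 chunks _ (by simpa using hl)
end

end FHP

/-! ### General facts on Maker-Breaker games -/

namespace FHP

section
variable {α : Type} [DecidableEq α] {X : Finset α} {F : Set (Finset α)}

theorem mono_aux {t : Bool} {M B : Finset α} (h : MakerWins X F t M B) :
    ∀ M' B', M ⊆ M' → B' ⊆ B → MakerWins X F t M' B' ∧ MakerWins X F true M' B' := by
  induction h with
  | claim A hA hAM =>
    intro M' B' hM _
    exact ⟨.claim A hA (hAM.trans hM), .claim A hA (hAM.trans hM)⟩
  | @makerMove M B e he heM heB _ ih =>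
    intro M' B' hM hB
    suffices h : MakerWins X F true M' B' from ⟨h, h⟩
    by_cases hc : e ∈ M'
    · exact (ih M' B' (Finset.insert_subset hc hM) hB).2
    · exact .makerMove e he hc (fun h => heB (hB h))
        (ih _ B' (Finset.insert_subset_insert e hM) hB).1
  | @breakerMove M B e he heM heB _ ih =>
    intro M' B' hM hB
    have h2 : MakerWins X F true M' B' :=
      (ih e he heM heB M' B' hM (hB.trans (Finset.subset_insert e B))).1
    refine ⟨?_, h2⟩
    by_cases hfree : ∃ g ∈ X, g ∉ M' ∧ g ∉ B'
    · obtain ⟨g, hg, hgM, hgB⟩ := hfree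
      refine .breakerMove g hg hgM hgB ?_
      intro f hf hfM hfB
      by_cases hc : f ∈ B
      · exact (ih e he heM heB M' _ hM
          (Finset.insert_subset (Finset.mem_insert_of_mem hc)
            (hB.trans (Finset.subset_insert e B)))).1
      · exact (ih f hf (fun h => hfM (hM h)) hc M' _ hM (Finset.insert_subset_insert f hB)).1
    · cases h2 with
      | claim A hA hAM => exact .claim A hA hAM
      | makerMove g hg hgM hgB _ => exact absurd ⟨g, hg, hgM, hgB⟩ hfree

theorem mono {t : Bool} {M B M' B' : Finset α} (h : MakerWins X F t M B) (hM : M ⊆ M')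
    (hB : B' ⊆ B) : MakerWins X F t M' B' := (mono_aux h M' B' hM hB).1

theorem tempo {M B : Finset α} (h : MakerWins X F false M B) : MakerWins X F true M B :=
  (mono_aux h M B subset_rfl subset_rfl).2

theorem breaker_step {M B : Finset α} (hX : X.Nonempty)
    (h : ∀ f ∈ X, MakerWins X F true M (insert f B)) : MakerWins X F false M B := by
  by_cases hfree : ∃ g ∈ X, g ∉ M ∧ g ∉ B
  · obtain ⟨g, hg, hgM, hgB⟩ := hfree
    exact .breakerMove g hg hgM hgB (fun f hf _ _ => h f hf)
  · obtain ⟨f, hf⟩ := hX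
    cases h f hf with
    | claim A hA hAM => exact .claim A hA hAM
    | makerMove g hg hgM hgB _ =>
      exact absurd ⟨g, hg, hgM, fun h => hgB (Finset.mem_insert_of_mem h)⟩ hfree

theorem maker_step {M B : Finset α} {e : α} (he : e ∈ X) (hc : e ∉ B ∨ e ∈ M)
    (h : MakerWins X F false (insert e M) B) : MakerWins X F true M B := by
  by_cases heM : e ∈ M
  · rw [Finset.insert_eq_of_mem heM] at h
    exact tempo h
  · exact .makerMove e he heM (hc.resolve_right heM) h

theorem not_wins {t : Bool} {M B : Finset α} (h : MakerWins X F t M B) (hd : Disjoint M B)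
    (hF : ∀ A ∈ F, ∃ e ∈ A, e ∈ B) : False := by
  induction h with
  | claim A hA hAM =>
    obtain ⟨e, heA, heB⟩ := hF A hA
    exact Finset.disjoint_left.1 hd (hAM heA) heB
  | makerMove e he heM heB _ ih =>
    exact ih (Finset.disjoint_insert_left.2 ⟨heB, hd⟩) hF
  | breakerMove e he heM heB _ ih =>
    refine ih e he heM heB (Finset.disjoint_insert_right.2 ⟨heM, hd⟩) ?_
    intro A hA
    obtain ⟨f, hfA, hfB⟩ := hF A hA
    exact ⟨f, hfA, Finset.mem_insert_of_mem hfB⟩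
end

section
variable {V : Type} [DecidableEq V] {X : Finset (Sym2 V)} {F : Set (Finset (Sym2 V))}

/-- Positions Maker wins when Breaker is to move. -/
def HM (X : Finset (Sym2 V)) (F : Set (Finset (Sym2 V))) (M0 : Finset (Sym2 V))
    (O Z : Set (Sym2 V)) : Prop :=
  ∀ M B : Finset (Sym2 V), M0 ⊆ M → O ⊆ (M : Set (Sym2 V)) → (∀ e ∈ Z, e ∈ B → e ∈ M) →
    MakerWins X F false M B

/-- Positions Breaker wins when Maker is to move. -/
def HB (X : Finset (Sym2 V)) (F : Set (Finset (Sym2 V))) (O Z : Set (Sym2 V)) : Prop :=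
  ∀ M B : Finset (Sym2 V), O ⊆ (B : Set (Sym2 V)) → (∀ e ∈ Z, e ∈ M → e ∈ B) → Disjoint M B →
    ¬ MakerWins X F true M B

theorem ruleM (hX : ∀ e : Sym2 V, ¬ e.IsDiag → e ∈ X) (M0 : Finset (Sym2 V)) :
    NodeRule (HM X F M0) := by
  intro O Z bs hne hbs hf M B hM0 hO hZ
  have key : ∀ f, ∀ b ∈ bs, (f ∈ O ∨ f ∉ insert b.1 b.2.2) →
      MakerWins X F true M (insert f B) := by
    intro f b hb hfb
    obtain ⟨h1, h2, h3, h4⟩ := hbs b hb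
    have key2 : ∀ e ∈ insert b.1 b.2.2, e ∈ insert f B → e ∈ M := by
      intro e he heB
      rcases Finset.mem_insert.1 heB with rfl | heB
      · rcases hfb with h | h
        · exact hO h
        · exact absurd he h
      · rcases h4 he with h | h
        · exact hZ e h heB
        · exact hO h
    refine maker_step (hX _ h2) ?_ (h1 _ _ ?_ ?_ ?_)
    · by_cases hc : b.1 ∈ insert f B
      · exact Or.inr (key2 _ (Set.mem_insert _ _) hc)
      · exact Or.inl hc
    · exact hM0.trans (Finset.subset_insert _ _)
    · intro e he
      rcases h3 he with rfl | h
      · simp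
      · exact Finset.mem_coe.2 (Finset.mem_insert_of_mem (hO h))
    · intro e he heB
      exact Finset.mem_insert_of_mem (key2 e (Set.mem_insert_of_mem _ he) heB)
  obtain ⟨b0, hb0⟩ := hne
  refine breaker_step ⟨b0.1, hX _ (hbs b0 hb0).2.1⟩ ?_
  intro f _
  by_cases hfO : f ∈ O
  · exact key f b0 hb0 (Or.inl hfO)
  · obtain ⟨b, hb, hfb⟩ := hf f hfO
    exact key f b hb (Or.inr hfb)

theorem ruleB (hX : ∀ e : Sym2 V, ¬ e.IsDiag → e ∈ X) : NodeRule (HB X F) := by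
  intro O Z bs hne hbs hf M B hO hZ hd hwin
  have key : ∀ M' , ∀ b ∈ bs, Disjoint M' B → (∀ e ∈ insert b.1 b.2.2, e ∈ M' → e ∈ M) →
      ¬ MakerWins X F true M' (insert b.1 B) := by
    intro M' b hb hd' hM'
    obtain ⟨h1, h2, h3, h4⟩ := hbs b hb
    have key2 : ∀ e ∈ insert b.1 b.2.2, e ∈ M' → e ∈ B := by
      intro e he heM
      rcases h4 he with h | h
      · exact hZ e h (hM' e he heM)
      · exact hO h
    refine h1 _ _ ?_ ?_ ?_
    · intro e he
      rcases h3 he with rfl | h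
      · simp
      · exact Finset.mem_coe.2 (Finset.mem_insert_of_mem (hO h))
    · intro e he heM
      exact Finset.mem_insert_of_mem (key2 e (Set.mem_insert_of_mem _ he) heM)
    · rw [Finset.disjoint_insert_right]
      refine ⟨fun hm => ?_, hd'⟩
      exact Finset.disjoint_left.1 hd' hm (key2 _ (Set.mem_insert _ _) hm)
  cases hwin with
  | claim A hA hAM =>
    obtain ⟨b, hb⟩ := hne
    exact key M b hb hd (fun e _ h => h) (.claim A hA hAM)
  | makerMove f hfX hfM hfB hw =>
    obtain ⟨b, hb, hfb⟩ := hf f (fun h => hfB (hO h))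
    have hd' : Disjoint (insert f M) B := Finset.disjoint_insert_left.2 ⟨hfB, hd⟩
    have hM' : ∀ e ∈ insert b.1 b.2.2, e ∈ insert f M → e ∈ M := by
      intro e he heM
      rcases Finset.mem_insert.1 heM with rfl | h
      · exact absurd he hfb
      · exact h
    refine key _ b hb hd' hM' ?_
    have hm : b.1 ∉ insert f M := by
      intro hm
      have h1 := hM' _ (Set.mem_insert _ _) hm
      rcases (hbs b hb).2.2.2 (Set.mem_insert _ _) with h | h
      · exact Finset.disjoint_left.1 hd h1 (hZ _ h h1)
      · exact Finset.disjoint_left.1 hd h1 (hO h)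
    by_cases hmB : b.1 ∈ B
    · rw [Finset.insert_eq_of_mem hmB]
      exact tempo hw
    · cases hw with
      | claim A hA hAM => exact .claim A hA hAM
      | breakerMove e he heM heB h => exact h _ (hX _ (hbs b hb).2.1) hm hmB
end

/-! ### Paths as lists -/

/-- Edges joining consecutive entries of a list. -/
def ledges {V : Type} : List V → List (Sym2 V)
  | a :: b :: t => s(a, b) :: ledges (b :: t)
  | _ => []

section
variable {V : Type}

theorem mem_ledges {e : Sym2 V} {l : List V} :
    e ∈ ledges l ↔ ∃ l₁ a b l₂, l = l₁ ++ a :: b :: l₂ ∧ e = s(a, b) := by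
  induction l with
  | nil => simp [ledges]
  | cons x t ih =>
    cases t with
    | nil =>
      simp only [ledges, List.not_mem_nil, false_iff]
      rintro ⟨l₁, a, b, l₂, h, -⟩
      have := congrArg List.length h
      simp at this
      omega
    | cons y t =>
      rw [ledges, List.mem_cons, ih]
      constructor
      · rintro (h | ⟨l₁, a, b, l₂, h, he⟩)
        · exact ⟨[], x, y, t, rfl, h⟩
        · exact ⟨x :: l₁, a, b, l₂, by rw [h]; rfl, he⟩
      · rintro ⟨l₁, a, b, l₂, h, he⟩
        cases l₁ with
        | nil =>
          left
          simp at h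
          rw [he, h.1, h.2.1]
        | cons z l₁ =>
          right
          simp at h
          exact ⟨l₁, a, b, l₂, h.2, he⟩

theorem mem_ledges_reverse {e : Sym2 V} {l : List V} : e ∈ ledges l.reverse ↔ e ∈ ledges l := by
  have : ∀ l : List V, e ∈ ledges l → e ∈ ledges l.reverse := by
    intro l h
    obtain ⟨l₁, a, b, l₂, rfl, he⟩ := mem_ledges.1 h
    exact mem_ledges.2 ⟨l₂.reverse, b, a, l₁.reverse, by simp, by rw [he, Sym2.eq_swap]⟩
  exact ⟨fun h => by simpa using this _ h, this l⟩

theorem swap_path {N i d : ℕ} (hc : i = 0 ∧ d = 1 ∨ 2 ≤ i) (hi : i + d < N)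
    {p : List ℕ} (hp : p.Perm (List.range' 2 (N - 2))) :
    ∃ p' : List ℕ, p'.Perm (List.range' 2 (N - 2)) ∧ ∀ (φ : ℕ → V) e,
      e ∈ ledges ((0 :: p ++ [1]).map (fun x => φ (Equiv.swap i (i + d) x))) ↔
        e ∈ ledges ((0 :: p' ++ [1]).map φ) := by
  have hmem : ∀ x ∈ p, 2 ≤ x ∧ x < N := by
    intro x hx
    have := hp.mem_iff.1 hx
    rw [List.mem_range'_1] at this
    omega
  rcases hc with ⟨rfl, rfl⟩ | hi2
  · refine ⟨p.reverse, (List.reverse_perm p).trans hp, ?_⟩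
    intro φ e
    rw [← mem_ledges_reverse]
    have hm : p.map (fun x => φ (Equiv.swap 0 (0 + 1) x)) = p.map φ := by
      apply List.map_congr_left
      intro x hx
      have := hmem x hx
      rw [Equiv.swap_apply_of_ne_of_ne (by omega) (by omega)]
    have : ((0 :: p ++ [1]).map (fun x => φ (Equiv.swap 0 (0 + 1) x))).reverse =
        (0 :: p.reverse ++ [1]).map φ := by
      simp only [List.cons_append, List.map_cons, List.map_append, List.reverse_cons,
        List.reverse_append, List.map_nil, hm]
      simp
    rw [this]
  · refine ⟨p.map (Equiv.swap i (i + d)), ?_, ?_⟩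
    · have hr : (p.map (Equiv.swap i (i + d))).Nodup :=
        (hp.nodup_iff.2 List.nodup_range').map (Equiv.injective _)
      rw [List.perm_ext_iff_of_nodup hr List.nodup_range']
      intro x
      rw [List.mem_map]
      constructor
      · rintro ⟨y, hy, rfl⟩
        have := hmem y hy
        rw [List.mem_range'_1, Equiv.swap_apply_def]
        split_ifs <;> omega
      · intro hx
        refine ⟨Equiv.swap i (i + d) x, ?_, by simp⟩
        rw [hp.mem_iff]
        rw [List.mem_range'_1] at hx ⊢
        rw [Equiv.swap_apply_def]
        split_ifs <;> omega
    · intro φ e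
      have : (0 :: p ++ [1]).map (fun x => φ (Equiv.swap i (i + d) x)) =
          (0 :: p.map (Equiv.swap i (i + d)) ++ [1]).map φ := by
        have h0 : Equiv.swap i (i + d) 0 = 0 := Equiv.swap_apply_of_ne_of_ne (by omega) (by omega)
        have h1 : Equiv.swap i (i + d) 1 = 1 := Equiv.swap_apply_of_ne_of_ne (by omega) (by omega)
        simp only [List.cons_append, List.map_cons, List.map_append, List.map_map, h0, h1,
          List.map_nil]
        rfl
      rw [this]

/-- Labellings for Maker's certificates. -/
def LabM (N : ℕ) (F : Set (Finset (Sym2 V))) (M0 : Finset (Sym2 V)) (φ : ℕ → V) : Prop :=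
  (∀ p < N, ∀ q < N, φ p = φ q → p = q) ∧ ∀ p : List ℕ, p.Perm (List.range' 2 (N - 2)) →
    ∃ A ∈ F, ∀ e ∈ A, e ∈ M0 ∨ e ∈ ledges ((0 :: p ++ [1]).map φ)

/-- Labellings for Breaker's certificates. -/
def LabB (N : ℕ) (F : Set (Finset (Sym2 V))) (φ : ℕ → V) : Prop :=
  (∀ p < N, ∀ q < N, φ p = φ q → p = q) ∧ ∀ A ∈ F, ∃ p : List ℕ,
    p.Perm (List.range' 2 (N - 2)) ∧ ∀ e ∈ ledges ((0 :: p ++ [1]).map φ), e ∈ A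

theorem labM_ok (N : ℕ) (F : Set (Finset (Sym2 V))) (M0 : Finset (Sym2 V)) :
    LabOK N (LabM N F M0) where
  inj := fun φ h => h.1
  swap := by
    intro φ hφ i d hd hc hi
    refine ⟨?_, ?_⟩
    · intro p hp q hq h
      exact (Equiv.swap i (i + d)).injective (hφ.1 _ (swap_lt hi hp) _ (swap_lt hi hq) h)
    · intro p hp
      obtain ⟨p', hp', h⟩ := swap_path (V := V) hc hi hp
      obtain ⟨A, hA, hAe⟩ := hφ.2 p' hp'
      exact ⟨A, hA, fun e he => (hAe e he).imp id (h φ e).2⟩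

theorem labB_ok (N : ℕ) (F : Set (Finset (Sym2 V))) : LabOK N (LabB N F) where
  inj := fun φ h => h.1
  swap := by
    intro φ hφ i d hd hc hi
    refine ⟨?_, ?_⟩
    · intro p hp q hq h
      exact (Equiv.swap i (i + d)).injective (hφ.1 _ (swap_lt hi hp) _ (swap_lt hi hq) h)
    · intro A hA
      obtain ⟨p, hp, hpA⟩ := hφ.2 A hA
      obtain ⟨p', hp', h⟩ := swap_path (V := V) hc hi hp
      refine ⟨p', hp', fun e he => hpA e ?_⟩
      have := (h (fun x => φ (Equiv.swap i (i + d) x)) e).2 he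
      simpa using this

/-- All edges of the path are in the matrix. -/
def allE (N w : ℕ) : List ℕ → Bool
  | a :: b :: t => (Nat.ble (a + 1) N && Nat.ble (b + 1) N && bit w 0 a b) && allE N w (b :: t)
  | _ => true

/-- Some edge of the path is in the matrix. -/
def anyE (N w : ℕ) : List ℕ → Bool
  | a :: b :: t => (Nat.ble (a + 1) N && Nat.ble (b + 1) N && bit w 0 a b) || anyE N w (b :: t)
  | _ => false

theorem allE_sound (N w : ℕ) (φ : ℕ → V) : ∀ l, allE N w l = true →
    ∀ e ∈ ledges (l.map φ), e ∈ eset N φ w 0 := by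
  intro l
  induction l with
  | nil => simp [ledges]
  | cons a t ih =>
    cases t with
    | nil => simp [ledges]
    | cons b t =>
      intro h e he
      rw [allE] at h
      simp only [Bool.and_eq_true] at h
      simp only [List.map_cons, ledges, List.mem_cons] at he
      rcases he with rfl | he
      · exact ⟨a, b, Nat.le_of_ble_eq_true h.1.1.1, Nat.le_of_ble_eq_true h.1.1.2, h.1.2, rfl⟩
      · exact ih h.2 e (by simpa using he)

theorem anyE_sound (N w : ℕ) (φ : ℕ → V) : ∀ l, anyE N w l = true →
    ∃ e ∈ ledges (l.map φ), e ∈ eset N φ w 0 := by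
  intro l
  induction l with
  | nil => simp [anyE]
  | cons a t ih =>
    cases t with
    | nil => simp [anyE]
    | cons b t =>
      intro h
      rw [anyE] at h
      simp only [Bool.or_eq_true, Bool.and_eq_true] at h
      simp only [List.map_cons, ledges, List.mem_cons]
      rcases h with h | h
      · exact ⟨_, Or.inl rfl, a, b, Nat.le_of_ble_eq_true h.1.1, Nat.le_of_ble_eq_true h.1.2,
          h.2, rfl⟩
      · obtain ⟨e, he, h2⟩ := ih h
        exact ⟨e, Or.inr (by simpa using he), h2⟩

/-- Symmetry test. -/
def symB (w : ℕ) : Bool :=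
  decide (∀ h : ℕ, h < 2 → ∀ p : ℕ, p < 8 → ∀ q : ℕ, q < 8 → bit w h p q = bit w h q p)

theorem symB_sound {w : ℕ} (h : symB w = true) : Symm w := by
  unfold symB at h
  have h2 := of_decide_eq_true h
  exact h2

theorem leafM [DecidableEq V] {X : Finset (Sym2 V)} {F : Set (Finset (Sym2 V))}
    {M0 : Finset (Sym2 V)} {N w : ℕ} (h1 : symB w = true)
    (h2 : allE N w (0 :: List.range' 2 (N - 2) ++ [1]) = true) :
    Valid N (LabM N F M0) (HM X F M0) w := by
  refine ⟨symB_sound h1, ?_⟩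
  intro φ hφ M B hM0 hO _
  obtain ⟨A, hA, hAe⟩ := hφ.2 _ (List.Perm.refl _)
  refine .claim A hA ?_
  intro e he
  rcases hAe e he with h | h
  · exact hM0 h
  · exact hO (allE_sound N w φ _ h2 e h)

theorem leafB [DecidableEq V] {X : Finset (Sym2 V)} {F : Set (Finset (Sym2 V))}
    {N w : ℕ} (h1 : symB w = true)
    (h2 : ((List.range' 2 (N - 2)).permutations'.all
      (fun p => anyE N w (0 :: p ++ [1]))) = true) :
    Valid N (LabB N F) (HB X F) w := by
  refine ⟨symB_sound h1, ?_⟩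
  intro φ hφ M B hO _ hd hwin
  refine not_wins hwin hd ?_
  intro A hA
  obtain ⟨p, hp, hpA⟩ := hφ.2 A hA
  rw [List.all_eq_true] at h2
  obtain ⟨e, he, heO⟩ := anyE_sound N w φ _ (h2 p (List.mem_permutations'.2 hp))
  exact ⟨e, hpA e he, hO heO⟩
end

end FHP

/-! ### Reduction of large boards to eight vertices -/

namespace FHP

section
variable {V : Type} [DecidableEq V] {X : Finset (Sym2 V)} {F : Set (Finset (Sym2 V))}

/-- Every path from `a` to `b` through `J` together with `M` contains a winning set. -/
def Ext (F : Set (Finset (Sym2 V))) (M : Finset (Sym2 V)) (J : Finset V) (a b : V) : Prop :=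
  ∀ q : List V, q.Nodup → q.toFinset = J →
    ∃ A ∈ F, ∀ e ∈ A, e ∈ M ∨ e ∈ ledges (a :: q ++ [b])

theorem ext_symm {M : Finset (Sym2 V)} {J : Finset V} {a b : V} (h : Ext F M J a b) :
    Ext F M J b a := by
  intro q hq hJ
  obtain ⟨A, hA, hAe⟩ := h q.reverse (List.nodup_reverse.2 hq) (by rw [List.toFinset_reverse, hJ])
  refine ⟨A, hA, fun e he => (hAe e he).imp id ?_⟩
  intro h
  rw [← mem_ledges_reverse] at h
  simpa using h

theorem ext_left {M : Finset (Sym2 V)} {J : Finset V} {a b w : V} (h : Ext F M J a b)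
    (hw : w ∈ J) : Ext F (insert s(a, w) M) (J.erase w) w b := by
  intro q hq hJ
  have hwq : w ∉ q := by
    rw [← List.mem_toFinset, hJ]
    simp
  obtain ⟨A, hA, hAe⟩ := h (w :: q) (List.nodup_cons.2 ⟨hwq, hq⟩)
    (by rw [List.toFinset_cons, hJ, Finset.insert_erase hw])
  refine ⟨A, hA, fun e he => ?_⟩
  rcases hAe e he with h | h
  · exact Or.inl (Finset.mem_insert_of_mem h)
  · simp only [List.cons_append, ledges, List.mem_cons] at h
    rcases h with rfl | h
    · exact Or.inl (Finset.mem_insert_self _ _)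
    · exact Or.inr h

/-- Maker wins the restricted game with `k` inner vertices. -/
def Good (X : Finset (Sym2 V)) (F : Set (Finset (Sym2 V))) (k : ℕ) : Prop :=
  ∀ (M B : Finset (Sym2 V)) (J : Finset V) (a b y : V), J.card = k → a ∉ J → b ∉ J → a ≠ b →
    y ∈ J → Ext F M J a b →
    (∀ e ∈ B, (∀ x ∈ e, x ∈ insert a (insert b J)) → e = s(a, y) ∨ e = s(a, b)) →
    MakerWins X F false M B

theorem good_left {k : ℕ} (hX : ∀ e : Sym2 V, ¬ e.IsDiag → e ∈ X) (hG : Good X F k)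
    {M B : Finset (Sym2 V)} {J : Finset V} {a b y w : V} (hJ : J.card = k + 1) (ha : a ∉ J)
    (hb : b ∉ J) (hab : a ≠ b) (hext : Ext F M J a b)
    (hB : ∀ e ∈ B, (∀ x ∈ e, x ∈ insert a (insert b J)) → e = s(a, y) ∨ e = s(a, b))
    {f : Sym2 V} (hw : w ∈ J) (hwy : w ≠ y) (hwf : s(a, w) ≠ f) {y' : V} (hy' : y' ∈ J.erase w)
    (hf : (∀ x ∈ f, x ∈ insert w (insert b (J.erase w))) → f = s(w, y') ∨ f = s(b, y')) :
    MakerWins X F true M (insert f B) := by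
  have haw : a ≠ w := fun h => ha (h ▸ hw)
  have hbw : b ≠ w := fun h => hb (h ▸ hw)
  have h1 : s(a, w) ∉ insert f B := by
    intro h
    rcases Finset.mem_insert.1 h with h | h
    · exact hwf h
    · rcases hB _ h (by simp [hw]) with h | h
      · rcases Sym2.eq_iff.1 h with ⟨-, h⟩ | ⟨h1, h2⟩
        · exact hwy h
        · exact haw h2.symm
      · rcases Sym2.eq_iff.1 h with ⟨-, h⟩ | ⟨h1, h2⟩
        · exact hbw h.symm
        · exact hab h1
  refine maker_step (hX _ (by simpa using haw)) (Or.inl h1) ?_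
  have hBR : ∀ e ∈ B, ¬ (∀ x ∈ e, x ∈ insert w (insert b (J.erase w))) := by
    intro e he hins
    have hR : ∀ x ∈ e, x ∈ insert a (insert b J) := by
      intro x hx
      have := hins x hx
      simp only [Finset.mem_insert, Finset.mem_erase] at this ⊢
      rcases this with rfl | h | h
      · exact Or.inr (Or.inr hw)
      · exact Or.inr (Or.inl h)
      · exact Or.inr (Or.inr h.2)
    have hae : a ∈ e := by
      rcases hB e he hR with rfl | rfl <;> simp
    have := hins a hae
    simp only [Finset.mem_insert, Finset.mem_erase] at this
    rcases this with h | h | h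
    · exact haw h
    · exact hab h
    · exact ha h.2
  have hcard : (J.erase w).card = k := by rw [Finset.card_erase_of_mem hw, hJ]; rfl
  have hb' : b ∉ J.erase w := fun h => hb (Finset.mem_of_mem_erase h)
  by_cases hc : f = s(b, y')
  · refine hG _ _ (J.erase w) b w y' hcard hb' (by simp) hbw hy' (ext_symm (ext_left hext hw)) ?_
    intro e he hins
    rcases Finset.mem_insert.1 he with rfl | he
    · exact Or.inl hc
    · exact absurd (fun x hx => by rw [Finset.insert_comm]; exact hins x hx) (hBR e he)
  · refine hG _ _ (J.erase w) w b y' hcard (by simp) hb' hbw.symm hy' (ext_left hext hw) ?_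
    intro e he hins
    rcases Finset.mem_insert.1 he with rfl | he
    · exact Or.inl ((hf hins).resolve_right hc)
    · exact absurd hins (hBR e he)

theorem good_step {k : ℕ} (hk : 6 ≤ k) (hX : ∀ e : Sym2 V, e ∈ X ↔ ¬ e.IsDiag)
    (hG : Good X F k) : Good X F (k + 1) := by
  intro M B J a b y hJ ha hb hab hy hext hB
  have hX' : ∀ e : Sym2 V, ¬ e.IsDiag → e ∈ X := fun e => (hX e).2
  refine breaker_step ⟨s(a, b), hX' _ (by simpa using hab)⟩ ?_
  intro f hfX
  have hfd := (hX f).1 hfX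
  -- a generic vertex
  have hgen : ∀ x z : V, ∃ w ∈ J, w ≠ y ∧ w ≠ x ∧ w ≠ z := by
    intro x z
    have h1 : (J.erase y).card = k := by rw [Finset.card_erase_of_mem hy, hJ]; rfl
    have h2 := Finset.pred_card_le_card_erase (s := J.erase y) (a := x)
    have h3 := Finset.pred_card_le_card_erase (s := (J.erase y).erase x) (a := z)
    have h4 : (((J.erase y).erase x).erase z).Nonempty := by
      rw [← Finset.card_pos]; omega
    obtain ⟨w, hw⟩ := h4
    simp only [Finset.mem_erase] at hw
    exact ⟨w, hw.2.2.2, hw.2.2.1, hw.2.1, hw.1⟩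
  by_cases hA : a ∈ f ∨ ¬ (∀ x ∈ f, x ∈ insert a (insert b J))
  · obtain ⟨x, z, rfl⟩ : ∃ x z, f = s(x, z) := by
      induction f using Sym2.ind with
      | _ x z => exact ⟨x, z, rfl⟩
    obtain ⟨w, hw, hwy, hwx, hwz⟩ := hgen x z
    refine good_left hX' hG hJ ha hb hab hext hB hw hwy ?_
      (y' := y) (Finset.mem_erase.2 ⟨hwy.symm, hy⟩) ?_
    · intro h
      rcases Sym2.eq_iff.1 h with ⟨-, h⟩ | ⟨-, h⟩
      · exact hwz h
      · exact hwx h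
    · intro hins
      exfalso
      rcases hA with h | h
      · have := hins a h
        simp only [Finset.mem_insert, Finset.mem_erase] at this
        rcases this with h | h | h
        · exact ha (h ▸ hw)
        · exact hab h
        · exact ha h.2
      · apply h
        intro t ht
        have := hins t ht
        simp only [Finset.mem_insert, Finset.mem_erase] at this ⊢
        rcases this with rfl | h | h
        · exact Or.inr (Or.inr hw)
        · exact Or.inr (Or.inl h)
        · exact Or.inr (Or.inr h.2)
  · push Not at hA
    obtain ⟨haf, hins⟩ := hA
    have hmem : ∀ x ∈ f, x = b ∨ x ∈ J := by
      intro x hx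
      have := hins x hx
      simp only [Finset.mem_insert] at this
      rcases this with rfl | h | h
      · exact absurd hx haf
      · exact Or.inl h
      · exact Or.inr h
    by_cases hbf : b ∈ f
    · obtain ⟨z, rfl⟩ := hbf
      have hz : z ∈ J := by
        rcases hmem z (by simp) with rfl | h
        · simp at hfd
        · exact h
      by_cases hzy : z = y
      · subst hzy
        obtain ⟨w, hw, hwy, -, -⟩ := hgen a a
        refine good_left hX' hG hJ ha hb hab hext hB hw hwy ?_
          (y' := z) (Finset.mem_erase.2 ⟨hwy.symm, hy⟩) (fun _ => Or.inr rfl)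
        intro h
        apply haf
        rw [← h]
        simp
      · have hby : b ≠ y := fun h => hb (h ▸ hy)
        have hay : a ≠ y := fun h => ha (h ▸ hy)
        obtain ⟨w, hw, hwy, -, -⟩ := hgen a a
        have h1 : s(b, y) ∉ insert s(b, z) B := by
          intro h
          rcases Finset.mem_insert.1 h with h | h
          · rcases Sym2.eq_iff.1 h with ⟨-, h⟩ | ⟨h1, h2⟩
            · exact hzy h.symm
            · exact hby h2.symm
          · rcases hB _ h (by simp [hy]) with h | h
            · rcases Sym2.eq_iff.1 h with ⟨h, -⟩ | ⟨h1, h2⟩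
              · exact hab h.symm
              · exact hby h1
            · rcases Sym2.eq_iff.1 h with ⟨h, -⟩ | ⟨h1, h2⟩
              · exact hab h.symm
              · exact hay h2.symm
        refine maker_step (hX' _ (by simpa using hby)) (Or.inl h1) ?_
        refine hG _ _ (J.erase y) a y w ?_ (fun h => ha (Finset.mem_of_mem_erase h)) (by simp) hay
          (Finset.mem_erase.2 ⟨hwy, hw⟩) (ext_symm (ext_left (ext_symm hext) hy)) ?_
        · rw [Finset.card_erase_of_mem hy, hJ]; rfl
        · intro e he hins'
          have hbe : b ∉ e := by
            intro h
            have := hins' b h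
            simp only [Finset.mem_insert, Finset.mem_erase] at this
            rcases this with h | h | h
            · exact hab h.symm
            · exact hby h
            · exact hb h.2
          rcases Finset.mem_insert.1 he with rfl | he
          · simp at hbe
          · have hR : ∀ x ∈ e, x ∈ insert a (insert b J) := by
              intro x hx
              have := hins' x hx
              simp only [Finset.mem_insert, Finset.mem_erase] at this ⊢
              rcases this with h | rfl | h
              · exact Or.inl h
              · exact Or.inr (Or.inr hy)
              · exact Or.inr (Or.inr h.2)
            rcases hB e he hR with rfl | rfl
            · exact Or.inr rfl
            · simp at hbe
    · have hJf : ∀ x ∈ f, x ∈ J := by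
        intro x hx
        rcases hmem x hx with rfl | h
        · exact absurd hx hbf
        · exact h
      obtain ⟨c, d, rfl, hcy⟩ : ∃ c d, f = s(c, d) ∧ c ≠ y := by
        induction f using Sym2.ind with
        | _ x z =>
          by_cases hxy : x = y
          · refine ⟨z, x, Sym2.eq_swap, ?_⟩
            rintro rfl
            simp [hxy] at hfd
          · exact ⟨x, z, rfl, hxy⟩
      have hcd : d ≠ c := by
        rintro rfl
        simp at hfd
      refine good_left hX' hG hJ ha hb hab hext hB (hJf c (by simp)) hcy ?_
        (y' := d) (Finset.mem_erase.2 ⟨hcd, hJf d (by simp)⟩) (fun _ => Or.inl rfl)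
      intro h
      apply haf
      rw [← h]
      simp

/-! ### Labellings -/

/-- The labelling given by a list. -/
def lab (a b : V) (l : List V) (i : ℕ) : V := (a :: b :: l).getD i a

theorem lab_lt {a b : V} {l : List V} {i : ℕ} (hi : i < l.length + 2) :
    lab a b l i = (a :: b :: l)[i]'(by simp only [List.length_cons]; omega) := by
  unfold lab
  rw [List.getD_eq_getElem]

theorem lab_inj {a b : V} {l : List V} (h : (a :: b :: l).Nodup) :
    ∀ p < l.length + 2, ∀ q < l.length + 2, lab a b l p = lab a b l q → p = q := by
  intro p hp q hq he
  rw [lab_lt hp, lab_lt hq] at he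
  exact (List.Nodup.getElem_inj_iff h).1 he

theorem lab_map (a b : V) (l : List V) :
    (List.range' 2 (l.length + 2 - 2)).map (lab a b l) = l := by
  apply List.ext_getElem
  · simp
  · intro i h1 h2
    rw [List.getElem_map, List.getElem_range', lab_lt (by omega)]
    have : ∀ j (hj : j < (a :: b :: l).length), j = i + 1 + 1 → (a :: b :: l)[j] = l[i] := by
      rintro j hj rfl
      simp
    exact this _ _ (by ring)

theorem labM_lab {M0 : Finset (Sym2 V)} {J : Finset V} {a b : V} {l : List V}
    (h : (a :: b :: l).Nodup) (hl : l.toFinset = J) (hext : Ext F M0 J a b) :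
    LabM (l.length + 2) F M0 (lab a b l) := by
  refine ⟨lab_inj h, ?_⟩
  intro p hp
  have hq : (p.map (lab a b l)).Perm l := by
    have := hp.map (lab a b l)
    rwa [lab_map] at this
  have hn : l.Nodup := (List.nodup_cons.1 (List.nodup_cons.1 h).2).2
  obtain ⟨A, hA, hAe⟩ := hext (p.map (lab a b l)) (hq.nodup_iff.2 hn)
    (by rw [List.toFinset_eq_of_perm _ _ hq, hl])
  refine ⟨A, hA, fun e he => (hAe e he).imp id ?_⟩
  intro h
  simpa [lab] using h

theorem labB_lab {a b : V} {l : List V} (h : (a :: b :: l).Nodup)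
    (hF : ∀ A ∈ F, ∃ q : List V, q.Perm l ∧ ∀ e ∈ ledges (a :: q ++ [b]), e ∈ A) :
    LabB (l.length + 2) F (lab a b l) := by
  refine ⟨lab_inj h, ?_⟩
  intro A hA
  obtain ⟨q, hq, hqA⟩ := hF A hA
  refine ⟨q.map (fun x => (a :: b :: l).idxOf x), ?_, ?_⟩
  · have h1 := hq.map (fun x => (a :: b :: l).idxOf x)
    refine h1.trans ?_
    have h2 : l.map (fun x => (a :: b :: l).idxOf x) = List.range' 2 (l.length + 2 - 2) := by
      conv_lhs => rw [← lab_map a b l, List.map_map]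
      conv_rhs => rw [← List.map_id (List.range' 2 (l.length + 2 - 2))]
      rw [lab_map]
      apply List.map_congr_left
      intro i hi
      rw [List.mem_range'_1] at hi
      have hi' : i < l.length + 2 := by omega
      simp only [Function.comp, id]
      rw [lab_lt hi']
      exact List.Nodup.idxOf_getElem h _ _
    rw [h2]
  · have hm : (q.map (fun x => (a :: b :: l).idxOf x)).map (lab a b l) = q := by
      rw [List.map_map]
      conv_rhs => rw [← List.map_id q]
      apply List.map_congr_left
      intro x hx
      have hx' : x ∈ a :: b :: l := by
        have := hq.mem_iff.1 hx
        simp [this]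
      have hlt := List.idxOf_lt_length_of_mem hx'
      simp only [Function.comp, id]
      rw [lab_lt (by simpa only [List.length_cons] using hlt)]
      exact List.getElem_idxOf hlt
    intro e he
    apply hqA
    have : (0 :: q.map (fun x => (a :: b :: l).idxOf x) ++ [1]).map (lab a b l) =
        a :: q ++ [b] := by
      rw [List.map_append, List.map_cons, hm]
      rfl
    rwa [this] at he

/-! ### Use of the certificates -/

theorem good_six (hX : ∀ e : Sym2 V, ¬ e.IsDiag → e ∈ X) : Good X F 6 := by
  intro M B J a b y hJ ha hb hab hy hext hB
  have hv : Valid 8 (LabM 8 F M) (HM X F M) 169808226154283146659436149247785828352 := by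
    have hleaf : Valid 8 (LabM 8 F M) (HM X F M) 4800925335842029572 :=
      leafM (by decide +kernel) (by decide +kernel)
    rw [← mak8_run]
    exact valid_result (by norm_num) (by norm_num) (labM_ok 8 F M) (ruleM hX M) hleaf
      (by simpa [mak8_leaves] using hleaf) _
  have hlen : (y :: (J.erase y).toList).length = 6 := by
    rw [List.length_cons, Finset.length_toList, Finset.card_erase_of_mem hy, hJ]
  have hnd : (a :: b :: y :: (J.erase y).toList).Nodup := by
    simp only [List.nodup_cons, List.mem_cons, Finset.mem_toList, Finset.mem_erase]
    refine ⟨?_, ?_, ?_, Finset.nodup_toList _⟩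
    · rintro (h | rfl | h)
      · exact hab h
      · exact ha hy
      · exact ha h.2
    · rintro (rfl | h)
      · exact hb hy
      · exact hb h.2
    · simp
  have htf : (y :: (J.erase y).toList).toFinset = J := by
    rw [List.toFinset_cons, Finset.toList_toFinset, Finset.insert_erase hy]
  have hLab := labM_lab hnd htf hext
  have hinj := lab_inj hnd
  rw [hlen] at hLab hinj
  refine hv.2 _ hLab M B subset_rfl ?_ ?_
  · rintro e ⟨p, q, hp, hq, hb, -⟩
    have : ∀ p < 8, ∀ q < 8, bit 169808226154283146659436149247785828352 0 p q = false := by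
      decide +kernel
    rw [this p hp q hq] at hb
    cases hb
  · rintro e ⟨p, q, hp, hq, hbit, rfl⟩ heB
    exfalso
    have b1 : bit 169808226154283146659436149247785828352 1 0 2 = false := by decide +kernel
    have b2 : bit 169808226154283146659436149247785828352 1 2 0 = false := by decide +kernel
    have b3 : bit 169808226154283146659436149247785828352 1 0 1 = false := by decide +kernel
    have b4 : bit 169808226154283146659436149247785828352 1 1 0 = false := by decide +kernel
    have hin : ∀ p < 8, lab a b (y :: (J.erase y).toList) p ∈ insert a (insert b J) := by
      intro p hp
      rw [lab_lt (by rw [hlen]; exact hp)]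
      have := List.getElem_mem (l := a :: b :: y :: (J.erase y).toList) (n := p)
        (by simp at hlen ⊢; omega)
      have h2 : ∀ x ∈ a :: b :: y :: (J.erase y).toList, x ∈ insert a (insert b J) := by
        intro x hx
        rw [← List.mem_toFinset, List.toFinset_cons, List.toFinset_cons, htf] at hx
        exact hx
      exact h2 _ this
    have e0 : lab a b (y :: (J.erase y).toList) 0 = a := rfl
    have e1 : lab a b (y :: (J.erase y).toList) 1 = b := rfl
    have e2 : lab a b (y :: (J.erase y).toList) 2 = y := rfl
    have hcases := hB _ heB (by
      intro x hx
      rcases Sym2.mem_iff.1 hx with rfl | rfl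
      · exact hin p hp
      · exact hin q hq)
    rcases hcases with h | h
    · rcases Sym2.eq_iff.1 h with ⟨h1, h2⟩ | ⟨h1, h2⟩
      · obtain rfl := hinj p hp 0 (by norm_num) (h1.trans e0.symm)
        obtain rfl := hinj q hq 2 (by norm_num) (h2.trans e2.symm)
        exact absurd (b1.symm.trans hbit) (by simp)
      · obtain rfl := hinj p hp 2 (by norm_num) (h1.trans e2.symm)
        obtain rfl := hinj q hq 0 (by norm_num) (h2.trans e0.symm)
        exact absurd (b2.symm.trans hbit) (by simp)
    · rcases Sym2.eq_iff.1 h with ⟨h1, h2⟩ | ⟨h1, h2⟩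
      · obtain rfl := hinj p hp 0 (by norm_num) (h1.trans e0.symm)
        obtain rfl := hinj q hq 1 (by norm_num) (h2.trans e1.symm)
        exact absurd (b3.symm.trans hbit) (by simp)
      · obtain rfl := hinj p hp 1 (by norm_num) (h1.trans e1.symm)
        obtain rfl := hinj q hq 0 (by norm_num) (h2.trans e0.symm)
        exact absurd (b4.symm.trans hbit) (by simp)

theorem good_all (hX : ∀ e : Sym2 V, e ∈ X ↔ ¬ e.IsDiag) : ∀ k, 6 ≤ k → Good X F k := by
  intro k hk
  induction k, hk using Nat.le_induction with
  | base => exact good_six (fun e => (hX e).2)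
  | succ k hk ih => exact good_step hk hX ih
end

/-! ### Hamiltonian paths of the complete graph -/

theorem edges_eq {V : Type} {G : SimpleGraph V} {a b : V} (p : G.Walk a b) :
    p.edges = ledges p.support := by
  induction p with
  | nil => simp [ledges]
  | @cons a c b h p ih =>
    rw [SimpleGraph.Walk.edges_cons, ih, SimpleGraph.Walk.support_cons]
    cases p with
    | nil => simp [ledges]
    | cons h' p' => simp [ledges]

theorem exists_walk {V : Type} : ∀ (q : List V) (a b : V), (a :: q ++ [b]).Nodup →
    ∃ p : (⊤ : SimpleGraph V).Walk a b, p.support = a :: q ++ [b] := by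
  intro q
  induction q with
  | nil =>
    intro a b h
    have hab : a ≠ b := by simpa using h
    exact ⟨SimpleGraph.Walk.cons (by simpa using hab) .nil, by simp⟩
  | cons c q ih =>
    intro a b h
    rw [List.cons_append, List.nodup_cons] at h
    obtain ⟨p, hp⟩ := ih c b h.2
    have hac : a ≠ c := by
      rintro rfl
      exact h.1 (by simp)
    exact ⟨SimpleGraph.Walk.cons (by simpa using hac) p, by simp [hp]⟩

section
variable {n : ℕ} {u v : Fin n}

theorem mem_board (e : Sym2 (Fin n)) : e ∈ Board n ↔ ¬ e.IsDiag := by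
  unfold Board
  rw [SimpleGraph.mem_edgeFinset, SimpleGraph.edgeSet_top]
  simp

/-- The inner vertices. -/
def inner (u v : Fin n) : Finset (Fin n) := (Finset.univ.erase u).erase v

theorem ext_ham (huv : u ≠ v) : Ext (FixedHamPaths n u v) ∅ (inner u v) u v := by
  intro q hq hJ
  have hm : ∀ x, x ∈ q ↔ x ≠ v ∧ x ≠ u := by
    intro x
    rw [← List.mem_toFinset, hJ, inner]
    simp
  have hnd : (u :: q ++ [v]).Nodup := by
    rw [List.cons_append, List.nodup_cons]
    refine ⟨?_, ?_⟩
    · simp [hm, huv]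
    · rw [List.nodup_append]
      refine ⟨hq, by simp, ?_⟩
      intro x hx y hy
      rw [List.mem_singleton] at hy
      rw [hy]
      exact ((hm x).1 hx).1
  obtain ⟨p, hp⟩ := exists_walk q u v hnd
  refine ⟨p.edges.toFinset, ⟨p, ?_, rfl⟩, ?_⟩
  · intro x
    rw [hp]
    apply List.count_eq_one_of_mem hnd
    by_cases h1 : x = u
    · simp [h1]
    · by_cases h2 : x = v
      · simp [h2]
      · simp [hm, h1, h2]
  · intro e he
    right
    rw [List.mem_toFinset, edges_eq, hp] at he
    exact he

theorem ham_list (huv : u ≠ v) {A : Finset (Sym2 (Fin n))} (hA : A ∈ FixedHamPaths n u v) :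
    ∃ q : List (Fin n), q.Perm (inner u v).toList ∧ ∀ e ∈ ledges (u :: q ++ [v]), e ∈ A := by
  obtain ⟨p, hp, rfl⟩ := hA
  obtain ⟨q, hq⟩ : ∃ q, p.support = u :: q ++ [v] := by
    have h1 := p.cons_tail_support.symm
    have h3 : p.support.getLast (by simp) = v := p.getLast_support
    have h2 : p.support.tail ≠ [] := by
      intro h
      rw [h] at h1
      have : v ∈ p.support := p.end_mem_support
      rw [h1] at this
      simp at this
      exact huv this.symm
    refine ⟨p.support.tail.dropLast, ?_⟩
    have h4 := List.dropLast_append_getLast h2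
    have h5 : p.support.tail.getLast h2 = v := by
      rw [List.getLast_tail, h3]
    rw [h5] at h4
    rw [List.cons_append, h4]
    exact h1
  have hnd : (u :: q ++ [v]).Nodup := by
    rw [← hq]
    exact hp.isPath.support_nodup
  refine ⟨q, ?_, ?_⟩
  · rw [List.cons_append, List.nodup_cons, List.nodup_append] at hnd
    obtain ⟨h1, h2, -, h3⟩ := hnd
    rw [List.perm_ext_iff_of_nodup h2 (Finset.nodup_toList _)]
    intro x
    have hx : x ∈ p.support := hp.mem_support x
    rw [hq] at hx
    rw [Finset.mem_toList, inner]
    simp only [Finset.mem_erase, Finset.mem_univ, and_true]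
    constructor
    · intro h
      refine ⟨h3 x h v (by simp), ?_⟩
      rintro rfl
      exact h1 (by simp [h])
    · rintro ⟨n1, n2⟩
      simpa [n1, n2] using hx
  · intro e he
    rw [List.mem_toFinset, edges_eq, hq]
    exact he

theorem inner_card (huv : u ≠ v) : (inner u v).card = n - 2 := by
  unfold inner
  rw [Finset.card_erase_of_mem (by simp [huv.symm]), Finset.card_erase_of_mem (by simp)]
  simp
  omega

theorem inner_nodup (huv : u ≠ v) : (u :: v :: (inner u v).toList).Nodup := by
  simp only [List.nodup_cons, List.mem_cons, Finset.mem_toList, inner, Finset.mem_erase]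
  exact ⟨by simp [huv], by simp, Finset.nodup_toList _⟩

theorem inner_length (hn : 4 ≤ n) (huv : u ≠ v) : (inner u v).toList.length + 2 = n := by
  rw [Finset.length_toList, inner_card huv]
  omega

theorem labM_ham (hn : 4 ≤ n) (huv : u ≠ v) :
    LabM n (FixedHamPaths n u v) ∅ (lab u v (inner u v).toList) := by
  have := labM_lab (inner_nodup huv) (Finset.toList_toFinset _) (ext_ham huv)
  rwa [inner_length hn huv] at this

theorem labB_ham (hn : 4 ≤ n) (huv : u ≠ v) :
    LabB n (FixedHamPaths n u v) (lab u v (inner u v).toList) := by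
  have := labB_lab (inner_nodup huv) (F := FixedHamPaths n u v) (fun A hA => ham_list huv hA)
  rwa [inner_length hn huv] at this

theorem second_of_eight (hn : 8 ≤ n) (huv : u ≠ v) :
    MakerWinsSecond (Board n) (FixedHamPaths n u v) := by
  have hc := inner_card huv
  obtain ⟨y, hy⟩ : (inner u v).Nonempty := by rw [← Finset.card_pos]; omega
  exact good_all mem_board (n - 2) (by omega) ∅ ∅ (inner u v) u v y hc (by simp [inner])
    (by simp [inner]) huv hy (ext_ham huv) (by simp)

/-- Test of all leaves of a Breaker certificate. -/
def leavesB (N : ℕ) (leaves : List ℕ) : Bool :=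
  leaves.all (fun w => symB w && (List.range' 2 (N - 2)).permutations'.all
      (fun p => anyE N w (0 :: p ++ [1])))

theorem breaker_cert {N w0 root : ℕ} {leaves : List ℕ} {cert : List (List ℕ)} (hN4 : 4 ≤ N)
    (hN : N ≤ 8) (hl : leavesB N leaves = true) (h0 : w0 ∈ leaves)
    (hrun : result N w0 leaves cert = root) {u v : Fin N} (huv : u ≠ v) :
    HB (Board N) (FixedHamPaths N u v) (eset N (lab u v (inner u v).toList) root 0)
      (eset N (lab u v (inner u v).toList) root 1) := by
  have hv : ∀ w ∈ leaves, Valid N (LabB N (FixedHamPaths N u v))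
      (HB (Board N) (FixedHamPaths N u v)) w := by
    intro w hw
    have := List.all_eq_true.1 hl w hw
    rw [Bool.and_eq_true] at this
    exact leafB this.1 this.2
  have := valid_result hN hN4 (labB_ok N _) (ruleB (fun e => (mem_board e).2)) (hv w0 h0) hv cert
  rw [hrun] at this
  exact this.2 _ (labB_ham hN4 huv)

theorem not_first {root : ℕ} (h : HB (Board n) (FixedHamPaths n u v)
      (eset n (lab u v (inner u v).toList) root 0) (eset n (lab u v (inner u v).toList) root 1))
    (hO : ∀ p < n, ∀ q < n, bit root 0 p q = false) :
    ¬ MakerWinsFirst (Board n) (FixedHamPaths n u v) := by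
  refine h ∅ ∅ ?_ (by simp) (by simp)
  rintro e ⟨p, q, hp, hq, hb, -⟩
  rw [hO p hp q hq] at hb
  cases hb

theorem not_first_six (hn : 4 ≤ n) (hn6 : n ≤ 6) (huv : u ≠ v) :
    ¬ MakerWinsFirst (Board n) (FixedHamPaths n u v) := by
  have : n = 4 ∨ n = 5 ∨ n = 6 := by omega
  rcases this with rfl | rfl | rfl
  · exact not_first (breaker_cert (by norm_num) (by norm_num) (leaves := brk4_leaves)
      (by decide +kernel) (by decide +kernel) brk4_run huv) (by decide +kernel)
  · exact not_first (breaker_cert (by norm_num) (by norm_num) (leaves := brk5_leaves)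
      (by decide +kernel) (by decide +kernel) brk5_run huv) (by decide +kernel)
  · exact not_first (breaker_cert (by norm_num) (by norm_num) (leaves := brk6_leaves)
      (by decide +kernel) (by decide +kernel) brk6_run huv) (by decide +kernel)

theorem not_second_seven {u v : Fin 7} (huv : u ≠ v) :
    ¬ MakerWinsSecond (Board 7) (FixedHamPaths 7 u v) := by
  intro hw
  have h := breaker_cert (by norm_num) (by norm_num) (leaves := brk7_leaves)
      (by decide +kernel) (by decide +kernel) brk7_run huv
  have hinj := (labB_ham (by norm_num) huv).1
  have hw2 : MakerWins (Board 7) (FixedHamPaths 7 u v) true ∅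
      {s(lab u v (inner u v).toList 0, lab u v (inner u v).toList 2)} := by
    cases hw with
    | claim A hA hAM => exact .claim A hA hAM
    | breakerMove e he heM heB h =>
      refine h _ ((mem_board _).2 ?_) (by simp) (by simp)
      intro hd
      have := hinj 0 (by norm_num) 2 (by norm_num) (Sym2.mk_isDiag_iff.1 hd)
      omega
  refine h _ _ ?_ (by simp) (by simp) hw2
  rintro e ⟨p, q, hp, hq, hb, rfl⟩
  have hbits : ∀ p < 7, ∀ q < 7, bit 329050362302873038415381759707381764 0 p q = true →
      p = 0 ∧ q = 2 ∨ p = 2 ∧ q = 0 := by decide +kernel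
  rcases hbits p hp q hq hb with ⟨rfl, rfl⟩ | ⟨rfl, rfl⟩
  · simp
  · rw [Sym2.eq_swap]; simp

theorem first_seven {u v : Fin 7} (huv : u ≠ v) :
    MakerWinsFirst (Board 7) (FixedHamPaths 7 u v) := by
  have hleaf : Valid 7 (LabM 7 (FixedHamPaths 7 u v) ∅) (HM (Board 7) (FixedHamPaths 7 u v) ∅)
      9658282273226756 := leafM (by decide +kernel) (by decide +kernel)
  have hv : Valid 7 (LabM 7 (FixedHamPaths 7 u v) ∅) (HM (Board 7) (FixedHamPaths 7 u v) ∅)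
      329050361056470592179675375491088384 := by
    rw [← mak7_run]
    exact valid_result (by norm_num) (by norm_num) (labM_ok 7 _ ∅)
      (ruleM (fun e => (mem_board e).2) ∅) hleaf (by simpa [mak7_leaves] using hleaf) _
  have hlab := labM_ham (by norm_num) huv
  have h := hv.2 _ hlab
  have hinj := hlab.1
  refine maker_step (e := s(lab u v (inner u v).toList 2, lab u v (inner u v).toList 3))
    ((mem_board _).2 ?_) (Or.inl (by simp)) (h _ _ (by simp) ?_ (by simp))
  · intro hd
    have := hinj 2 (by norm_num) 3 (by norm_num) (Sym2.mk_isDiag_iff.1 hd)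
    omega
  · rintro e ⟨p, q, hp, hq, hb, rfl⟩
    have hbits : ∀ p < 7, ∀ q < 7, bit 329050361056470592179675375491088384 0 p q = true →
        p = 2 ∧ q = 3 ∨ p = 3 ∧ q = 2 := by decide +kernel
    rcases hbits p hp q hq hb with ⟨rfl, rfl⟩ | ⟨rfl, rfl⟩
    · simp
    · rw [Sym2.eq_swap]; simp
end

end FHP

/-- In the Maker-Breaker Fixed Hamiltonian Path game on `E(K_n)` (`n ≥ 4`) with two
fixed distinct vertices `u, v`: Maker as first player wins iff `n ≥ 7`, and Maker as
second player wins iff `n ≥ 8`. -/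
theorem fixed_hamiltonian_path_game (n : ℕ) (hn : 4 ≤ n) (u v : Fin n) (huv : u ≠ v) :
    (MakerWinsFirst (Board n) (FixedHamPaths n u v) ↔ 7 ≤ n) ∧
    (MakerWinsSecond (Board n) (FixedHamPaths n u v) ↔ 8 ≤ n) := by
  rcases Nat.lt_or_ge n 7 with h7 | h7
  · have h1 := FHP.not_first_six hn (by omega) huv
    refine ⟨⟨fun h => absurd h h1, fun h => by omega⟩,
      ⟨fun h => absurd (FHP.tempo h) h1, fun h => by omega⟩⟩
  · rcases Nat.lt_or_ge n 8 with h8 | h8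
    · obtain rfl : n = 7 := by omega
      exact ⟨⟨fun _ => h7, fun _ => FHP.first_seven huv⟩,
        ⟨fun h => absurd h (FHP.not_second_seven huv), fun h => by omega⟩⟩
    · have h := FHP.second_of_eight h8 huv
      exact ⟨⟨fun _ => h7, fun _ => FHP.tempo h⟩, ⟨fun _ => h8, fun _ => h⟩⟩
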